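/- Let f : [0,1] → [0,1] be a C^3 l-modal map with negative Schwarzian derivative which is non-flat at each of its critical points and has no attracting periodic orbits. Then f has no homterval; consequently, the set of all backward iterates of the critical set, ⋃_{n≥0} f^{-n}({c_1,…,c_l}), is dense in [0,1]. -/

import Mathlib

open Set Metric Filter

noncomputable section

/-- Endpoints of the laps of an `l`-modal map with turning points `c`: the points
`0 = e₀ < c₁ < … < c_l < e_{l+1} = 1`. -/
def lapPts (l : ℕ) (c : Fin l → ℝ) (i : Fin (l + 2)) : ℝ :=
  if h0 : (i : ℕ) = 0 then 0
  else if hl : (i : ℕ) = l + 1 then 1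
  else c ⟨(i : ℕ) - 1, by have := i.isLt; omega⟩

/-- The `i`-th (closed) lap of an `l`-modal map with turning points `c`. -/
def lap (l : ℕ) (c : Fin l → ℝ) (i : Fin (l + 1)) : Set ℝ :=
  Icc (lapPts l c i.castSucc) (lapPts l c i.succ)

/-- `f` is an `l`-modal map of `[0,1]` with turning points `c 0 < … < c (l-1)`:
it maps `[0,1]` into itself, sends the boundary into the boundary, and is strictly
monotone on each of the `l+1` laps, with alternating directions (so that each `c i`
is a local extremum, i.e. a turning point). -/
def IsLModal (l : ℕ) (f : ℝ → ℝ) (c : Fin l → ℝ) : Prop :=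
  StrictMono c ∧ (∀ i, c i ∈ Ioo (0:ℝ) 1) ∧
  MapsTo f (Icc 0 1) (Icc 0 1) ∧
  f 0 ∈ ({0, 1} : Set ℝ) ∧ f 1 ∈ ({0, 1} : Set ℝ) ∧
  ∃ s : Fin (l + 1) → Bool,
    (∀ i : Fin l, s i.castSucc ≠ s i.succ) ∧
    (∀ i, if s i then StrictMonoOn f (lap l c i) else StrictAntiOn f (lap l c i))

/-- The Schwarzian derivative `f'''/f' - (3/2) (f''/f')²`. -/
def schwarzian (f : ℝ → ℝ) (x : ℝ) : ℝ :=
  iteratedDeriv 3 f x / deriv f x - 3/2 * (iteratedDeriv 2 f x / deriv f x) ^ 2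

/-- `f` is non-flat at `x`: there is a `C²` diffeomorphism `φ` with `φ 0 = x` such that
`f ∘ φ` is a polynomial near the origin. -/
def NonFlatAt (f : ℝ → ℝ) (x : ℝ) : Prop :=
  ∃ φ : ℝ → ℝ, ∃ P : Polynomial ℝ, ∃ U ∈ nhds (0:ℝ),
    ContDiff ℝ 2 φ ∧ φ 0 = x ∧ (∀ t, deriv φ t ≠ 0) ∧
    ∀ t ∈ U, f (φ t) = P.eval t

/-- The forward orbit of `p` under `f`. -/
def orbit (f : ℝ → ℝ) (p : ℝ) : Set ℝ := Set.range fun n : ℕ => f^[n] p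

/-- The basin of attraction (inside `[0,1]`) of the periodic orbit of `p`. -/
def basin (f : ℝ → ℝ) (p : ℝ) : Set ℝ :=
  {x ∈ Icc (0:ℝ) 1 |
    Tendsto (fun k : ℕ => Metric.infDist (f^[k] x) (orbit f p)) atTop (nhds 0)}

/-- `f` has an attracting periodic orbit: some periodic orbit whose basin contains a
nonempty open subset of `[0,1]`. -/
def HasAttractingPeriodicOrbit (f : ℝ → ℝ) : Prop :=
  ∃ p ∈ Icc (0:ℝ) 1, ∃ n : ℕ, 1 ≤ n ∧ f^[n] p = p ∧
    ∃ U : Set ℝ, IsOpen U ∧ (U ∩ Icc (0:ℝ) 1).Nonempty ∧ U ∩ Icc (0:ℝ) 1 ⊆ basin f p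

/-- `f` has a homterval: a nondegenerate interval on which every iterate of `f` is
monotone. -/
def HasHomterval (f : ℝ → ℝ) : Prop :=
  ∃ a b : ℝ, a < b ∧ Icc a b ⊆ Icc (0:ℝ) 1 ∧
    ∀ n : ℕ, MonotoneOn (f^[n]) (Icc a b) ∨ AntitoneOn (f^[n]) (Icc a b)


/-! ### Part 1: negative Schwarzian derivative and cross ratios -/

namespace NoHom

theorem sch_hasDerivAt {g : ℝ → ℝ} (hg : ContDiff ℝ 3 g) (x : ℝ) :
    HasDerivAt g (deriv g x) x ∧ HasDerivAt (deriv g) (iteratedDeriv 2 g x) x ∧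
      HasDerivAt (iteratedDeriv 2 g) (iteratedDeriv 3 g x) x := by
  have h0 : Differentiable ℝ g := hg.differentiable (by norm_num)
  have h1 : Differentiable ℝ (iteratedDeriv 1 g) :=
    hg.differentiable_iteratedDeriv 1 (by norm_num)
  have h2 : Differentiable ℝ (iteratedDeriv 2 g) :=
    hg.differentiable_iteratedDeriv 2 (by norm_num)
  refine ⟨(h0 x).hasDerivAt, ?_, ?_⟩
  · have := (h1 x).hasDerivAt
    rw [iteratedDeriv_one] at this
    rw [iteratedDeriv_succ, iteratedDeriv_one]
    exact this
  · have := (h2 x).hasDerivAt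
    have e : iteratedDeriv 3 g x = deriv (iteratedDeriv 2 g) x := by
      rw [iteratedDeriv_succ (n := 2)]
    rw [e]
    exact this

/-- The key infinitesimal inequality for maps with negative Schwarzian derivative. -/
theorem sch_slope {g : ℝ → ℝ} {u v : ℝ} (hg : ContDiff ℝ 3 g)
    (hpos : ∀ x ∈ Ioo u v, 0 < deriv g x) (hS : ∀ x ∈ Ioo u v, schwarzian g x < 0)
    {x y : ℝ} (hx : x ∈ Ioo u v) (hy : y ∈ Ioo u v) (hxy : x < y) :
    deriv g x * deriv g y < ((g y - g x) / (y - x)) ^ 2 := by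
  set φ : ℝ → ℝ := fun t => (√(deriv g t))⁻¹ with hφ
  set φ1 : ℝ → ℝ := fun t => -(iteratedDeriv 2 g t) / (2 * (√(deriv g t)) ^ 3) with hφ1
  set φ2 : ℝ → ℝ := fun t => -(schwarzian g t) / (2 * √(deriv g t)) with hφ2
  have hsub : ∀ t ∈ Icc x y, t ∈ Ioo u v := fun t ht =>
    ⟨lt_of_lt_of_le hx.1 ht.1, lt_of_le_of_lt ht.2 hy.2⟩
  have hr : ∀ t ∈ Ioo u v, 0 < √(deriv g t) := fun t ht => Real.sqrt_pos.2 (hpos t ht)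
  have hsq : ∀ t ∈ Ioo u v, HasDerivAt (fun t => √(deriv g t))
      (iteratedDeriv 2 g t / (2 * √(deriv g t))) t := fun t ht =>
    ((sch_hasDerivAt hg t).2.1).sqrt (hpos t ht).ne'
  have d1 : ∀ t ∈ Ioo u v, HasDerivAt φ (φ1 t) t := by
    intro t ht
    have := (hsq t ht).inv (hr t ht).ne'
    refine HasDerivAt.congr_deriv this ?_
    have := (hr t ht).ne'
    simp only [hφ1]
    field_simp
  have d2 : ∀ t ∈ Ioo u v, HasDerivAt φ1 (φ2 t) t := by
    intro t ht
    have h3 := ((hsq t ht).pow 3).const_mul 2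
    have hne := (hr t ht).ne'
    have := ((sch_hasDerivAt hg t).2.2).neg.div h3 (by simp [hne])
    refine HasDerivAt.congr_deriv this ?_
    simp only [hφ2, schwarzian, Pi.pow_apply, Pi.neg_apply]
    have e : deriv g t = (√(deriv g t)) ^ 2 := (Real.sq_sqrt (hpos t ht).le).symm
    generalize √(deriv g t) = r at *
    rw [e]
    field_simp
    simp
    ring
  have p2 : ∀ t ∈ Ioo u v, 0 < φ2 t := fun t ht => by
    have := hS t ht
    have := hr t ht
    simp only [hφ2]
    apply div_pos <;> linarith
  set b : ℝ → ℝ := fun t => φ x - φ t + (t - x) * φ1 t with hb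
  have db : ∀ t ∈ Ioo u v, HasDerivAt b ((t - x) * φ2 t) t := by
    intro t ht
    have := ((d1 t ht).const_sub (φ x)).add (((hasDerivAt_id t).sub_const x).mul (d2 t ht))
    refine HasDerivAt.congr_deriv this ?_
    simp
  have bmono : StrictMonoOn b (Icc x y) := by
    apply strictMonoOn_of_deriv_pos (convex_Icc x y)
    · exact fun t ht => (db t (hsub t ht)).continuousAt.continuousWithinAt
    · intro t ht
      rw [interior_Icc] at ht
      rw [(db t (hsub t (Ioo_subset_Icc_self ht))).deriv]
      exact mul_pos (by linarith [ht.1]) (p2 t (hsub t (Ioo_subset_Icc_self ht)))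
  have bx : b x = 0 := by simp [hb]
  have bpos : ∀ t ∈ Ioc x y, 0 < b t := by
    intro t ht
    rw [← bx]
    exact bmono (left_mem_Icc.2 hxy.le) (Ioc_subset_Icc_self ht) ht.1
  set H : ℝ → ℝ := fun t => (g t - g x) * φ x - (t - x) * √(deriv g t) with hH
  have dH : ∀ t ∈ Ioo u v, HasDerivAt H (b t * deriv g t) t := by
    intro t ht
    have := (((sch_hasDerivAt hg t).1.sub_const (g x)).mul_const (φ x)).sub
      (((hasDerivAt_id t).sub_const x).mul (hsq t ht))
    refine HasDerivAt.congr_deriv this ?_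
    have e : deriv g t = (√(deriv g t)) ^ 2 := (Real.sq_sqrt (hpos t ht).le).symm
    have hne := (hr t ht).ne'
    simp only [hb, hφ1, id]
    rw [show φ t = (√(deriv g t))⁻¹ from rfl]
    generalize φ x = A
    generalize √(deriv g t) = r at *
    rw [e]
    field_simp
    ring
  have Hmono : StrictMonoOn H (Icc x y) := by
    apply strictMonoOn_of_deriv_pos (convex_Icc x y)
    · exact fun t ht => (dH t (hsub t ht)).continuousAt.continuousWithinAt
    · intro t ht
      rw [interior_Icc] at ht
      have ht' := hsub t (Ioo_subset_Icc_self ht)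
      rw [(dH t ht').deriv]
      exact mul_pos (bpos t ⟨ht.1, ht.2.le⟩) (hpos t ht')
  have Hx : H x = 0 := by simp [hH]
  have Hy : 0 < H y := by
    rw [← Hx]
    exact Hmono (left_mem_Icc.2 hxy.le) (right_mem_Icc.2 hxy.le) hxy
  have rx := hr x hx
  have ry := hr y hy
  have key : √(deriv g x) * √(deriv g y) < (g y - g x) / (y - x) := by
    rw [lt_div_iff₀ (by linarith)]
    have : (y - x) * √(deriv g y) < (g y - g x) * (√(deriv g x))⁻¹ := by
      simpa [hH, hφ] using Hy
    rw [← div_eq_mul_inv, lt_div_iff₀ rx] at this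
    linarith
  have e1 : deriv g x * deriv g y = (√(deriv g x) * √(deriv g y)) ^ 2 := by
    rw [mul_pow, Real.sq_sqrt (hpos x hx).le, Real.sq_sqrt (hpos y hy).le]
  rw [e1]
  exact pow_lt_pow_left₀ key (by positivity) (by norm_num)

theorem sch_strictMono {g : ℝ → ℝ} {u v : ℝ} (hg : ContDiff ℝ 3 g)
    (hpos : ∀ x ∈ Ioo u v, 0 < deriv g x) : StrictMonoOn g (Icc u v) := by
  apply strictMonoOn_of_deriv_pos (convex_Icc u v) hg.continuous.continuousOn
  intro x hx
  rw [interior_Icc] at hx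
  exact hpos x hx

/-- One-sided density inequality, right side. -/
theorem sch_right {g : ℝ → ℝ} {u v : ℝ} (hg : ContDiff ℝ 3 g)
    (hpos : ∀ x ∈ Ioo u v, 0 < deriv g x) (hS : ∀ x ∈ Ioo u v, schwarzian g x < 0)
    {x q w : ℝ} (hx : x ∈ Ioo u v) (hxq : x < q) (hqw : q < w) (hw : w ≤ v) :
    deriv g x * (1 / (g q - g x) - 1 / (g w - g x)) < 1 / (q - x) - 1 / (w - x) := by
  have hm := sch_strictMono hg hpos
  have hgx : ∀ y ∈ Icc q w, 0 < g y - g x := fun y hy => by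
    have := hm ⟨hx.1.le, hx.2.le⟩ (b := y) ⟨by linarith [hx.1, hy.1], by linarith [hy.2]⟩
      (by linarith [hy.1])
    linarith
  set k : ℝ → ℝ := fun y => deriv g x / (g y - g x) - 1 / (y - x) with hk
  have dk : ∀ y ∈ Icc q w, HasDerivAt k
      (-(deriv g x * deriv g y) / (g y - g x) ^ 2 + 1 / (y - x) ^ 2) y := by
    intro y hy
    have h1 := (hasDerivAt_const y (deriv g x)).div ((sch_hasDerivAt hg y).1.sub_const (g x))
      (hgx y hy).ne'
    have h2 := (hasDerivAt_const y (1:ℝ)).div ((hasDerivAt_id y).sub_const x)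
      (by simp; linarith [hy.1])
    refine HasDerivAt.congr_deriv (h1.sub h2) ?_
    simp
    ring
  have : StrictMonoOn k (Icc q w) := by
    apply strictMonoOn_of_deriv_pos (convex_Icc q w)
    · exact fun t ht => (dk t ht).continuousAt.continuousWithinAt
    · intro y hy
      rw [interior_Icc] at hy
      have hy' := Ioo_subset_Icc_self hy
      rw [(dk y hy').deriv]
      have := sch_slope hg hpos hS hx (y := y) ⟨by linarith [hx.1, hy.1], by linarith [hy.2]⟩
        (by linarith [hy.1])
      have h3 := hgx y hy'
      have h4 : 0 < y - x := by linarith [hy.1]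
      rw [div_pow, lt_div_iff₀ (by positivity)] at this
      rw [div_add_div _ _ (by positivity) (by positivity)]
      apply div_pos _ (by positivity)
      linarith
  have := this (left_mem_Icc.2 hqw.le) (right_mem_Icc.2 hqw.le) hqw
  simp only [hk] at this
  rw [mul_sub, mul_one_div, mul_one_div]
  linarith

/-- One-sided density inequality, left side. -/
theorem sch_left {g : ℝ → ℝ} {u v : ℝ} (hg : ContDiff ℝ 3 g)
    (hpos : ∀ x ∈ Ioo u v, 0 < deriv g x) (hS : ∀ x ∈ Ioo u v, schwarzian g x < 0)
    {x q w : ℝ} (hx : x ∈ Ioo u v) (hxq : q < x) (hqw : w < q) (hw : u ≤ w) :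
    deriv g x * (1 / (g x - g q) - 1 / (g x - g w)) < 1 / (x - q) - 1 / (x - w) := by
  have hm := sch_strictMono hg hpos
  have hgx : ∀ y ∈ Icc w q, 0 < g x - g y := fun y hy => by
    have := hm (a := y) ⟨by linarith [hy.1], by linarith [hy.2, hx.2]⟩ ⟨hx.1.le, hx.2.le⟩ 
      (by linarith [hy.2])
    linarith
  set k : ℝ → ℝ := fun y => deriv g x / (g x - g y) - 1 / (x - y) with hk
  have dk : ∀ y ∈ Icc w q, HasDerivAt k
      ((deriv g x * deriv g y) / (g x - g y) ^ 2 - 1 / (x - y) ^ 2) y := by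
    intro y hy
    have h1 := (hasDerivAt_const y (deriv g x)).div ((sch_hasDerivAt hg y).1.const_sub (g x))
      (hgx y hy).ne'
    have h2 := (hasDerivAt_const y (1:ℝ)).div ((hasDerivAt_id y).const_sub x)
      (by simp; linarith [hy.2])
    refine HasDerivAt.congr_deriv (h1.sub h2) ?_
    simp
  have : StrictAntiOn k (Icc w q) := by
    apply strictAntiOn_of_deriv_neg (convex_Icc w q)
    · exact fun t ht => (dk t ht).continuousAt.continuousWithinAt
    · intro y hy
      rw [interior_Icc] at hy
      have hy' := Ioo_subset_Icc_self hy
      rw [(dk y hy').deriv]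
      have := sch_slope hg hpos hS (x := y) (y := x)
        ⟨by linarith [hy.1], by linarith [hy.2, hx.2]⟩ hx (by linarith [hy.2])
      have h3 := hgx y hy'
      have h4 : 0 < x - y := by linarith [hy.2]
      rw [div_pow, lt_div_iff₀ (by positivity)] at this
      rw [div_sub_div _ _ (by positivity) (by positivity)]
      apply div_neg_of_neg_of_pos _ (by positivity)
      linarith
  have := this (left_mem_Icc.2 hqw.le) (right_mem_Icc.2 hqw.le) hqw
  simp only [hk] at this
  rw [mul_sub, mul_one_div, mul_one_div]
  linarith

/-- The cross ratio of four points. -/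
def cr (u a b v : ℝ) : ℝ := ((v - u) * (b - a)) / ((a - u) * (v - b))

theorem cr_neg (u a b v : ℝ) : cr (-u) (-a) (-b) (-v) = cr u a b v := by
  unfold cr
  rw [show (-v - -u) * (-b - -a) = (v - u) * (b - a) by ring,
    show (-a - -u) * (-v - -b) = (a - u) * (v - b) by ring]

theorem cr_rev (u a b v : ℝ) : cr v b a u = cr u a b v := by
  unfold cr
  rw [show (u - v) * (a - b) = (v - u) * (b - a) by ring,
    show (b - v) * (u - a) = (a - u) * (v - b) by ring]

/-- Increasing maps with negative Schwarzian derivative expand cross ratios. -/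
theorem sch_cr_pos {g : ℝ → ℝ} {u a b v : ℝ} (hg : ContDiff ℝ 3 g)
    (hpos : ∀ x ∈ Ioo u v, 0 < deriv g x) (hS : ∀ x ∈ Ioo u v, schwarzian g x < 0)
    (h1 : u < a) (h2 : a < b) (h3 : b < v) :
    cr u a b v < cr (g u) (g a) (g b) (g v) := by
  have hm := sch_strictMono hg hpos
  have m1 : u ∈ Icc u v := ⟨le_rfl, by linarith⟩
  have m2 : a ∈ Icc u v := ⟨by linarith, by linarith⟩
  have m3 : b ∈ Icc u v := ⟨by linarith, by linarith⟩
  have m4 : v ∈ Icc u v := ⟨by linarith, by linarith⟩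
  have g1 := hm m1 m2 h1
  have g2 := hm m2 m3 h2
  have g3 := hm m3 m4 h3
  have hb : ∀ x ∈ Icc u a, 0 < g b - g x := fun x hx => by
    have := hm (a := x) ⟨hx.1, by linarith [hx.2]⟩ m3 (by linarith [hx.2]); linarith
  have hv : ∀ x ∈ Icc u a, 0 < g v - g x := fun x hx => by
    have := hb x hx; linarith
  set K : ℝ → ℝ := fun x => Real.log (g v - g x) - Real.log (v - x) - Real.log (g b - g x)
    + Real.log (b - x) with hK
  have dK : ∀ x ∈ Icc u a, HasDerivAt K (deriv g x * (1 / (g b - g x) - 1 / (g v - g x))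
      - (1 / (b - x) - 1 / (v - x))) x := by
    intro x hx
    have e1 := ((sch_hasDerivAt hg x).1.const_sub (g v)).log (hv x hx).ne'
    have e2 := ((hasDerivAt_id x).const_sub v).log (by simp; linarith [hx.2])
    have e3 := ((sch_hasDerivAt hg x).1.const_sub (g b)).log (hb x hx).ne'
    have e4 := ((hasDerivAt_id x).const_sub b).log (by simp; linarith [hx.2])
    refine HasDerivAt.congr_deriv (((e1.sub e2).sub e3).add e4) ?_
    simp
    ring
  have : StrictAntiOn K (Icc u a) := by
    apply strictAntiOn_of_deriv_neg (convex_Icc u a)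
    · exact fun t ht => (dK t ht).continuousAt.continuousWithinAt
    · intro y hy
      rw [interior_Icc] at hy
      rw [(dK y (Ioo_subset_Icc_self hy)).deriv]
      have := sch_right hg hpos hS (x := y) (q := b) (w := v) ⟨hy.1, by linarith [hy.2]⟩
        (by linarith [hy.2]) h3 le_rfl
      linarith
  have := this (left_mem_Icc.2 h1.le) (right_mem_Icc.2 h1.le) h1
  simp only [hK] at this
  have A1 : 0 < g v - g a := by linarith
  have A2 : 0 < g b - g a := by linarith
  have A3 : 0 < g v - g u := by linarith
  have A4 : 0 < g b - g u := by linarith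
  have B1 : 0 < v - a := by linarith
  have B2 : 0 < b - a := by linarith
  have B3 : 0 < v - u := by linarith
  have B4 : 0 < b - u := by linarith
  have C1 : 0 < g a - g u := by linarith
  have C2 : 0 < g v - g b := by linarith
  have D1 : 0 < a - u := by linarith
  have D2 : 0 < v - b := by linarith
  have key : (g v - g a) * (b - a) * ((v - u) * (g b - g u)) <
      (g v - g u) * (b - u) * ((v - a) * (g b - g a)) := by
    rw [← Real.log_lt_log_iff (by positivity) (by positivity)]
    rw [Real.log_mul (by positivity) (by positivity), Real.log_mul (by positivity) (by positivity),
      Real.log_mul (by positivity) (by positivity), Real.log_mul (by positivity) (by positivity),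
      Real.log_mul (by positivity) (by positivity), Real.log_mul (by positivity) (by positivity)]
    linarith
  unfold cr
  rw [div_lt_div_iff₀ (by positivity) (by positivity)]
  nlinarith [key]

end NoHom


/-! ### Part 2: the standing assumptions, laps and attraction lemmas -/

namespace NoHom

/-- The standing assumptions used in the core of the argument. -/
structure Sys (f : ℝ → ℝ) (Cr : Finset ℝ) : Prop where
  cd : ContDiff ℝ 3 f
  maps : ∀ x ∈ Icc (0:ℝ) 1, f x ∈ Icc (0:ℝ) 1
  b0 : f 0 = 0 ∨ f 0 = 1
  b1 : f 1 = 0 ∨ f 1 = 1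
  crI : ∀ c ∈ Cr, c ∈ Ioo (0:ℝ) 1
  crz : ∀ c ∈ Cr, deriv f c = 0
  reg : ∀ x ∈ Icc (0:ℝ) 1, x ∉ Cr → deriv f x ≠ 0
  sch : ∀ x ∈ Icc (0:ℝ) 1, x ∉ Cr → schwarzian f x < 0
  turn : ∀ d ∈ Cr,
    (∀ p ∈ Icc (0:ℝ) 1, (∀ c ∈ Cr, c ∈ uIcc p d → c = d) → f p ≤ f d) ∨
    (∀ p ∈ Icc (0:ℝ) 1, (∀ c ∈ Cr, c ∈ uIcc p d → c = d) → f d ≤ f p)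
  n3 : ∃ C : ℝ, 0 < C ∧ ∃ n : ℕ, ∀ u a b v D : ℝ, 0 ≤ u → u ≤ a → a < b → b ≤ v → v ≤ 1 →
    (∀ x ∈ Icc a b, ∀ y ∈ Icc a b, |f x - f y| ≤ D) →
    ∀ x ∈ Icc u v, |deriv f x| * (b - a) ≤ C * ((v - u) / (b - a)) ^ n * D
  na : ¬ HasAttractingPeriodicOrbit f

variable {f : ℝ → ℝ} {Cr : Finset ℝ}

theorem Sys.cont (h : Sys f Cr) : Continuous f := h.cd.continuous

theorem Sys.itcont (h : Sys f Cr) (n : ℕ) : Continuous f^[n] := h.cont.iterate n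

theorem Sys.itcd (h : Sys f Cr) (n : ℕ) : ContDiff ℝ 3 f^[n] := by
  induction n with
  | zero => exact contDiff_id
  | succ n ih => rw [Function.iterate_succ']; exact h.cd.comp ih

theorem Sys.itmaps (h : Sys f Cr) (n : ℕ) : ∀ x ∈ Icc (0:ℝ) 1, f^[n] x ∈ Icc (0:ℝ) 1 := by
  induction n with
  | zero => intro x hx; simpa using hx
  | succ n ih => intro x hx; rw [Function.iterate_succ_apply']; exact h.maps _ (ih x hx)

theorem schwarzian_neg (f : ℝ → ℝ) (x : ℝ) : schwarzian (-f) x = schwarzian f x := by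
  unfold schwarzian
  have h1 : deriv (-f) x = - deriv f x := by
    exact deriv.neg
  rw [iteratedDeriv_neg, iteratedDeriv_neg, h1, neg_div_neg_eq, neg_div_neg_eq]

/-- On an interval without critical points the derivative has constant sign. -/
theorem Sys.sign (h : Sys f Cr) {u v : ℝ} (hu : 0 ≤ u) (hv : v ≤ 1)
    (hc : ∀ c ∈ Cr, c ∉ Ioo u v) :
    (∀ x ∈ Ioo u v, 0 < deriv f x) ∨ (∀ x ∈ Ioo u v, deriv f x < 0) := by
  by_contra hcon
  push Not at hcon
  obtain ⟨⟨x, hx, hx'⟩, ⟨y, hy, hy'⟩⟩ := hcon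
  have hcont : Continuous (deriv f) := h.cd.continuous_deriv (by norm_num)
  have := isPreconnected_Ioo.intermediate_value hx hy hcont.continuousOn
  obtain ⟨z, hz, hz0⟩ := this ⟨hx', hy'⟩
  exact h.reg z ⟨by linarith [hz.1], by linarith [hz.2]⟩ (fun hzc => hc z hzc hz) hz0

theorem Sys.mono (h : Sys f Cr) {u v : ℝ} (hu : 0 ≤ u) (hv : v ≤ 1)
    (hc : ∀ c ∈ Cr, c ∉ Ioo u v) :
    StrictMonoOn f (Icc u v) ∨ StrictAntiOn f (Icc u v) := by
  rcases h.sign hu hv hc with h1 | h1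
  · exact Or.inl (sch_strictMono h.cd h1)
  · right
    apply strictAntiOn_of_deriv_neg (convex_Icc u v) h.cont.continuousOn
    intro x hx
    rw [interior_Icc] at hx
    exact h1 x hx

theorem Sys.schneg (h : Sys f Cr) {u v : ℝ} (hu : 0 ≤ u) (hv : v ≤ 1)
    (hc : ∀ c ∈ Cr, c ∉ Ioo u v) : ∀ x ∈ Ioo u v, schwarzian f x < 0 := fun x hx =>
  h.sch x ⟨by linarith [hx.1], by linarith [hx.2]⟩ (fun hzc => hc x hzc hx)

/-- cross ratios are expanded. -/
theorem Sys.cr_lt (h : Sys f Cr) {u a b v : ℝ} (hu : 0 ≤ u) (hv : v ≤ 1)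
    (hc : ∀ c ∈ Cr, c ∉ Ioo u v) (h1 : u < a) (h2 : a < b) (h3 : b < v) :
    cr u a b v < cr (f u) (f a) (f b) (f v) := by
  have hS := h.schneg hu hv hc
  rcases h.sign hu hv hc with hp | hp
  · exact sch_cr_pos h.cd hp hS h1 h2 h3
  · have := sch_cr_pos (g := -f) (u := u) (v := v) h.cd.neg
      (fun x hx => by rw [deriv.neg]; linarith [hp x hx])
      (fun x hx => by rw [schwarzian_neg]; exact hS x hx) h1 h2 h3
    simpa only [Pi.neg_apply, cr_neg] using this

theorem Sys.right_abs (h : Sys f Cr) {u v : ℝ} (hu : 0 ≤ u) (hv : v ≤ 1)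
    (hc : ∀ c ∈ Cr, c ∉ Ioo u v) {x q w : ℝ} (hx : x ∈ Ioo u v) (hxq : x < q) (hqw : q < w)
    (hw : w ≤ v) :
    |deriv f x| * (1 / |f q - f x| - 1 / |f w - f x|) ≤ 1 / (q - x) - 1 / (w - x) := by
  have hS := h.schneg hu hv hc
  have mx : x ∈ Icc u v := ⟨hx.1.le, hx.2.le⟩
  have mq : q ∈ Icc u v := ⟨by linarith [hx.1], by linarith⟩
  have mw : w ∈ Icc u v := ⟨by linarith [hx.1], by linarith⟩
  rcases h.sign hu hv hc with hp | hp
  · have hm := sch_strictMono h.cd hp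
    rw [abs_of_pos (hp x hx), abs_of_pos (by linarith [hm mx mq hxq]),
      abs_of_pos (by linarith [hm mx mw (hxq.trans hqw)])]
    exact (sch_right h.cd hp hS hx hxq hqw hw).le
  · have hp' : ∀ x ∈ Ioo u v, 0 < deriv (-f) x :=
      fun x hx => by rw [deriv.neg]; linarith [hp x hx]
    have hm := sch_strictMono h.cd.neg hp'
    have e1 := hm mx mq hxq
    have e2 := hm mx mw (hxq.trans hqw)
    have := (sch_right (g := -f) (u := u) (v := v) h.cd.neg hp'
      (fun x hx => by rw [schwarzian_neg]; exact hS x hx) hx hxq hqw hw).le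
    simp only at e1 e2
    rw [abs_of_neg (hp x hx), abs_of_neg (by linarith), abs_of_neg (by linarith)]
    simp only [Pi.neg_apply, deriv.neg] at this
    rw [show -(f q - f x) = -f q - -f x by ring, show -(f w - f x) = -f w - -f x by ring]
    exact this

theorem Sys.left_abs (h : Sys f Cr) {u v : ℝ} (hu : 0 ≤ u) (hv : v ≤ 1)
    (hc : ∀ c ∈ Cr, c ∉ Ioo u v) {x q w : ℝ} (hx : x ∈ Ioo u v) (hxq : q < x) (hqw : w < q)
    (hw : u ≤ w) :
    |deriv f x| * (1 / |f q - f x| - 1 / |f w - f x|) ≤ 1 / (x - q) - 1 / (x - w) := by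
  have hS := h.schneg hu hv hc
  have mx : x ∈ Icc u v := ⟨hx.1.le, hx.2.le⟩
  have mq : q ∈ Icc u v := ⟨by linarith, by linarith [hx.2]⟩
  have mw : w ∈ Icc u v := ⟨by linarith, by linarith [hx.2]⟩
  rw [abs_sub_comm (f q), abs_sub_comm (f w)]
  rcases h.sign hu hv hc with hp | hp
  · have hm := sch_strictMono h.cd hp
    rw [abs_of_pos (hp x hx), abs_of_pos (by linarith [hm mq mx hxq]),
      abs_of_pos (by linarith [hm mw mx (hqw.trans hxq)])]
    exact (sch_left h.cd hp hS hx hxq hqw hw).le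
  · have hp' : ∀ x ∈ Ioo u v, 0 < deriv (-f) x :=
      fun x hx => by rw [deriv.neg]; linarith [hp x hx]
    have hm := sch_strictMono h.cd.neg hp'
    have e1 := hm mq mx hxq
    have e2 := hm mw mx (hqw.trans hxq)
    have := (sch_left (g := -f) (u := u) (v := v) h.cd.neg hp'
      (fun x hx => by rw [schwarzian_neg]; exact hS x hx) hx hxq hqw hw).le
    simp only at e1 e2
    rw [abs_of_neg (hp x hx), abs_of_neg (by linarith), abs_of_neg (by linarith)]
    simp only [Pi.neg_apply, deriv.neg] at this
    rw [show -(f x - f q) = -f x - -f q by ring, show -(f x - f w) = -f x - -f w by ring]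
    exact this

/-- Components of open subsets of `(0,1)`. -/
theorem comp_exists {Ω : Set ℝ} (hΩ : IsOpen Ω) (hsub : Ω ⊆ Ioo 0 1) {x : ℝ} (hx : x ∈ Ω) :
    ∃ α β : ℝ, 0 ≤ α ∧ α < x ∧ x < β ∧ β ≤ 1 ∧ Ioo α β ⊆ Ω ∧ α ∉ Ω ∧ β ∉ Ω := by
  have hx01 := hsub hx
  set A := Ωᶜ ∩ Icc 0 x with hA
  set B := Ωᶜ ∩ Icc x 1 with hB
  have cA : IsCompact A := isCompact_Icc.inter_left hΩ.isClosed_compl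
  have cB : IsCompact B := isCompact_Icc.inter_left hΩ.isClosed_compl
  have nA : A.Nonempty := ⟨0, fun h0 => lt_irrefl _ (hsub h0).1, le_rfl, hx01.1.le⟩
  have nB : B.Nonempty := ⟨1, fun h0 => lt_irrefl _ (hsub h0).2, hx01.2.le, le_rfl⟩
  obtain ⟨α, hα, hα'⟩ := cA.exists_isGreatest nA
  obtain ⟨β, hβ, hβ'⟩ := cB.exists_isLeast nB
  have h1 : α < x := lt_of_le_of_ne hα.2.2 (fun e => hα.1 (e ▸ hx))
  have h2 : x < β := lt_of_le_of_ne hβ.2.1 (fun e => hβ.1 (e ▸ hx))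
  refine ⟨α, β, hα.2.1, h1, h2, hβ.2.2, ?_, hα.1, hβ.1⟩
  intro y hy
  by_contra hyΩ
  rcases le_total y x with hyx | hyx
  · have := hα' (show y ∈ A from ⟨hyΩ, by linarith [hα.2.1, hy.1], hyx⟩)
    linarith [hy.1]
  · have := hβ' (show y ∈ B from ⟨hyΩ, hyx, by linarith [hβ.2.2, hy.2]⟩)
    linarith [hy.2]

/-- Attraction lemma A1. -/
theorem Sys.A1 (h : Sys f Cr) {U : Set ℝ} (hU : IsOpen U) (hne : U.Nonempty)
    (hsub : U ⊆ Icc 0 1) {p : ℝ} (hp : p ∈ Icc (0:ℝ) 1) {q : ℕ} (hq : 1 ≤ q)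
    (hpq : f^[q] p = p)
    (hU2 : ∀ x ∈ U, Tendsto (fun k : ℕ => Metric.infDist (f^[k] x) (orbit f p)) atTop (nhds 0)) :
    False := by
  refine h.na ⟨p, hp, q, hq, hpq, U, hU, ?_, ?_⟩
  · obtain ⟨x, hx⟩ := hne
    exact ⟨x, hx, hsub hx⟩
  · intro x hx
    exact ⟨hx.2, hU2 x hx.1⟩

theorem Sys.A2 (h : Sys f Cr) {U : Set ℝ} (hU : IsOpen U) (hne : U.Nonempty)
    (hsub : U ⊆ Icc 0 1) {p : ℝ} {q : ℕ} (hq : 1 ≤ q)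
    (hU2 : ∀ x ∈ U, Tendsto (fun k : ℕ => (f^[q])^[k] x) atTop (nhds p)) :
    False := by
  obtain ⟨x0, hx0⟩ := hne
  have hp : p ∈ Icc (0:ℝ) 1 := by
    apply isClosed_Icc.mem_of_tendsto (hU2 x0 hx0)
    refine Eventually.of_forall fun k => ?_
    rw [← Function.iterate_mul]
    exact h.itmaps _ _ (hsub hx0)
  have hpq : f^[q] p = p := by
    have h1 := (hU2 x0 hx0).comp (tendsto_add_atTop_nat 1)
    have h2 := ((h.itcont q).tendsto p).comp (hU2 x0 hx0)
    refine tendsto_nhds_unique h2 (h1.congr fun k => ?_)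
    simp [Function.iterate_succ_apply']
  refine h.A1 hU ⟨x0, hx0⟩ hsub hp hq hpq fun x hx => ?_
  rw [Metric.tendsto_atTop]
  intro ε hε
  have h1 : ∀ r ∈ Finset.range q, ∀ᶠ k in atTop, dist (f^[r] ((f^[q])^[k] x)) (f^[r] p) < ε := by
    intro r _
    have := ((h.itcont r).tendsto p).comp (hU2 x hx)
    exact (Metric.tendsto_nhds.1 this) ε hε
  have h2 := (Finset.eventually_all (Finset.range q)).2 h1
  obtain ⟨N, hN⟩ := eventually_atTop.1 h2
  refine ⟨q * N, fun n hn => ?_⟩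
  have hk : N ≤ n / q := by
    rw [Nat.le_div_iff_mul_le (by omega)]
    linarith [mul_comm q N]
  have := hN (n / q) hk (n % q) (Finset.mem_range.2 (Nat.mod_lt _ (by omega)))
  rw [← Function.iterate_mul, ← Function.iterate_add_apply, Nat.mod_add_div] at this
  rw [dist_zero_right, Real.norm_of_nonneg infDist_nonneg]
  exact lt_of_le_of_lt (infDist_le_dist_of_mem ⟨n % q, rfl⟩) this

/-- Attraction lemma A3: an invariant open interval contains a fixed point. -/
theorem Sys.A3 (h : Sys f Cr) {α β : ℝ} (hα : 0 ≤ α) (hβ : β ≤ 1) (hab : α < β) {q : ℕ}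
    (hq : 1 ≤ q) (hmaps : ∀ x ∈ Ioo α β, f^[q] x ∈ Ioo α β)
    (hnf : ∀ x ∈ Ioo α β, f^[q] x ≠ x) : False := by
  set F := f^[q] with hF
  have hFc : Continuous F := h.itcont q
  have hit : ∀ x ∈ Ioo α β, ∀ k, F^[k] x ∈ Ioo α β := by
    intro x hx k
    induction k with
    | zero => exact hx
    | succ k ih => rw [Function.iterate_succ_apply']; exact hmaps _ ih
  have hlimfix : ∀ x p, Tendsto (fun k => F^[k] x) atTop (nhds p) → F p = p := by
    intro x p hxp
    have h1 := hxp.comp (tendsto_add_atTop_nat 1)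
    have h2 := (hFc.tendsto p).comp hxp
    refine tendsto_nhds_unique h2 (h1.congr fun k => ?_)
    simp [Function.iterate_succ_apply']
  have hsg : (∀ x ∈ Ioo α β, x < F x) ∨ (∀ x ∈ Ioo α β, F x < x) := by
    by_contra hcon
    push Not at hcon
    obtain ⟨⟨x, hx, hx'⟩, ⟨y, hy, hy'⟩⟩ := hcon
    obtain ⟨z, hz, hz0⟩ := isPreconnected_Ioo.intermediate_value hx hy
      (f := fun t => F t - t) (by fun_prop) (show (0:ℝ) ∈ Icc (F x - x) (F y - y) from
        ⟨by linarith, by linarith⟩)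
    exact hnf z hz (by simp only at hz0; linarith)
  have hUo : IsOpen (Ioo α β) := isOpen_Ioo
  have hsub : Ioo α β ⊆ Icc 0 1 := fun x hx => ⟨by linarith [hx.1], by linarith [hx.2]⟩
  rcases hsg with hs | hs
  · refine h.A2 (p := β) hUo (nonempty_Ioo.2 hab) hsub hq fun x hx => ?_
    have hm : Monotone (fun k => F^[k] x) := monotone_nat_of_le_succ fun k => by
      rw [Function.iterate_succ_apply']; exact (hs _ (hit x hx k)).le
    obtain ⟨p, hp⟩ : ∃ p, Tendsto (fun k => F^[k] x) atTop (nhds p) :=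
      ⟨_, tendsto_atTop_ciSup hm ⟨β, by rintro _ ⟨k, rfl⟩; exact (hit x hx k).2.le⟩⟩
    have hp1 : x ≤ p := hm.ge_of_tendsto hp 0
    have hp2 : p ≤ β := le_of_tendsto' hp fun k => (hit x hx k).2.le
    rcases hp2.eq_or_lt with e | e
    · rw [← e]; exact hp
    · exact absurd (hlimfix x p hp) (hnf p ⟨by linarith [hx.1], e⟩)
  · refine h.A2 (p := α) hUo (nonempty_Ioo.2 hab) hsub hq fun x hx => ?_
    have hm : Antitone (fun k => F^[k] x) := antitone_nat_of_succ_le fun k => by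
      rw [Function.iterate_succ_apply']; exact (hs _ (hit x hx k)).le
    obtain ⟨p, hp⟩ : ∃ p, Tendsto (fun k => F^[k] x) atTop (nhds p) :=
      ⟨_, tendsto_atTop_ciInf hm ⟨α, by rintro _ ⟨k, rfl⟩; exact (hit x hx k).1.le⟩⟩
    have hp1 : p ≤ x := hm.le_of_tendsto hp 0
    have hp2 : α ≤ p := ge_of_tendsto' hp fun k => (hit x hx k).1.le
    rcases hp2.eq_or_lt with e | e
    · rw [e]; exact hp
    · exact absurd (hlimfix x p hp) (hnf p ⟨e, by linarith [hx.2]⟩)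

theorem Sys.A4 (h : Sys f Cr) {α β : ℝ} (hα : 0 ≤ α) (hβ : β ≤ 1) (hab : α < β) {q : ℕ}
    (hq : 1 ≤ q) (hmaps : ∀ x ∈ Ioo α β, f^[q] x ∈ Ioo α β)
    (hd : ∀ x ∈ Ioo α β, |deriv f^[q] x| ≤ 1 / 2) : False := by
  set F := f^[q] with hF
  have hFcd : ContDiff ℝ 3 F := h.itcd q
  have hFc : Continuous F := h.itcont q
  have hFd : Continuous (deriv F) := hFcd.continuous_deriv (by norm_num)
  have hcl : closure (Ioo α β) = Icc α β := closure_Ioo hab.ne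
  have hm' : MapsTo F (Icc α β) (Icc α β) := by
    rw [← hcl]
    exact MapsTo.closure hmaps hFc
  have hd' : ∀ x ∈ Icc α β, ‖deriv F x‖ ≤ 1 / 2 := by
    intro x hx
    rw [← hcl] at hx
    have hcl2 : IsClosed {y | ‖deriv F y‖ ≤ 1/2} := isClosed_le hFd.norm continuous_const
    exact closure_minimal (fun y hy => hd y hy) hcl2 hx
  obtain ⟨p, hp, hpf⟩ := exists_mem_Icc_isFixedPt_of_mapsTo hFc.continuousOn hab.le hm'
  have hlip : ∀ x ∈ Icc α β, |F x - p| ≤ 1 / 2 * |x - p| := by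
    intro x hx
    have := (convex_Icc α β).norm_image_sub_le_of_norm_deriv_le (f := F)
      (fun x _ => (hFcd.differentiable (by norm_num)) x) hd' hp hx
    rw [hpf] at this
    exact this
  have hk : ∀ x ∈ Icc α β, ∀ k, F^[k] x ∈ Icc α β ∧ |F^[k] x - p| ≤ (1/2)^k * |x - p| := by
    intro x hx k
    induction k with
    | zero => exact ⟨hx, by simp⟩
    | succ k ih =>
      rw [Function.iterate_succ_apply']
      refine ⟨hm' ih.1, (hlip _ ih.1).trans ?_⟩
      rw [pow_succ]
      linarith [ih.2]
  refine h.A2 (p := p) isOpen_Ioo (nonempty_Ioo.2 hab)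
    (fun x hx => ⟨by linarith [hx.1], by linarith [hx.2]⟩) hq fun x hx => ?_
  rw [tendsto_iff_norm_sub_tendsto_zero]
  have ht : Tendsto (fun k : ℕ => (1/2:ℝ)^k * |x - p|) atTop (nhds 0) := by
    have := (tendsto_pow_atTop_nhds_zero_of_lt_one (r := (1/2:ℝ)) (by norm_num)
      (by norm_num)).mul_const |x - p|
    simpa using this
  exact squeeze_zero (fun _ => norm_nonneg _)
    (fun k => (hk x (Ioo_subset_Icc_self hx) k).2) ht

/-- chain rule: if the derivative of an iterate is nonzero, the orbit avoids `Cr`. -/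
theorem Sys.deriv_it (h : Sys f Cr) (q : ℕ) (x : ℝ) :
    deriv f^[q + 1] x = deriv f (f^[q] x) * deriv f^[q] x := by
  have hd : Differentiable ℝ f := h.cd.differentiable (by norm_num)
  have hd2 : Differentiable ℝ f^[q] := (h.itcd q).differentiable (by norm_num)
  rw [Function.iterate_succ']
  exact deriv_comp x (hd _) (hd2 _)

theorem Sys.deriv_it_ne (h : Sys f Cr) {q : ℕ} {x : ℝ} (hx : deriv f^[q] x ≠ 0) :
    ∀ j < q, f^[j] x ∉ Cr := by
  induction q with
  | zero => intro j hj; omega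
  | succ q ih =>
    rw [h.deriv_it] at hx
    intro j hj
    rcases Nat.lt_succ_iff_lt_or_eq.1 hj with h1 | h1
    · exact ih (right_ne_zero_of_mul hx) j h1
    · subst h1
      intro hc
      exact hx (by rw [h.crz _ hc, zero_mul])

/-- Attraction lemma A5. -/
theorem Sys.A5 (h : Sys f Cr) {u v : ℝ} (hu : 0 ≤ u) (hv : v ≤ 1) (huv : u < v) {q : ℕ}
    (hq : 1 ≤ q) (hfu : f^[q] u = u) (hfv : f^[q] v = v) (hm : StrictMonoOn f^[q] (Icc u v)) :
    False := by
  set F := f^[q] with hF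
  have hFc : Continuous F := h.itcont q
  by_cases hid : ∀ y ∈ Ioo u v, F y = y
  · have hid' : ∀ y ∈ Icc u v, F y = y := by
      intro y hy
      rcases hy.1.eq_or_lt with e | e
      · rw [← e, hfu]
      rcases hy.2.eq_or_lt with e' | e'
      · rw [e', hfv]
      exact hid y ⟨e, e'⟩
    have hcf : ∀ y ∈ Ioo u v, ∀ j < q, f^[j] y ∉ Cr := by
      intro y hy
      apply h.deriv_it_ne
      have : F =ᶠ[nhds y] id := by
        filter_upwards [isOpen_Ioo.mem_nhds hy] with z hz using hid z hz
      rw [← hF, this.deriv_eq]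
      simp
    have hinj : ∀ j ≤ q, InjOn f^[j] (Icc u v) := by
      intro j hj x hx y hy hxy
      have h1 : f^[q - j] (f^[j] x) = f^[q - j] (f^[j] y) := by rw [hxy]
      rw [← Function.iterate_add_apply, ← Function.iterate_add_apply, Nat.sub_add_cancel hj] at h1
      rw [← hid' x hx, ← hid' y hy]; exact h1
    obtain ⟨a, ha1, ha2⟩ := exists_between huv
    obtain ⟨b, hb1, hb2⟩ := exists_between ha2
    have mu : u ∈ Icc u v := ⟨le_rfl, huv.le⟩
    have mv : v ∈ Icc u v := ⟨huv.le, le_rfl⟩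
    have ma : a ∈ Icc u v := ⟨ha1.le, ha2.le⟩
    have mb : b ∈ Icc u v := ⟨(ha1.trans hb1).le, hb2.le⟩
    have hstep : ∀ j < q, cr (f^[j] u) (f^[j] a) (f^[j] b) (f^[j] v) <
        cr (f^[j+1] u) (f^[j+1] a) (f^[j+1] b) (f^[j+1] v) := by
      intro j hj
      simp only [Function.iterate_succ_apply']
      have hcont : ContinuousOn f^[j] (Icc u v) := (h.itcont j).continuousOn
      have i0 := h.itmaps j u ⟨hu, by linarith⟩
      have i1 := h.itmaps j v ⟨by linarith, hv⟩
      rcases hcont.strictMonoOn_of_injOn_Icc' huv.le (hinj j hj.le) with hmj | hmj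
      · refine h.cr_lt i0.1 i1.2 ?_ (hmj mu ma ha1) (hmj ma mb hb1) (hmj mb mv hb2)
        intro c hc hcI
        obtain ⟨y, hy, rfl⟩ := intermediate_value_Ioo huv.le hcont hcI
        exact hcf y hy j hj hc
      · rw [← cr_rev, ← cr_rev (f (f^[j] u))]
        refine h.cr_lt i1.1 i0.2 ?_ (hmj mb mv hb2) (hmj ma mb hb1) (hmj mu ma ha1)
        intro c hc hcI
        obtain ⟨y, hy, rfl⟩ := intermediate_value_Ioo' huv.le hcont hcI
        exact hcf y hy j hj hc
    have hall : ∀ j ≤ q, 1 ≤ j → cr u a b v <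
        cr (f^[j] u) (f^[j] a) (f^[j] b) (f^[j] v) := by
      intro j hj
      induction j with
      | zero => intro h0; omega
      | succ j ih =>
        intro _
        rcases Nat.eq_zero_or_pos j with e | e
        · subst e; simpa using hstep 0 (by omega)
        · exact (ih (by omega) e).trans (hstep j (by omega))
    have := hall q le_rfl hq
    rw [← hF, hfu, hfv, hid' a ma, hid' b mb] at this
    exact lt_irrefl _ this
  · push Not at hid
    obtain ⟨y, hy, hyF⟩ := hid
    have ho : IsOpen ({y | F y ≠ y} ∩ Ioo u v) := (isOpen_ne_fun hFc continuous_id).inter isOpen_Ioo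
    obtain ⟨α, β, h0, h1, h2, h3, h4, h5, h6⟩ := comp_exists ho
      (fun z hz => ⟨by linarith [hz.2.1], by linarith [hz.2.2]⟩) (x := y) ⟨hyF, hy⟩
    have hαβ : α < β := h1.trans h2
    have hcl : Icc α β ⊆ Icc u v := by
      rw [← closure_Ioo hαβ.ne]
      exact closure_minimal (fun z hz => Ioo_subset_Icc_self (h4 hz).2) isClosed_Icc
    have mα := hcl (left_mem_Icc.2 hαβ.le)
    have mβ := hcl (right_mem_Icc.2 hαβ.le)
    have fα : F α = α := by
      by_contra hne
      rcases mα.1.eq_or_lt with e | e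
      · exact hne (by rw [← e]; exact hfu)
      · exact h5 ⟨hne, e, by linarith [mβ.2]⟩
    have fβ : F β = β := by
      by_contra hne
      rcases mβ.2.eq_or_lt with e | e
      · exact hne (by rw [e]; exact hfv)
      · exact h6 ⟨hne, by linarith [mα.1], e⟩
    refine h.A3 h0 h3 hαβ hq (fun x hx => ?_) (fun x hx => (h4 hx).1)
    have hx' := Ioo_subset_Icc_self (h4 hx).2
    constructor
    · rw [← fα]; exact hm mα hx' hx.1
    · rw [← fβ]; exact hm hx' mβ hx.2

/-- finitely many points of each period. -/
theorem Sys.fix_finite (h : Sys f Cr) {q : ℕ} (hq : 1 ≤ q) :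
    {x | x ∈ Icc (0:ℝ) 1 ∧ f^[q] x = x}.Finite := by
  by_contra hinf
  set F := f^[q] with hF
  have hFcd : ContDiff ℝ 3 F := h.itcd q
  have hFd : Continuous (deriv F) := hFcd.continuous_deriv (by norm_num)
  obtain ⟨z, hz, hacc⟩ := Set.Infinite.exists_accPt_of_subset_isCompact hinf isCompact_Icc
    (fun x hx => hx.1)
  have hcl : IsClosed {x | x ∈ Icc (0:ℝ) 1 ∧ F x = x} :=
    isClosed_Icc.inter (isClosed_eq (h.itcont q) continuous_id)
  have hzf : F z = z := (isClosed_iff_accPt.1 hcl z hacc).2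
  rw [accPt_iff_frequently] at hacc
  have hderiv : HasDerivAt F (deriv F z) z :=
    ((hFcd.differentiable (by norm_num)) z).hasDerivAt
  have hL : deriv F z = 1 := by
    have ht := hasDerivAt_iff_tendsto_slope.1 hderiv
    by_contra hne
    have hev : ∀ᶠ y in nhdsWithin z {z}ᶜ, slope F z y ≠ 1 := ht.eventually_ne hne
    rw [eventually_nhdsWithin_iff] at hev
    obtain ⟨y, ⟨hyz, hy1, hy2⟩, hy3⟩ := (hacc.and_eventually hev).exists
    apply hy3 hyz
    rw [slope_def_field, hy2, hzf, div_self (sub_ne_zero.2 hyz)]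
  have hpos : ∀ᶠ y in nhds z, 0 < deriv F y :=
    hFd.continuousAt.eventually (by rw [hL]; exact lt_mem_nhds one_pos)
  obtain ⟨δ, hδ, hball⟩ := Metric.eventually_nhds_iff_ball.1 hpos
  have hev2 : ∀ᶠ y in nhds z, y ∈ ball z δ := ball_mem_nhds z hδ
  obtain ⟨y, ⟨hyz, hy1, hy2⟩, hy3⟩ := (hacc.and_eventually hev2).exists
  have hmono : ∀ s t, s ∈ ball z δ → t ∈ ball z δ → StrictMonoOn F (Icc s t) := by
    intro s t hs ht
    apply strictMonoOn_of_deriv_pos (convex_Icc s t) (h.itcont q).continuousOn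
    intro x hx
    rw [interior_Icc] at hx
    apply hball
    rw [Real.ball_eq_Ioo] at *
    exact ⟨by linarith [hs.1, hx.1], by linarith [ht.2, hx.2]⟩
  rcases lt_or_gt_of_ne hyz with hlt | hlt
  · exact h.A5 hy1.1 hz.2 hlt hq hy2 hzf (hmono y z hy3 (mem_ball_self hδ))
  · exact h.A5 hz.1 hy1.2 hlt hq hzf hy2 (hmono z y (mem_ball_self hδ) hy3)

end NoHom


/-! ### Part 3: the orbit of a wandering interval -/

namespace NoHom

variable {f : ℝ → ℝ} {Cr : Finset ℝ}

theorem pos_lb {ι : Type*} (S : Finset ι) (g : ι → ℝ) (h : ∀ x ∈ S, 0 < g x) :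
    ∃ δ > 0, δ ≤ 1 ∧ ∀ x ∈ S, δ ≤ g x := by
  classical
  induction S using Finset.induction_on with
  | empty => exact ⟨1, one_pos, le_rfl, by simp⟩
  | insert a S _ ih =>
    obtain ⟨δ, h1, h2, h3⟩ := ih fun x hx => h x (Finset.mem_insert_of_mem hx)
    refine ⟨min δ (g a), lt_min h1 (h a (Finset.mem_insert_self _ _)), (min_le_left _ _).trans h2, ?_⟩
    intro x hx
    rcases Finset.mem_insert.1 hx with rfl | hx
    · exact min_le_right _ _
    · exact (min_le_left _ _).trans (h3 x hx)

/-- A preconnected set inside `Ω` meeting a component is contained in it. -/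
theorem comp_max {Ω S : Set ℝ} {α β : ℝ} (hS : IsPreconnected S) (hSΩ : S ⊆ Ω) (hα : α ∉ Ω)
    (hβ : β ∉ Ω) (hne : (S ∩ Ioo α β).Nonempty) : S ⊆ Ioo α β := by
  obtain ⟨x, hxS, hx⟩ := hne
  have ho := hS.ordConnected
  intro y hy
  constructor
  · by_contra hle
    exact hα (hSΩ (ho.out hy hxS ⟨not_lt.1 hle, hx.1.le⟩))
  · by_contra hle
    exact hβ (hSΩ (ho.out hxS hy ⟨hx.2.le, not_lt.1 hle⟩))

/-- the orbit of a wandering interval. -/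
structure Orb (f : ℝ → ℝ) (Cr : Finset ℝ) (x a b : ℕ → ℝ) (η : ℝ) : Prop where
  mem : ∀ i, x i ∈ Ioo (a i) (b i)
  step : ∀ i, f (x i) = x (i + 1)
  pos : ∀ i, 0 < a i
  lt1 : ∀ i, b i < 1
  nc : ∀ i, ∀ c ∈ Cr, c ∉ Icc (a i) (b i)
  ends : ∀ i, (f (a i) = a (i+1) ∧ f (b i) = b (i+1)) ∨ (f (a i) = b (i+1) ∧ f (b i) = a (i+1))
  maps : ∀ i, ∀ y ∈ Ioo (a i) (b i), f y ∈ Ioo (a (i+1)) (b (i+1))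
  disj : ∀ i j, i ≠ j → Disjoint (Ioo (a i) (b i)) (Ioo (a j) (b j))
  ηpos : 0 < η
  η1 : η ≤ 1
  len : ∀ i, b i - a i < η / 2
  sep : ∀ c ∈ Cr, ∀ d ∈ Cr, c ≠ d → η ≤ |c - d|
  lim : Tendsto (fun i => b i - a i) atTop (nhds 0)
  j4 : ∀ ε > 0, ∀ K : ℕ, ∃ y ∈ Ioo (a 0 - ε) (a 0 + ε), ∃ k ≥ K, f^[k] y ∈ Cr

/-- disjoint intervals have lengths tending to zero. -/
theorem len_tendsto {a b : ℕ → ℝ} (ha : ∀ i, 0 ≤ a i) (hb : ∀ i, b i ≤ 1) (hab : ∀ i, a i < b i)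
    (hd : ∀ i j, i ≠ j → Disjoint (Ioo (a i) (b i)) (Ioo (a j) (b j))) :
    Tendsto (fun i => b i - a i) atTop (nhds 0) := by
  have hsum : ∀ n, ∑ i ∈ Finset.range n, (b i - a i) ≤ 1 := by
    intro n
    have h1 : MeasureTheory.volume (⋃ i ∈ Finset.range n, Ioo (a i) (b i)) =
        ∑ i ∈ Finset.range n, MeasureTheory.volume (Ioo (a i) (b i)) :=
      MeasureTheory.measure_biUnion_finset (fun i _ j _ hij => hd i j hij)
        (fun i _ => measurableSet_Ioo)
    have h2 : MeasureTheory.volume (⋃ i ∈ Finset.range n, Ioo (a i) (b i)) ≤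
        MeasureTheory.volume (Icc (0:ℝ) 1) := by
      apply MeasureTheory.measure_mono
      intro y hy
      simp only [mem_iUnion] at hy
      obtain ⟨i, _, hy⟩ := hy
      exact ⟨by linarith [ha i, hy.1], by linarith [hb i, hy.2]⟩
    rw [h1] at h2
    simp only [Real.volume_Ioo, Real.volume_Icc] at h2
    rw [← ENNReal.ofReal_sum_of_nonneg (fun i _ => by linarith [hab i])] at h2
    have := (ENNReal.ofReal_le_ofReal_iff (by norm_num)).1 h2
    linarith
  exact (summable_of_sum_range_le (fun i => by linarith [hab i]) hsum).tendsto_atTop_zero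

/-- Points of `(0,1)` not accumulated by precritical points. -/
def Gs (f : ℝ → ℝ) (Cr : Finset ℝ) : Set ℝ :=
  Ioo 0 1 \ closure {y | ∃ n : ℕ, f^[n] y ∈ Cr}

theorem Gs_open : IsOpen (Gs f Cr) := isOpen_Ioo.sdiff isClosed_closure

theorem Gs_nc {y : ℝ} (hy : y ∈ Gs f Cr) (n : ℕ) : f^[n] y ∉ Cr := fun hc =>
  hy.2 (subset_closure ⟨n, hc⟩)

theorem mem_Gs {y : ℝ} : y ∈ Gs f Cr ↔ y ∈ Ioo (0:ℝ) 1 ∧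
    ∀ᶠ z in nhds y, ∀ n : ℕ, f^[n] z ∉ Cr := by
  unfold Gs
  rw [Set.mem_sdiff, mem_closure_iff_frequently, not_frequently]
  simp only [mem_ofPred_eq, not_exists]

theorem Sys.Gs_iff (h : Sys f Cr) {y : ℝ} (hy : y ∈ Ioo (0:ℝ) 1) (hyc : y ∉ Cr) :
    y ∈ Gs f Cr ↔ f y ∈ Gs f Cr := by
  have hd : HasStrictDerivAt f (deriv f y) y :=
    h.cd.contDiffAt.hasStrictDerivAt (by norm_num)
  have hne := h.reg y ⟨hy.1.le, hy.2.le⟩ hyc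
  have hmap : map f (nhds y) = nhds (f y) := hd.map_nhds_eq hne
  rw [mem_Gs, mem_Gs, ← hmap, eventually_map]
  have hCc : ∀ᶠ z in nhds y, z ∉ Cr :=
    (Cr.finite_toSet.isClosed.isOpen_compl.mem_nhds hyc)
  constructor
  · rintro ⟨_, h2⟩
    refine ⟨?_, h2.mono fun z hz n => ?_⟩
    · have : Icc (0:ℝ) 1 ∈ nhds (f y) := by
        rw [← hmap, mem_map]
        filter_upwards [Ioo_mem_nhds hy.1 hy.2] with z hz using h.maps z ⟨hz.1.le, hz.2.le⟩
      rw [← interior_Icc]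
      exact mem_interior_iff_mem_nhds.2 this
    · have := hz (n + 1)
      rwa [Function.iterate_succ_apply] at this
  · rintro ⟨_, h2⟩
    refine ⟨hy, (h2.and hCc).mono fun z hz n => ?_⟩
    cases n with
    | zero => exact hz.2
    | succ n => rw [Function.iterate_succ_apply]; exact hz.1 n

theorem Sys.Gs_maps (h : Sys f Cr) {y : ℝ} (hy : y ∈ Gs f Cr) (n : ℕ) : f^[n] y ∈ Gs f Cr := by
  induction n with
  | zero => exact hy
  | succ n ih =>
    rw [Function.iterate_succ_apply']
    exact (h.Gs_iff ih.1 (Gs_nc ih 0)).1 ih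

theorem Sys.Gs_deriv (h : Sys f Cr) {y : ℝ} (hy : y ∈ Gs f Cr) (n : ℕ) : deriv f^[n] y ≠ 0 := by
  induction n with
  | zero => simp
  | succ n ih =>
    rw [h.deriv_it]
    refine mul_ne_zero (h.reg _ ?_ (Gs_nc hy n)) ih
    have := (h.Gs_maps hy n).1
    exact ⟨this.1.le, this.2.le⟩

theorem Sys.Gs_sign (h : Sys f Cr) {α β : ℝ} (hG : Ioo α β ⊆ Gs f Cr) (n : ℕ) :
    (∀ x ∈ Ioo α β, 0 < deriv f^[n] x) ∨ (∀ x ∈ Ioo α β, deriv f^[n] x < 0) := by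
  by_contra hcon
  push Not at hcon
  obtain ⟨⟨x, hx, hx'⟩, ⟨y, hy, hy'⟩⟩ := hcon
  have hcont : Continuous (deriv f^[n]) := (h.itcd n).continuous_deriv (by norm_num)
  obtain ⟨z, hz, hz0⟩ := isPreconnected_Ioo.intermediate_value hx hy hcont.continuousOn ⟨hx', hy'⟩
  exact h.Gs_deriv (hG hz) n hz0

/-- components of `Gs` are wandering. -/
theorem Sys.Gs_wander (h : Sys f Cr) {α β : ℝ} (h0 : 0 ≤ α) (h1 : β ≤ 1) (hαβ : α < β)
    (hG : Ioo α β ⊆ Gs f Cr) (hα : α ∉ Gs f Cr) (hβ : β ∉ Gs f Cr) {y : ℝ} (hy : y ∈ Ioo α β)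
    {q : ℕ} (hq : 1 ≤ q) (hqy : f^[q] y ∈ Ioo α β) : False := by
  have hmaps : ∀ x ∈ Ioo α β, f^[q] x ∈ Ioo α β := by
    have : f^[q] '' Ioo α β ⊆ Ioo α β := by
      apply comp_max (isPreconnected_Ioo.image _ (h.itcont q).continuousOn) _ hα hβ
      · exact ⟨_, mem_image_of_mem _ hy, hqy⟩
      · rintro _ ⟨z, hz, rfl⟩
        exact h.Gs_maps (hG hz) q
    exact fun x hx => this (mem_image_of_mem _ hx)
  have hmaps2 : ∀ x ∈ Ioo α β, f^[q+q] x ∈ Ioo α β := fun x hx => by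
    rw [Function.iterate_add_apply]; exact hmaps _ (hmaps x hx)
  have hpos : ∀ x ∈ Ioo α β, 0 < deriv f^[q+q] x := by
    intro x hx
    have hdd : deriv f^[q+q] x = deriv f^[q] (f^[q] x) * deriv f^[q] x := by
      have hd2 : Differentiable ℝ f^[q] := (h.itcd q).differentiable (by norm_num)
      rw [Function.iterate_add]
      exact deriv_comp x (hd2 _) (hd2 _)
    rw [hdd]
    rcases h.Gs_sign hG q with hs | hs
    · exact mul_pos (hs _ (hmaps x hx)) (hs _ hx)
    · exact mul_pos_of_neg_of_neg (hs _ (hmaps x hx)) (hs _ hx)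
  have hm : StrictMonoOn f^[q+q] (Icc α β) := by
    apply strictMonoOn_of_deriv_pos (convex_Icc α β) (h.itcont _).continuousOn
    rw [interior_Icc]; exact hpos
  by_cases hz : ∃ z ∈ Ioo α β, f^[q+q] z = z
  · obtain ⟨z, hz, hzf⟩ := hz
    by_cases hz' : ∃ w ∈ Ioo z β, f^[q+q] w = w
    · obtain ⟨w, hw, hwf⟩ := hz'
      refine h.A5 (u := z) (v := w) (by linarith [hz.1]) (by linarith [hw.2]) hw.1
        (q := q + q) (by omega) hzf hwf (hm.mono ?_)
      exact Icc_subset_Icc hz.1.le hw.2.le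
    · push Not at hz'
      refine h.A3 (by linarith [hz.1]) h1 hz.2 (q := q + q) (by omega) (fun x hx => ?_) hz'
      refine ⟨?_, (hmaps2 x ⟨by linarith [hz.1, hx.1], hx.2⟩).2⟩
      have := hm (Ioo_subset_Icc_self hz) (b := x) ⟨by linarith [hz.1, hx.1], hx.2.le⟩ hx.1
      rwa [hzf] at this
  · push Not at hz
    exact h.A3 h0 h1 hαβ (q := q+q) (by omega) hmaps2 hz

theorem Sys.orb (h : Sys f Cr) {s t : ℝ} (hs : 0 ≤ s) (hst : s < t) (ht : t ≤ 1)
    (hfree : ∀ y ∈ Ioo s t, ∀ n : ℕ, f^[n] y ∉ Cr) : ∃ x a b η, Orb f Cr x a b η := by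
  classical
  obtain ⟨x0, hx0⟩ := exists_between hst
  have hx0G : x0 ∈ Gs f Cr := by
    rw [mem_Gs]
    refine ⟨⟨by linarith [hx0.1], by linarith [hx0.2]⟩, ?_⟩
    filter_upwards [Ioo_mem_nhds hx0.1 hx0.2] with z hz using hfree z hz
  have hsub : Gs f Cr ⊆ Ioo 0 1 := fun y hy => hy.1
  choose α β h0 h1 h2 h3 h4 h5 h6 using fun i => comp_exists Gs_open hsub (h.Gs_maps hx0G i)
  have hαβ : ∀ i, α i < β i := fun i => (h1 i).trans (h2 i)
  have hxm : ∀ i, f^[i] x0 ∈ Ioo (α i) (β i) := fun i => ⟨h1 i, h2 i⟩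
  have hdisj' : ∀ i j, i < j → Disjoint (Ioo (α i) (β i)) (Ioo (α j) (β j)) := by
    intro i j hij
    rw [Set.disjoint_left]
    intro y hyi hyj
    have hsubj : Ioo (α j) (β j) ⊆ Ioo (α i) (β i) :=
      comp_max isPreconnected_Ioo (h4 j) (h5 i) (h6 i) ⟨y, hyj, hyi⟩
    refine h.Gs_wander (h0 i) (h3 i) (hαβ i) (h4 i) (h5 i) (h6 i) (hxm i) (q := j - i) (by omega) ?_
    rw [← Function.iterate_add_apply, Nat.sub_add_cancel hij.le]
    exact hsubj (hxm j)
  have hdisj : ∀ i j, i ≠ j → Disjoint (Ioo (α i) (β i)) (Ioo (α j) (β j)) := by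
    intro i j hij
    rcases lt_or_gt_of_ne hij with hl | hl
    · exact hdisj' i j hl
    · exact (hdisj' j i hl).symm
  have hmaps : ∀ i, ∀ y ∈ Ioo (α i) (β i), f y ∈ Ioo (α (i+1)) (β (i+1)) := by
    intro i
    have : f '' Ioo (α i) (β i) ⊆ Ioo (α (i+1)) (β (i+1)) := by
      apply comp_max (isPreconnected_Ioo.image _ h.cont.continuousOn) _ (h5 _) (h6 _)
      · refine ⟨_, mem_image_of_mem _ (hxm i), ?_⟩
        rw [← Function.iterate_succ_apply' f]; exact hxm (i+1)
      · rintro _ ⟨z, hz, rfl⟩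
        exact h.Gs_maps (h4 i hz) 1
    exact fun y hy => this (mem_image_of_mem _ hy)
  have hlim := len_tendsto h0 h3 hαβ hdisj
  -- bad indices
  set Z : Finset ℝ := insert 0 (insert 1 Cr) with hZ
  have hZG : ∀ z ∈ Z, z ∉ Gs f Cr := by
    intro z hz hzG
    rw [hZ, Finset.mem_insert, Finset.mem_insert] at hz
    rcases hz with rfl | rfl | hz
    · exact lt_irrefl _ hzG.1.1
    · exact lt_irrefl _ hzG.1.2
    · exact Gs_nc hzG 0 hz
  have hfinα : ∀ z, {i | α i = z}.Finite := by
    intro z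
    apply Set.Subsingleton.finite
    intro i hi j hj
    by_contra hij
    have hd := Set.disjoint_left.1 (hdisj i j hij)
    obtain ⟨y, hy1, hy2⟩ := exists_between (lt_min (hαβ i) (show α i < β j by
      rw [show α i = z from hi, ← show α j = z from hj]; exact hαβ j))
    rw [lt_min_iff] at hy2
    refine hd ⟨hy1, hy2.1⟩ ⟨?_, hy2.2⟩
    rw [show α j = z from hj, ← show α i = z from hi]; exact hy1
  have hfinβ : ∀ z, {i | β i = z}.Finite := by
    intro z
    apply Set.Subsingleton.finite
    intro i hi j hj
    by_contra hij
    have hd := Set.disjoint_left.1 (hdisj i j hij)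
    obtain ⟨y, hy1, hy2⟩ := exists_between (max_lt (hαβ i) (show α j < β i by
      rw [show β i = z from hi, ← show β j = z from hj]; exact hαβ j))
    rw [max_lt_iff] at hy1
    refine hd ⟨hy1.1, hy2⟩ ⟨hy1.2, ?_⟩
    rw [show β j = z from hj, ← show β i = z from hi]; exact hy2
  have hfin : (⋃ z ∈ Z, ({i | α i = z} ∪ {i | β i = z})).Finite :=
    Z.finite_toSet.biUnion fun z _ => (hfinα z).union (hfinβ z)
  obtain ⟨N1, hN1⟩ := hfin.bddAbove
  obtain ⟨η, hη, hη1, hηs⟩ := pos_lb Cr.offDiag (fun p => |p.1 - p.2|) (fun p hp => by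
    rw [Finset.mem_offDiag] at hp
    exact abs_pos.2 (sub_ne_zero.2 hp.2.2))
  obtain ⟨N2, hN2⟩ := eventually_atTop.1 (hlim.eventually (gt_mem_nhds (show 0 < η / 2 by linarith)))
  set N := N1 + N2 + 1 with hN
  have hgood : ∀ i, N ≤ i → ∀ z ∈ Z, z ∉ Icc (α i) (β i) := by
    intro i hi z hz hzI
    have hzn : z ∉ Ioo (α i) (β i) := fun hm => hZG z hz (h4 i hm)
    have : i ∈ (⋃ z ∈ Z, ({i | α i = z} ∪ {i | β i = z})) := by
      simp only [mem_iUnion]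
      refine ⟨z, hz, ?_⟩
      rcases hzI.1.eq_or_lt with e | e
      · exact Or.inl e
      · rcases hzI.2.eq_or_lt with e' | e'
        · exact Or.inr e'.symm
        · exact absurd ⟨e, e'⟩ hzn
    have := hN1 this
    omega
  have hpos : ∀ i, N ≤ i → 0 < α i := fun i hi =>
    lt_of_le_of_ne (h0 i) fun e => hgood i hi 0 (by simp [hZ]) ⟨e.symm.le, by linarith [hαβ i]⟩
  have hlt1 : ∀ i, N ≤ i → β i < 1 := fun i hi =>
    lt_of_le_of_ne (h3 i) fun e => hgood i hi 1 (by simp [hZ]) ⟨by linarith [hαβ i], e.symm.le⟩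
  have hnc : ∀ i, N ≤ i → ∀ c ∈ Cr, c ∉ Icc (α i) (β i) := fun i hi c hc =>
    hgood i hi c (by simp [hZ, hc])
  have hcl : ∀ i, ∀ y ∈ Icc (α i) (β i), f y ∈ Icc (α (i+1)) (β (i+1)) := by
    intro i
    rw [← closure_Ioo (hαβ i).ne, ← closure_Ioo (hαβ (i+1)).ne]
    exact MapsTo.closure (hmaps i) h.cont
  have hends1 : ∀ i, N ≤ i → ∀ y, y ∈ Icc (α i) (β i) → y ∉ Gs f Cr →
      f y = α (i+1) ∨ f y = β (i+1) := by
    intro i hi y hy hyG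
    have hy01 : y ∈ Ioo (0:ℝ) 1 := ⟨by linarith [hpos i hi, hy.1], by linarith [hlt1 i hi, hy.2]⟩
    have hyG' := (h.Gs_iff hy01 (fun hc => hnc i hi y hc hy)).not.1 hyG
    have hI := hcl i y hy
    rcases hI.1.eq_or_lt with e | e
    · exact Or.inl e.symm
    · rcases hI.2.eq_or_lt with e' | e'
      · exact Or.inr e'
      · exact absurd (h4 _ ⟨e, e'⟩) hyG'
  have hends : ∀ i, N ≤ i → (f (α i) = α (i+1) ∧ f (β i) = β (i+1)) ∨
      (f (α i) = β (i+1) ∧ f (β i) = α (i+1)) := by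
    intro i hi
    have ml := left_mem_Icc.2 (hαβ i).le
    have mr := right_mem_Icc.2 (hαβ i).le
    have hne : f (α i) ≠ f (β i) := by
      rcases h.mono (h0 i) (h3 i) (fun c hc hcI => hnc i hi c hc (Ioo_subset_Icc_self hcI)) with hm | hm
      · exact (hm ml mr (hαβ i)).ne
      · exact (hm ml mr (hαβ i)).ne'
    rcases hends1 i hi _ ml (h5 i) with e | e <;> rcases hends1 i hi _ mr (h6 i) with e' | e'
    · exact absurd (e.trans e'.symm) hne
    · exact Or.inl ⟨e, e'⟩
    · exact Or.inr ⟨e, e'⟩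
    · exact absurd (e.trans e'.symm) hne
  refine ⟨fun i => f^[N + i] x0, fun i => α (N + i), fun i => β (N + i), η, ?_⟩
  refine
    { mem := fun i => hxm _
      step := fun i => ?_
      pos := fun i => hpos _ (by omega)
      lt1 := fun i => hlt1 _ (by omega)
      nc := fun i => hnc _ (by omega)
      ends := fun i => hends _ (by omega)
      maps := fun i => hmaps _
      disj := fun i j hij => hdisj _ _ (by omega)
      ηpos := hη
      η1 := hη1
      len := fun i => hN2 _ (by omega)
      sep := fun c hc d hd hcd => hηs (c, d) (Finset.mem_offDiag.2 ⟨hc, hd, hcd⟩)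
      lim := by
        have := hlim.comp (tendsto_add_atTop_nat N)
        simpa [Function.comp_def, add_comm] using this
      j4 := ?_ }
  · rw [← Function.iterate_succ_apply' f]; rfl
  · intro ε hε K
    simp only [Nat.add_zero]
    have hmemcl : ∀ k, f^[k] (α N) ∈ Icc (α (N+k)) (β (N+k)) := by
      intro k
      induction k with
      | zero => exact left_mem_Icc.2 (hαβ N).le
      | succ k ih => rw [Function.iterate_succ_apply']; exact hcl _ _ ih
    have hcl2 : α N ∈ closure {y | ∃ n : ℕ, f^[n] y ∈ Cr} := by
      by_contra hcon
      exact h5 N ⟨⟨hpos N le_rfl, by linarith [hαβ N, hlt1 N le_rfl]⟩, hcon⟩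
    rw [mem_closure_iff_frequently] at hcl2
    have hev : ∀ᶠ y in nhds (α N), ∀ k ∈ Finset.range K, f^[k] y ∉ Cr := by
      rw [Finset.eventually_all]
      intro k _
      have : f^[k] (α N) ∉ Cr := fun hc => hnc (N+k) (by omega) _ hc (hmemcl k)
      exact ((h.itcont k).tendsto (α N)).eventually (Cr.finite_toSet.isClosed.isOpen_compl.mem_nhds this)
    have hev2 : ∀ᶠ y in nhds (α N), y ∈ Ioo (α N - ε) (α N + ε) :=
      Ioo_mem_nhds (by linarith) (by linarith)
    obtain ⟨y, ⟨k, hk⟩, hy1, hy2⟩ := (hcl2.and_eventually (hev.and hev2)).exists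
    refine ⟨y, hy2, k, ?_, hk⟩
    by_contra hlt
    exact hy1 k (Finset.mem_range.2 (by omega)) hk

variable {x a b : ℕ → ℝ} {η : ℝ}

theorem Orb.it (o : Orb f Cr x a b η) (i k : ℕ) : f^[k] (x i) = x (i + k) := by
  induction k with
  | zero => rfl
  | succ k ih => rw [Function.iterate_succ_apply', ih, o.step]; rfl

theorem Orb.lt (o : Orb f Cr x a b η) (i : ℕ) : a i < b i := (o.mem i).1.trans (o.mem i).2

theorem Orb.sub01 (o : Orb f Cr x a b η) (i : ℕ) : Icc (a i) (b i) ⊆ Ioo 0 1 := fun y hy =>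
  ⟨by linarith [o.pos i, hy.1], by linarith [o.lt1 i, hy.2]⟩

theorem Orb.x01 (o : Orb f Cr x a b η) (i : ℕ) : x i ∈ Ioo (0:ℝ) 1 :=
  o.sub01 i (Ioo_subset_Icc_self (o.mem i))

theorem Orb.cmaps (o : Orb f Cr x a b η) (h : Sys f Cr) (i : ℕ) :
    ∀ y ∈ Icc (a i) (b i), f y ∈ Icc (a (i+1)) (b (i+1)) := by
  rw [← closure_Ioo (o.lt i).ne, ← closure_Ioo (o.lt (i+1)).ne]
  exact MapsTo.closure (o.maps i) h.cont

theorem Orb.itmaps (o : Orb f Cr x a b η) (i k : ℕ) :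
    ∀ y ∈ Ioo (a i) (b i), f^[k] y ∈ Ioo (a (i+k)) (b (i+k)) := by
  intro y hy
  induction k with
  | zero => exact hy
  | succ k ih => rw [Function.iterate_succ_apply']; exact o.maps _ _ ih

/-- The wandering orbit is not attracted to a finite invariant set. -/
theorem Orb.away (o : Orb f Cr x a b η) (h : Sys f Cr) (Z : Finset ℝ)
    (hne : Z.Nonempty) (hZ01 : ∀ z ∈ Z, z ∈ Icc (0:ℝ) 1) (hZf : ∀ z ∈ Z, f z ∈ Z) :
    ∃ ρ > 0, ∀ N : ℕ, ∃ i ≥ N, ρ ≤ infDist (x i) (Z : Set ℝ) := by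
  by_contra hcon
  push Not at hcon
  have hlim0 : ∀ ρ > 0, ∃ N, ∀ i ≥ N, ∃ z ∈ Z, dist (x i) z < ρ := by
    intro ρ hρ
    obtain ⟨N, hN⟩ := hcon ρ hρ
    exact ⟨N, fun i hi => (infDist_lt_iff (Finset.coe_nonempty.2 hne)).1 (hN i hi)⟩
  obtain ⟨ε, hε, hε1, hεs⟩ := pos_lb Z.offDiag (fun p => |p.1 - p.2|) (fun p hp => by
    rw [Finset.mem_offDiag] at hp
    exact abs_pos.2 (sub_ne_zero.2 hp.2.2))
  have hsep : ∀ z ∈ Z, ∀ w ∈ Z, dist z w < ε → z = w := by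
    intro z hz w hw hzw
    by_contra hne
    have := hεs (z, w) (Finset.mem_offDiag.2 ⟨hz, hw, hne⟩)
    rw [Real.dist_eq] at hzw
    simp only at this
    linarith
  have huc : ∃ δ > 0, ∀ z ∈ Z, ∀ y, dist y z < δ → dist (f y) (f z) < ε / 2 := by
    have hex : ∀ z : ℝ, ∃ δ > 0, ∀ y, dist y z < δ → dist (f y) (f z) < ε / 2 := fun z =>
      Metric.continuous_iff.1 h.cont z (ε/2) (by linarith)
    choose δ hδ hδ' using hex
    obtain ⟨δ0, h1, _, h3⟩ := pos_lb Z δ (fun z _ => hδ z)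
    exact ⟨δ0, h1, fun z hz y hy => hδ' z y (lt_of_lt_of_le hy (h3 z hz))⟩
  obtain ⟨δ, hδ, hδ'⟩ := huc
  set r := min δ (ε / 2) with hr
  have hrpos : 0 < r := lt_min hδ (by linarith)
  obtain ⟨N, hN⟩ := hlim0 r hrpos
  obtain ⟨z, hz, hzd⟩ := hN N le_rfl
  have hitZ : ∀ k, f^[k] z ∈ Z := by
    intro k
    induction k with
    | zero => exact hz
    | succ k ih => rw [Function.iterate_succ_apply']; exact hZf _ ih
  have hfollow : ∀ k, dist (x (N + k)) (f^[k] z) < r := by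
    intro k
    induction k with
    | zero => exact hzd
    | succ k ih =>
      obtain ⟨w, hw, hwd⟩ := hN (N + (k + 1)) (by omega)
      have e1 := hδ' _ (hitZ k) _ (lt_of_lt_of_le ih (min_le_left _ _))
      rw [o.step, ← Function.iterate_succ_apply' f] at e1
      have hww : f^[k+1] z = w := by
        apply hsep _ (hitZ _) _ hw
        have := dist_triangle_left (f^[k+1] z) w (x (N + k + 1))
        have h2 : r ≤ ε / 2 := min_le_right _ _
        rw [← Nat.add_assoc] at hwd
        linarith
      rw [hww]
      exact hwd
  have hconv : ∀ ρ > 0, ∃ K, ∀ k ≥ K, dist (x (N + k)) (f^[k] z) < ρ := by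
    intro ρ hρ
    obtain ⟨M, hM⟩ := hlim0 (min ρ (ε/2)) (lt_min hρ (by linarith))
    refine ⟨M, fun k hk => ?_⟩
    obtain ⟨w, hw, hwd⟩ := hM (N + k) (by omega)
    have hww : f^[k] z = w := by
      apply hsep _ (hitZ _) _ hw
      have := dist_triangle_left (f^[k] z) w (x (N + k))
      have h2 : r ≤ ε / 2 := min_le_right _ _
      have h3 : min ρ (ε/2) ≤ ε / 2 := min_le_right _ _
      linarith [hfollow k]
    rw [hww]
    exact lt_of_lt_of_le hwd (min_le_left _ _)
  -- periodic point
  obtain ⟨m, n, hmn, hmn'⟩ : ∃ m n : ℕ, m < n ∧ f^[m] z = f^[n] z := by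
    obtain ⟨m, n, hne, he⟩ := Finite.exists_ne_map_eq_of_infinite (fun k : ℕ => (⟨f^[k] z, hitZ k⟩ : Z))
    have he' : f^[m] z = f^[n] z := congrArg Subtype.val he
    rcases lt_or_gt_of_ne hne with hl | hl
    · exact ⟨m, n, hl, he'⟩
    · exact ⟨n, m, hl, he'.symm⟩
  refine h.A1 (U := Ioo (a 0) (b 0)) (p := f^[m] z) (q := n - m) isOpen_Ioo (nonempty_Ioo.2 (o.lt 0))
    (fun y hy => Ioo_subset_Icc_self (o.sub01 0 (Ioo_subset_Icc_self hy)))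
    (hZ01 _ (hitZ m)) (by omega) ?_ ?_
  · rw [← Function.iterate_add_apply, Nat.sub_add_cancel hmn.le, hmn']
  · intro y hy
    rw [Metric.tendsto_atTop]
    intro ρ hρ
    obtain ⟨K, hK⟩ := hconv (ρ/2) (by linarith)
    obtain ⟨L, hL⟩ := eventually_atTop.1 (o.lim.eventually (gt_mem_nhds (show 0 < ρ / 2 by linarith)))
    refine ⟨N + K + L + m, fun k hk => ?_⟩
    rw [dist_zero_right, Real.norm_of_nonneg infDist_nonneg]
    have e1 : infDist (f^[k] y) (orbit f (f^[m] z)) ≤ dist (f^[k] y) (f^[k - N] z) := by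
      apply infDist_le_dist_of_mem
      refine ⟨k - N - m, ?_⟩
      simp only
      rw [← Function.iterate_add_apply, Nat.sub_add_cancel (by omega)]
    have e2 := hK (k - N) (by omega)
    rw [Nat.add_sub_of_le (by omega)] at e2
    have e3 : dist (f^[k] y) (x k) < ρ / 2 := by
      have i1 := o.itmaps 0 k y hy
      have i2 := o.mem k
      rw [Nat.zero_add] at i1
      rw [Real.dist_eq, abs_lt]
      have := hL k (by omega)
      constructor <;> linarith [i1.1, i1.2, i2.1, i2.2]
    linarith [dist_triangle (f^[k] y) (x k) (f^[k - N] z)]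

end NoHom


/-! ### Part 4: chains of intervals and distortion -/

namespace NoHom

variable {f : ℝ → ℝ} {Cr : Finset ℝ}

/-- nested intervals in the unit interval. -/
def Nest (u a b v : ℝ) : Prop := 0 ≤ u ∧ u < a ∧ a < b ∧ b < v ∧ v ≤ 1

theorem cr_left {u a b v : ℝ} (h : Nest u a b v) : b - a ≤ cr u a b v * (a - u) := by
  obtain ⟨_, h1, h2, h3, _⟩ := h
  have e1 : 0 < a - u := by linarith
  have e2 : 0 < v - b := by linarith
  unfold cr
  rw [div_mul_eq_mul_div, le_div_iff₀ (by positivity)]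
  nlinarith [mul_pos (show 0 < b - a by linarith) e1]

theorem cr_right {u a b v : ℝ} (h : Nest u a b v) : b - a ≤ cr u a b v * (v - b) := by
  obtain ⟨_, h1, h2, h3, _⟩ := h
  have e1 : 0 < a - u := by linarith
  have e2 : 0 < v - b := by linarith
  unfold cr
  rw [div_mul_eq_mul_div, le_div_iff₀ (by positivity)]
  nlinarith [mul_pos (show 0 < b - a by linarith) e2]

theorem cr_pos {u a b v : ℝ} (h : Nest u a b v) : 0 < cr u a b v := by
  obtain ⟨_, h1, h2, h3, _⟩ := h
  unfold cr
  exact div_pos (mul_pos (by linarith) (by linarith)) (mul_pos (by linarith) (by linarith))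

theorem cr_le {u a b v t : ℝ} (h : Nest u a b v) (ht : 0 < t) (h1 : t * (b - a) ≤ a - u)
    (h2 : t * (b - a) ≤ v - b) : cr u a b v ≤ 1 / t ^ 2 + 2 / t := by
  obtain ⟨_, g1, g2, g3, _⟩ := h
  have e1 : 0 < a - u := by linarith
  have e2 : 0 < v - b := by linarith
  have e3 : 0 < b - a := by linarith
  have k1 : (b - a) / (a - u) ≤ 1 / t := by
    rw [div_le_div_iff₀ e1 ht]; linarith
  have k2 : (b - a) / (v - b) ≤ 1 / t := by
    rw [div_le_div_iff₀ e2 ht]; linarith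
  have k3 : 0 ≤ (b - a) / (a - u) := by positivity
  have k4 : 0 ≤ (b - a) / (v - b) := by positivity
  have : cr u a b v = (b - a) / (v - b) + (b - a) / (a - u) * ((b - a) / (v - b))
      + (b - a) / (a - u) := by
    unfold cr
    field_simp
    ring
  rw [this]
  have k5 := mul_le_mul k1 k2 k4 (by positivity)
  have : 1 / t ^ 2 + 2 / t = 1 / t + 1 / t * (1 / t) + 1 / t := by field_simp; ring
  linarith

/-- diffeomorphic step. -/
def DS (f : ℝ → ℝ) (Cr : Finset ℝ) (u a b v u' a' b' v' : ℝ) : Prop :=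
  (∀ c ∈ Cr, c ∉ Ioo u v) ∧
    ((f u = u' ∧ f a = a' ∧ f b = b' ∧ f v = v') ∨ (f u = v' ∧ f a = b' ∧ f b = a' ∧ f v = u'))

/-- passage step. -/
def PS (f : ℝ → ℝ) (r : ℝ) (u a b v u' v' : ℝ) : Prop :=
  (f u ∉ Ioo u' v' ∨ r * (b - a) ≤ a - u) ∧ (f v ∉ Ioo u' v' ∨ r * (b - a) ≤ v - b)

theorem Sys.ds_cr (h : Sys f Cr) {u a b v u' a' b' v' : ℝ} (hn : Nest u a b v)
    (hd : DS f Cr u a b v u' a' b' v') : cr u a b v ≤ cr u' a' b' v' := by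
  obtain ⟨h0, h1, h2, h3, h4⟩ := hn
  have := h.cr_lt h0 h4 hd.1 h1 h2 h3
  rcases hd.2 with ⟨e1, e2, e3, e4⟩ | ⟨e1, e2, e3, e4⟩
  · rw [e1, e2, e3, e4] at this; exact this.le
  · rw [e1, e2, e3, e4] at this
    rw [cr_rev u' a' b' v'] at this; exact this.le

/-- mean value estimate -/
theorem mv_abs (h : Sys f Cr) {p q L : ℝ} (hL : ∀ x ∈ Icc p q, |deriv f x| ≤ L) (hpq : p ≤ q) :
    |f q - f p| ≤ L * (q - p) := by
  have := (convex_Icc p q).norm_image_sub_le_of_norm_deriv_le (f := f)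
      (fun x _ => (h.cd.differentiable (by norm_num)) x) hL (left_mem_Icc.2 hpq) (right_mem_Icc.2 hpq)
  rwa [Real.norm_eq_abs, Real.norm_eq_abs, abs_of_nonneg (sub_nonneg.2 hpq)] at this

theorem sub_lower {u' a' b' v' X y z : ℝ} (hn : Nest u' a' b' v') (hX : cr u' a' b' v' = X)
    (hy : y ∈ Icc a' b') (hz : z ∉ Ioo u' v') : b' - a' ≤ X * |y - z| := by
  have hXp := cr_pos hn
  have h1 := cr_left hn
  have h2 := cr_right hn
  rw [hX] at h1 h2 hXp
  by_cases hzu : z ≤ u'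
  · have : a' - u' ≤ |y - z| := by rw [le_abs]; left; linarith [hy.1]
    nlinarith
  · have hzv : v' ≤ z := by
      by_contra hlt
      exact hz ⟨not_le.1 hzu, not_le.1 hlt⟩
    have : v' - b' ≤ |y - z| := by rw [le_abs]; right; linarith [hy.2]
    nlinarith

/-- Uniform constants for passage steps. -/
theorem Sys.ps_side (h : Sys f Cr) : ∃ C : ℝ, 0 < C ∧ ∃ n : ℕ,
    ∀ u a b v u' a' b' v' r t : ℝ, Nest u a b v → Nest u' a' b' v' →
      (∀ y ∈ Icc a b, f y ∈ Icc a' b') → PS f r u a b v u' v' → 0 < t → t ≤ r →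
      cr u' a' b' v' * (C * (1 + t) ^ n * t) < 1 →
      t * (b - a) ≤ a - u ∧ t * (b - a) ≤ v - b := by
  obtain ⟨C, hC, n, hn3⟩ := h.n3
  refine ⟨C, hC, n, ?_⟩
  intro u a b v u' a' b' v' r t hN hN' hm hps ht htr hlt
  obtain ⟨h0, h1, h2, h3, h4⟩ := id hN
  have hN2 := hN'
  obtain ⟨g0, g1, g2, g3, g4⟩ := hN'
  have hba : 0 < b - a := by linarith
  have hD : ∀ x ∈ Icc a b, ∀ y ∈ Icc a b, |f x - f y| ≤ b' - a' := by
    intro x hx y hy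
    have e1 := hm x hx
    have e2 := hm y hy
    rw [abs_le]
    constructor <;> linarith [e1.1, e1.2, e2.1, e2.2]
  have hX := cr_pos hN2
  set X := cr u' a' b' v' with hXdef
  have hD0 : 0 < b' - a' := by linarith
  -- common final computation
  have fin : ∀ w : ℝ, 0 < w → w < t * (b - a) → ∀ y z : ℝ, y ∈ Icc a' b' → z ∉ Ioo u' v' →
      |y - z| * (b - a) ≤ C * (1 + t) ^ n * (b' - a') * w → False := by
    intro w hw hwt y z hy hz hyz
    have e1 := sub_lower hN2 rfl hy hz
    rw [← hXdef] at e1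
    have e2 : X * (|y - z| * (b - a)) ≤ X * (C * (1 + t) ^ n * (b' - a') * w) :=
      mul_le_mul_of_nonneg_left hyz hX.le
    have hP : 0 < X * C * (1 + t) ^ n * (b' - a') := by positivity
    have e3 : X * C * (1 + t) ^ n * (b' - a') * w < X * C * (1 + t) ^ n * (b' - a') * (t * (b - a)) :=
      mul_lt_mul_of_pos_left hwt hP
    have e4 : (b' - a') * (b - a) ≤ X * |y - z| * (b - a) := mul_le_mul_of_nonneg_right e1 hba.le
    have e5 : X * (C * (1 + t) ^ n * t) * ((b' - a') * (b - a)) < 1 * ((b' - a') * (b - a)) :=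
      mul_lt_mul_of_pos_right hlt (by positivity)
    nlinarith
  constructor
  · by_contra hcon
    push Not at hcon
    rcases hps.1 with hu | hu
    · refine fin (a - u) (by linarith) hcon (f a) (f u) (hm a ⟨le_rfl, h2.le⟩) hu ?_
      have hder : ∀ x ∈ Icc u a, |deriv f x| ≤ C * (1 + t) ^ n * (b' - a') / (b - a) := by
        intro x hx
        rw [le_div_iff₀ hba]
        refine (hn3 u a b b (b' - a') h0 h1.le h2 le_rfl (by linarith) hD x
          ⟨hx.1, by linarith [hx.2]⟩).trans ?_
        have : (b - u) / (b - a) ≤ 1 + t := by rw [div_le_iff₀ hba]; linarith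
        have h0' : 0 ≤ (b - u) / (b - a) := div_nonneg (by linarith) hba.le
        gcongr
      have := mv_abs h hder h1.le
      rw [div_mul_eq_mul_div, le_div_iff₀ hba] at this
      exact this
    · nlinarith
  · by_contra hcon
    push Not at hcon
    rcases hps.2 with hu | hu
    · refine fin (v - b) (by linarith) hcon (f b) (f v) (hm b ⟨h2.le, le_rfl⟩) hu ?_
      have hder : ∀ x ∈ Icc b v, |deriv f x| ≤ C * (1 + t) ^ n * (b' - a') / (b - a) := by
        intro x hx
        rw [le_div_iff₀ hba]
        refine (hn3 a a b v (b' - a') (by linarith) le_rfl h2 h3.le h4 hD x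
          ⟨by linarith [hx.1], hx.2⟩).trans ?_
        have : (v - a) / (b - a) ≤ 1 + t := by rw [div_le_iff₀ hba]; linarith
        have h0' : 0 ≤ (v - a) / (b - a) := div_nonneg (by linarith) hba.le
        gcongr
      have := mv_abs h hder h3.le
      rw [div_mul_eq_mul_div, le_div_iff₀ hba, abs_sub_comm] at this
      exact this
    · nlinarith

/-- derivative estimate for a passage step. -/
theorem Sys.ps_der (h : Sys f Cr) : ∃ C : ℝ, 0 < C ∧
    ∀ a b a' b' : ℝ, 0 ≤ a → a < b → b ≤ 1 →
      (∀ y ∈ Icc a b, f y ∈ Icc a' b') → ∀ x ∈ Icc a b, |deriv f x| * (b - a) ≤ C * (b' - a') := by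
  obtain ⟨C, hC, n, hn3⟩ := h.n3
  refine ⟨C, hC, fun a b a' b' h0 h1 h2 hm x hx => ?_⟩
  have := hn3 a a b b (b' - a') h0 le_rfl h1 le_rfl h2 (fun x hx y hy => by
    have e1 := hm x hx
    have e2 := hm y hy
    rw [abs_le]
    constructor <;> linarith [e1.1, e1.2, e2.1, e2.2]) x hx
  rwa [div_self (by linarith), one_pow, mul_one] at this

theorem seq_bound {X : ℕ → ℝ} {T s : ℕ} {S : Finset ℕ} {κ : ℕ → ℝ} (hκ : Monotone κ)
    (hs : S.card ≤ s) (h0 : X T ≤ κ 0) (hoff : ∀ k < T, k ∉ S → X k ≤ X (k+1))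
    (hon : ∀ k < T, k ∈ S → ∀ i < s, X (k+1) ≤ κ i → X k ≤ κ (i+1)) :
    ∀ k ≤ T, X k ≤ κ s := by
  classical
  have key : ∀ j ≤ T, X (T - j) ≤ κ (S.filter (T - j ≤ ·)).card := by
    intro j hj
    induction j with
    | zero => exact h0.trans (hκ (Nat.zero_le _))
    | succ j ih =>
      have ih := ih (by omega)
      set k := T - (j+1) with hk
      have hk1 : T - j = k + 1 := by omega
      rw [hk1] at ih
      by_cases hkS : k ∈ S
      · have hsub : S.filter (k ≤ ·) = insert k (S.filter (k + 1 ≤ ·)) := by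
          ext y
          simp only [Finset.mem_filter, Finset.mem_insert]
          constructor
          · rintro ⟨h1, h2⟩
            rcases h2.eq_or_lt with e | e
            · exact Or.inl e.symm
            · exact Or.inr ⟨h1, e⟩
          · rintro (rfl | ⟨h1, h2⟩)
            · exact ⟨hkS, le_rfl⟩
            · exact ⟨h1, by omega⟩
        have hcard : (S.filter (k ≤ ·)).card = (S.filter (k + 1 ≤ ·)).card + 1 := by
          rw [hsub, Finset.card_insert_of_notMem]
          simp
        have hle : (S.filter (k ≤ ·)).card ≤ s := (Finset.card_filter_le _ _).trans hs
        rw [hcard]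
        exact hon k (by omega) hkS _ (by omega) ih
      · refine (hoff k (by omega) hkS).trans (ih.trans (hκ (Finset.card_le_card ?_)))
        intro y
        simp only [Finset.mem_filter]
        rintro ⟨h1, h2⟩
        exact ⟨h1, by omega⟩
  intro k hk
  have := key (T - k) (by omega)
  rw [Nat.sub_sub_self hk] at this
  exact this.trans (hκ ((Finset.card_filter_le _ _).trans hs))

theorem seq_prod {Y : ℕ → ℝ} {A : ℝ} (hA : 1 ≤ A) {S : Finset ℕ} (hY : ∀ k, 0 ≤ Y k) (T : ℕ)
    (hoff : ∀ k < T, k ∉ S → Y (k+1) ≤ Y k) (hon : ∀ k < T, k ∈ S → Y (k+1) ≤ A * Y k) :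
    Y T ≤ A ^ S.card * Y 0 := by
  classical
  have key : ∀ k ≤ T, Y k ≤ A ^ (S.filter (· < k)).card * Y 0 := by
    intro k hk
    induction k with
    | zero => simp
    | succ k ih =>
      have ih := ih (by omega)
      by_cases hkS : k ∈ S
      · have hsub : S.filter (· < k + 1) = insert k (S.filter (· < k)) := by
          ext y
          simp only [Finset.mem_filter, Finset.mem_insert]
          constructor
          · rintro ⟨h1, h2⟩
            rcases (Nat.lt_succ_iff.1 h2).eq_or_lt with e | e
            · exact Or.inl e
            · exact Or.inr ⟨h1, e⟩
          · rintro (rfl | ⟨h1, h2⟩)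
            · exact ⟨hkS, by omega⟩
            · exact ⟨h1, by omega⟩
        rw [hsub, Finset.card_insert_of_notMem (by simp), pow_succ]
        have := hon k (by omega) hkS
        nlinarith
      · refine (hoff k (by omega) hkS).trans (ih.trans ?_)
        refine mul_le_mul_of_nonneg_right (pow_le_pow_right₀ hA (Finset.card_le_card ?_)) (hY 0)
        intro y
        simp only [Finset.mem_filter]
        rintro ⟨h1, h2⟩
        exact ⟨h1, by omega⟩
  exact (key T le_rfl).trans (mul_le_mul_of_nonneg_right
    (pow_le_pow_right₀ hA (Finset.card_filter_le _ _)) (hY 0))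

/-- A chain of nested pairs of intervals. -/
structure Chain (f : ℝ → ℝ) (Cr : Finset ℝ) (r : ℝ) (T : ℕ) (u a b v : ℕ → ℝ) (S : Finset ℕ) :
    Prop where
  nest : ∀ k ≤ T, Nest (u k) (a k) (b k) (v k)
  maps : ∀ k < T, ∀ y ∈ Ioo (a k) (b k), f y ∈ Ioo (a (k+1)) (b (k+1))
  ds : ∀ k < T, k ∉ S → DS f Cr (u k) (a k) (b k) (v k) (u (k+1)) (a (k+1)) (b (k+1)) (v (k+1))
  ps : ∀ k < T, k ∈ S → PS f r (u k) (a k) (b k) (v k) (u (k+1)) (v (k+1))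

variable {T : ℕ} {u a b v : ℕ → ℝ} {S : Finset ℕ} {r : ℝ}

theorem Chain.cmaps (h : Sys f Cr) (ch : Chain f Cr r T u a b v S) {k : ℕ} (hk : k < T) :
    ∀ y ∈ Icc (a k) (b k), f y ∈ Icc (a (k+1)) (b (k+1)) := by
  have h1 := (ch.nest k hk.le).2.2.1
  have h2 := (ch.nest (k+1) hk).2.2.1
  rw [← closure_Ioo h1.ne, ← closure_Ioo h2.ne]
  exact MapsTo.closure (ch.maps k hk) h.cont

/-- Bounded cross ratio pulls back to bounded cross ratio. -/
theorem Sys.chainK (h : Sys f Cr) {r : ℝ} (hr : 0 < r) (s : ℕ) (K : ℝ) : ∃ K' : ℝ, K ≤ K' ∧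
    ∀ T u a b v S, Chain f Cr r T u a b v S → S.card ≤ s →
      cr (u T) (a T) (b T) (v T) ≤ K → ∀ k ≤ T, cr (u k) (a k) (b k) (v k) ≤ K' := by
  obtain ⟨C, hC, n, hside⟩ := h.ps_side
  have hex : ∀ K : ℝ, ∃ t : ℝ, 0 < t ∧ t ≤ r ∧ ∀ X, X ≤ K → 0 < X → X * (C * (1 + t) ^ n * t) < 1 := by
    intro K
    set M := (|K| + 1) * C * 2 ^ n with hM
    have hMp : 0 < M := by positivity
    refine ⟨min (min r 1) (1 / (2 * M)), by positivity, (min_le_left _ _).trans (min_le_left _ _), ?_⟩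
    intro X hX hX0
    set t := min (min r 1) (1 / (2 * M)) with ht
    have t0 : 0 < t := by positivity
    have t1 : t ≤ 1 := (min_le_left _ _).trans (min_le_right _ _)
    have t2 : t ≤ 1 / (2 * M) := min_le_right _ _
    have hX' : X ≤ |K| + 1 := by linarith [le_abs_self K]
    calc X * (C * (1 + t) ^ n * t) ≤ (|K| + 1) * (C * (1 + 1) ^ n * (1 / (2 * M))) := by gcongr
      _ = M * (1 / (2 * M)) := by rw [hM]; ring
      _ = 1 / 2 := by field_simp
      _ < 1 := by norm_num
  choose t ht1 ht2 ht3 using hex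
  set θ : ℝ → ℝ := fun K => max K (1 / (t K) ^ 2 + 2 / t K) with hθ
  set κ : ℕ → ℝ := fun i => θ^[i] K with hκ
  have hmono : Monotone κ := monotone_nat_of_le_succ fun i => by
    simp only [hκ, Function.iterate_succ_apply']
    exact le_max_left _ _
  refine ⟨κ s, hmono (Nat.zero_le s), ?_⟩
  intro T u a b v S ch hS hT
  refine seq_bound (X := fun k => cr (u k) (a k) (b k) (v k)) hmono hS hT ?_ ?_
  · intro k hk hkS
    exact h.ds_cr (ch.nest k hk.le) (ch.ds k hk hkS)
  · intro k hk hkS i _ hi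
    simp only [hκ, Function.iterate_succ_apply']
    have hn' := ch.nest (k+1) hk
    obtain ⟨e1, e2⟩ := hside _ _ _ _ _ _ _ _ r (t (θ^[i] K)) (ch.nest k hk.le) hn' (ch.cmaps h hk)
      (ch.ps k hk hkS) (ht1 _) (ht2 _) (ht3 _ _ hi (cr_pos hn'))
    exact (cr_le (ch.nest k hk.le) (ht1 _) e1 e2).trans (le_max_right _ _)

/-- Small cross ratio pulls back to small cross ratio along untrimmed chains. -/
theorem Sys.chainE (h : Sys f Cr) (s : ℕ) {ε : ℝ} (hε : 0 < ε) : ∃ δ > 0, ∃ r > 0,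
    ∀ T u a b v S, Chain f Cr r T u a b v S → S.card ≤ s →
      cr (u T) (a T) (b T) (v T) ≤ δ → ∀ k ≤ T, cr (u k) (a k) (b k) (v k) ≤ ε := by
  obtain ⟨C, hC, n, hside⟩ := h.ps_side
  have hex : ∀ ε : ℝ, ∃ t δ : ℝ, 0 < ε → 0 < t ∧ 0 < δ ∧ δ ≤ ε ∧ 1 / t ^ 2 + 2 / t ≤ ε ∧
      δ * (C * (1 + t) ^ n * t) < 1 := by
    intro ε
    by_cases hε : 0 < ε
    · set t := 1 + 3 / ε with ht
      have h1 : 0 < 3 / ε := by positivity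
      have h2 : 1 ≤ t := by linarith
      have hM : 0 < C * (1 + t) ^ n * t := by positivity
      refine ⟨t, min ε (1 / (2 * (C * (1 + t) ^ n * t))), fun _ => ⟨by linarith, by positivity,
        min_le_left _ _, ?_, ?_⟩⟩
      · have e1 : 1 / t ^ 2 ≤ 1 / t := by
          apply one_div_le_one_div_of_le (by linarith); nlinarith
        have e2 : 3 / t ≤ ε := by
          rw [div_le_iff₀ (by linarith), ht, mul_add, mul_div_cancel₀ _ hε.ne']
          linarith
        have e3 : 3 / t = 1 / t + 2 / t := by ring
        linarith
      · have := min_le_right ε (1 / (2 * (C * (1 + t) ^ n * t)))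
        have h3 := mul_le_mul_of_nonneg_right this hM.le
        have h4 : 1 / (2 * (C * (1 + t) ^ n * t)) * (C * (1 + t) ^ n * t) = 1 / 2 := by
          field_simp
        linarith
    · exact ⟨1, 1, fun h => absurd h hε⟩
  choose t ϑ hh using hex
  have hpos : ∀ i, 0 < ϑ^[i] ε := by
    intro i
    induction i with
    | zero => exact hε
    | succ i ih => rw [Function.iterate_succ_apply']; exact (hh _ ih).2.1
  set κ : ℕ → ℝ := fun i => ϑ^[s - i] ε with hκ
  have hmono : Monotone κ := monotone_nat_of_le_succ fun i => by
    simp only [hκ]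
    rcases Nat.lt_or_ge i s with hi | hi
    · rw [show s - i = (s - (i+1)) + 1 by omega, Function.iterate_succ_apply']
      exact (hh _ (hpos _)).2.2.1
    · rw [show s - i = s - (i+1) by omega]
  obtain ⟨r, hr, hr'⟩ : ∃ r > 0, ∀ i < s, t (κ (i+1)) ≤ r := by
    refine ⟨1 + ∑ i ∈ Finset.range s, t (κ (i+1)), ?_, ?_⟩
    · have : 0 ≤ ∑ i ∈ Finset.range s, t (κ (i+1)) :=
        Finset.sum_nonneg fun i _ => (hh _ (hpos _)).1.le
      linarith
    · intro i hi
      have := Finset.single_le_sum (f := fun i => t (κ (i+1)))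
        (fun i _ => (hh _ (hpos _)).1.le) (Finset.mem_range.2 hi)
      linarith
  refine ⟨κ 0, hpos _, r, hr, ?_⟩
  intro T u a b v S ch hS hT
  have hs : κ s = ε := by simp [hκ]
  rw [← hs]
  refine seq_bound (X := fun k => cr (u k) (a k) (b k) (v k)) hmono hS hT ?_ ?_
  · intro k hk hkS
    exact h.ds_cr (ch.nest k hk.le) (ch.ds k hk hkS)
  · intro k hk hkS i his hi
    have hn' := ch.nest (k+1) hk
    obtain ⟨g1, g2, g3, g4, g5⟩ := hh (κ (i+1)) (hpos _)
    have hκi : κ i = ϑ (κ (i+1)) := by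
      simp only [hκ]
      rw [← Function.iterate_succ_apply' ϑ]
      congr 1
      congr 1
      omega
    have hlt : cr (u (k+1)) (a (k+1)) (b (k+1)) (v (k+1)) *
        (C * (1 + t (κ (i+1))) ^ n * t (κ (i+1))) < 1 := by
      refine lt_of_le_of_lt (mul_le_mul_of_nonneg_right (hi.trans hκi.le) (by positivity)) g5
    obtain ⟨e1, e2⟩ := hside _ _ _ _ _ _ _ _ r (t (κ (i+1))) (ch.nest k hk.le) hn' (ch.cmaps h hk)
      (ch.ps k hk hkS) g1 (hr' i his) hlt
    exact (cr_le (ch.nest k hk.le) g1 e1 e2).trans g4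

/-- the density function. -/
def tau (u a b v z : ℝ) : ℝ := min (1 / (b - z) - 1 / (v - z)) (1 / (z - a) - 1 / (z - u))

theorem tau_le {u a b v z : ℝ} (hn : Nest u a b v) (hz : z ∈ Ioo a b) :
    tau u a b v z ≤ 2 / (b - a) := by
  obtain ⟨h0, h1, h2, h3, h4⟩ := hn
  have e1 : 0 < b - z := by linarith [hz.2]
  have e2 : 0 < z - a := by linarith [hz.1]
  have e3 : 0 < 1 / (v - z) := one_div_pos.2 (by linarith)
  have e4 : 0 < 1 / (z - u) := one_div_pos.2 (by linarith)
  rcases le_total (b - z) (z - a) with h | h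
  · refine (min_le_right _ _).trans ?_
    have : 1 / (z - a) ≤ 2 / (b - a) := by
      rw [div_le_div_iff₀ e2 (by linarith)]; linarith
    linarith
  · refine (min_le_left _ _).trans ?_
    have : 1 / (b - z) ≤ 2 / (b - a) := by
      rw [div_le_div_iff₀ e1 (by linarith)]; linarith
    linarith

theorem le_tau {u a b v z : ℝ} (hn : Nest u a b v) (hz : z ∈ Ioo a b) :
    1 / ((b - a) * (1 + cr u a b v)) ≤ tau u a b v z := by
  have hX := cr_pos hn
  have hl := cr_left hn
  have hr := cr_right hn
  obtain ⟨h0, h1, h2, h3, h4⟩ := hn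
  set X := cr u a b v
  have e1 : 0 < b - z := by linarith [hz.2]
  have e2 : 0 < z - a := by linarith [hz.1]
  have e3 : 0 < v - z := by linarith
  have e4 : 0 < z - u := by linarith
  have e5 : 0 < b - a := by linarith
  refine le_min ?_ ?_
  · rw [div_sub_div _ _ e1.ne' e3.ne', div_le_div_iff₀ (by positivity) (by positivity)]
    have : (b - z) * (v - z) ≤ (b - a) * (v - a) := by
      apply mul_le_mul <;> linarith
    have h6 : v - a ≤ (1 + X) * (v - b) := by linarith
    have h7 : (b - a) * (v - a) ≤ (b - a) * ((1 + X) * (v - b)) := mul_le_mul_of_nonneg_left h6 e5.le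
    nlinarith
  · rw [div_sub_div _ _ e2.ne' e4.ne', div_le_div_iff₀ (by positivity) (by positivity)]
    have : (z - a) * (z - u) ≤ (b - a) * (b - u) := by
      apply mul_le_mul <;> linarith
    have h6 : b - u ≤ (1 + X) * (a - u) := by linarith
    have h7 : (b - a) * (b - u) ≤ (b - a) * ((1 + X) * (a - u)) := mul_le_mul_of_nonneg_left h6 e5.le
    nlinarith

theorem Sys.ds_tau (h : Sys f Cr) {u a b v u' a' b' v' z : ℝ} (hn : Nest u a b v)
    (hn' : Nest u' a' b' v') (hd : DS f Cr u a b v u' a' b' v') (hz : z ∈ Ioo a b)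
    (hz' : f z ∈ Ioo a' b') :
    |deriv f z| * tau u' a' b' v' (f z) ≤ tau u a b v z := by
  obtain ⟨h0, h1, h2, h3, h4⟩ := hn
  obtain ⟨g0, g1, g2, g3, g4⟩ := hn'
  have hzI : z ∈ Ioo u v := ⟨by linarith [hz.1], by linarith [hz.2]⟩
  have hR := h.right_abs h0 h4 hd.1 hzI hz.2 h3 le_rfl
  have hL := h.left_abs h0 h4 hd.1 hzI hz.1 h1 le_rfl
  have habs := abs_nonneg (deriv f z)
  unfold tau
  rcases hd.2 with ⟨e1, e2, e3, e4⟩ | ⟨e1, e2, e3, e4⟩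
  · rw [e3, e4, abs_of_pos (show 0 < b' - f z by linarith [hz'.2]), abs_of_pos (show 0 < v' - f z by linarith [hz'.2])] at hR
    rw [e1, e2, abs_of_neg (show a' - f z < 0 by linarith [hz'.1]), abs_of_neg (show u' - f z < 0 by linarith [hz'.1]), neg_sub, neg_sub] at hL
    exact le_min ((mul_le_mul_of_nonneg_left (min_le_left _ _) habs).trans hR)
      ((mul_le_mul_of_nonneg_left (min_le_right _ _) habs).trans hL)
  · rw [e1, e2, abs_of_pos (show 0 < b' - f z by linarith [hz'.2]), abs_of_pos (show 0 < v' - f z by linarith [hz'.2])] at hL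
    rw [e3, e4, abs_of_neg (show a' - f z < 0 by linarith [hz'.1]), abs_of_neg (show u' - f z < 0 by linarith [hz'.1]), neg_sub, neg_sub] at hR
    exact le_min ((mul_le_mul_of_nonneg_left (min_le_right _ _) habs).trans hR)
      ((mul_le_mul_of_nonneg_left (min_le_left _ _) habs).trans hL)

/-- Derivative bound along chains. -/
theorem Sys.chainD (h : Sys f Cr) {r : ℝ} (hr : 0 < r) (s : ℕ) (K : ℝ) : ∃ D : ℝ, 0 < D ∧
    ∀ T u a b v S, Chain f Cr r T u a b v S → S.card ≤ s →
      cr (u T) (a T) (b T) (v T) ≤ K → ∀ z ∈ Ioo (a 0) (b 0),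
        |deriv f^[T] z| * (b 0 - a 0) ≤ D * (b T - a T) := by
  obtain ⟨K', hKK, hK'⟩ := h.chainK hr s K
  obtain ⟨C, hC, hder⟩ := h.ps_der
  set A := 1 + 2 * C * (1 + |K'|) with hA
  have hA1 : 1 ≤ A := by have : 0 ≤ 2 * C * (1 + |K'|) := by positivity
                         linarith
  refine ⟨A ^ s * 2 * (1 + |K'|), by positivity, ?_⟩
  intro T u a b v S ch hS hT z hz
  have hX := hK' T u a b v S ch hS hT
  have hzk : ∀ k ≤ T, f^[k] z ∈ Ioo (a k) (b k) := by
    intro k hk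
    induction k with
    | zero => exact hz
    | succ k ih => rw [Function.iterate_succ_apply']; exact ch.maps k (by omega) _ (ih (by omega))
  have htp : ∀ k ≤ T, 0 < tau (u k) (a k) (b k) (v k) (f^[k] z) := fun k hk => by
    refine lt_of_lt_of_le ?_ (le_tau (ch.nest k hk) (hzk k hk))
    have := cr_pos (ch.nest k hk)
    have := (ch.nest k hk).2.2.1
    have : 0 < b k - a k := by linarith
    positivity
  set Y : ℕ → ℝ := fun k => if k ≤ T then |deriv f^[k] z| * tau (u k) (a k) (b k) (v k) (f^[k] z) else 0
    with hY
  have hYT : Y T ≤ A ^ S.card * Y 0 := by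
    apply seq_prod hA1
    · intro k
      simp only [hY]
      split_ifs with hk
      · exact mul_nonneg (abs_nonneg _) (htp k hk).le
      · exact le_rfl
    · intro k hk hkS
      simp only [hY, if_pos hk.le, if_pos (show k + 1 ≤ T from hk)]
      rw [h.deriv_it, abs_mul, Function.iterate_succ_apply']
      have := h.ds_tau (ch.nest k hk.le) (ch.nest (k+1) hk) (ch.ds k hk hkS) (hzk k hk.le)
        (by rw [← Function.iterate_succ_apply' f]; exact hzk (k+1) hk)
      have hn := abs_nonneg (deriv f^[k] z)
      nlinarith
    · intro k hk hkS
      simp only [hY, if_pos hk.le, if_pos (show k + 1 ≤ T from hk)]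
      rw [h.deriv_it, abs_mul]
      have n1 := ch.nest k hk.le
      have n2 := ch.nest (k+1) hk
      have l1 : 0 < b k - a k := by linarith [n1.2.2.1]
      have l2 : 0 < b (k+1) - a (k+1) := by linarith [n2.2.2.1]
      have d1 := hder (a k) (b k) (a (k+1)) (b (k+1)) (by linarith [n1.1, n1.2.1]) n1.2.2.1
        (by linarith [n1.2.2.2.1, n1.2.2.2.2]) (ch.cmaps h hk) _ (Ioo_subset_Icc_self (hzk k hk.le))
      have d2 := tau_le n2 (hzk (k+1) hk)
      have d3 := le_tau n1 (hzk k hk.le)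
      have hXk := hX k hk.le
      have hXp := cr_pos n1
      set τ' := tau (u (k+1)) (a (k+1)) (b (k+1)) (v (k+1)) (f^[k+1] z)
      set τ := tau (u k) (a k) (b k) (v k) (f^[k] z)
      set P := |deriv f (f^[k] z)|
      have hP : 0 ≤ P := abs_nonneg _
      have hτ' : 0 < τ' := htp (k+1) hk
      have d2' : τ' * (b (k+1) - a (k+1)) ≤ 2 := by rwa [le_div_iff₀ l2] at d2
      have d3' : 1 ≤ τ * ((b k - a k) * (1 + |K'|)) := by
        rw [div_le_iff₀ (by positivity)] at d3
        have hτ : 0 < τ := htp k hk.le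
        have : cr (u k) (a k) (b k) (v k) ≤ |K'| := hXk.trans (le_abs_self _)
        have h5 : τ * ((b k - a k) * (1 + cr (u k) (a k) (b k) (v k))) ≤
          τ * ((b k - a k) * (1 + |K'|)) := by gcongr
        linarith
      have hτ : 0 < τ := htp k hk.le
      have key : P * τ' ≤ A * τ := by
        have s1 : P * τ' * (b k - a k) ≤ C * 2 := by
          have : P * (b k - a k) * τ' ≤ C * (b (k+1) - a (k+1)) * τ' :=
            mul_le_mul_of_nonneg_right d1 hτ'.le
          nlinarith
        have s2 : C * 2 ≤ (C * 2) * (τ * ((b k - a k) * (1 + |K'|))) :=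
          le_mul_of_one_le_right (by positivity) d3'
        have s3 : P * τ' * (b k - a k) ≤ (2 * C * (1 + |K'|) * τ) * (b k - a k) := by
          linarith
        have s4 := le_of_mul_le_mul_right s3 l1
        have : A * τ = τ + 2 * C * (1 + |K'|) * τ := by rw [hA]; ring
        linarith
      have hn := abs_nonneg (deriv f^[k] z)
      nlinarith
  have n0 := ch.nest 0 (Nat.zero_le _)
  have nT := ch.nest T le_rfl
  have l0 : 0 < b 0 - a 0 := by linarith [n0.2.2.1]
  have lT : 0 < b T - a T := by linarith [nT.2.2.1]
  simp only [hY, if_pos le_rfl, if_pos (Nat.zero_le T)] at hYT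
  have hd0 : deriv f^[0] z = 1 := by simp
  rw [hd0, abs_one, one_mul] at hYT
  have t0 := tau_le n0 (hzk 0 (Nat.zero_le _))
  have tT := le_tau nT (hzk T le_rfl)
  have hXT : cr (u T) (a T) (b T) (v T) ≤ |K'| := (hX T le_rfl).trans (le_abs_self _)
  have hXp := cr_pos nT
  set τT := tau (u T) (a T) (b T) (v T) (f^[T] z)
  set τ0 := tau (u 0) (a 0) (b 0) (v 0) (f^[0] z)
  have hτT : 0 < τT := htp T le_rfl
  rw [le_div_iff₀ l0] at t0
  rw [div_le_iff₀ (by positivity)] at tT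
  have tT' : 1 ≤ τT * ((b T - a T) * (1 + |K'|)) := by
    refine tT.trans ?_
    gcongr
  have hpow : A ^ S.card ≤ A ^ s := pow_le_pow_right₀ hA1 hS
  have hApos : 0 < A ^ s := by positivity
  have hτ0 : 0 < τ0 := htp 0 (Nat.zero_le _)
  set P := |deriv f^[T] z|
  have hP : 0 ≤ P := abs_nonneg _
  calc P * (b 0 - a 0) ≤ P * (b 0 - a 0) * (τT * ((b T - a T) * (1 + |K'|))) :=
        le_mul_of_one_le_right (by positivity) tT'
    _ = (P * τT) * ((b 0 - a 0) * ((b T - a T) * (1 + |K'|))) := by ring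
    _ ≤ (A ^ s * τ0) * ((b 0 - a 0) * ((b T - a T) * (1 + |K'|))) := by
        apply mul_le_mul_of_nonneg_right _ (by positivity)
        exact hYT.trans (mul_le_mul_of_nonneg_right hpow hτ0.le)
    _ = A ^ s * (τ0 * (b 0 - a 0)) * (1 + |K'|) * (b T - a T) := by ring
    _ ≤ A ^ s * 2 * (1 + |K'|) * (b T - a T) := by gcongr

end NoHom


/-! ### Part 5: pull-backs, trimmed chains -/

namespace NoHom

variable {f : ℝ → ℝ} {Cr : Finset ℝ}

/-- `(u,v)` is mapped into `(w₁,w₂)` with endpoints going to endpoints. -/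
structure Pull (f : ℝ → ℝ) (u v w₁ w₂ : ℝ) : Prop where
  maps : ∀ y ∈ Ioo u v, f y ∈ Ioo w₁ w₂
  lft : f u = w₁ ∨ f u = w₂
  rgt : f v = w₁ ∨ f v = w₂

theorem Pull.nl {u v w₁ w₂ : ℝ} (p : Pull f u v w₁ w₂) : f u ∉ Ioo w₁ w₂ := by
  intro hm
  rcases p.lft with e | e <;> rw [e] at hm
  · exact lt_irrefl _ hm.1
  · exact lt_irrefl _ hm.2

theorem Pull.nr {u v w₁ w₂ : ℝ} (p : Pull f u v w₁ w₂) : f v ∉ Ioo w₁ w₂ := by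
  intro hm
  rcases p.rgt with e | e <;> rw [e] at hm
  · exact lt_irrefl _ hm.1
  · exact lt_irrefl _ hm.2

theorem Pull.cmaps (h : Sys f Cr) {u v w₁ w₂ : ℝ} (p : Pull f u v w₁ w₂) (huv : u < v)
    (hw : w₁ < w₂) : ∀ y ∈ Icc u v, f y ∈ Icc w₁ w₂ := by
  rw [← closure_Ioo huv.ne, ← closure_Ioo hw.ne]
  exact MapsTo.closure p.maps h.cont

/-- An endpoint of an interval mapped into `(w₁,w₂)` whose image leaves the interval. -/
theorem Sys.endpt (h : Sys f Cr) {u v w₁ w₂ e : ℝ} (huv : u < v) (hw : w₁ < w₂)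
    (hm : ∀ y ∈ Ioo u v, f y ∈ Ioo w₁ w₂) (he : e ∈ Icc u v) (hn : f e ∉ Ioo w₁ w₂) :
    f e = w₁ ∨ f e = w₂ := by
  have h1 : MapsTo f (Icc u v) (Icc w₁ w₂) := by
    rw [← closure_Ioo huv.ne, ← closure_Ioo hw.ne]
    exact MapsTo.closure hm h.cont
  have h2 := h1 he
  by_contra hcon
  push Not at hcon
  exact hn ⟨lt_of_le_of_ne h2.1 (Ne.symm hcon.1), lt_of_le_of_ne h2.2 hcon.2⟩

theorem Sys.bdry (h : Sys f Cr) {e : ℝ} (he : e = 0 ∨ e = 1) : f e = 0 ∨ f e = 1 := by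
  rcases he with rfl | rfl
  · exact h.b0
  · exact h.b1

theorem Sys.pull_exists (h : Sys f Cr) {w₁ w₂ x : ℝ} (h0 : 0 ≤ w₁) (h1 : w₂ ≤ 1)
    (hx : x ∈ Ioo (0:ℝ) 1) (hfx : f x ∈ Ioo w₁ w₂) :
    ∃ u v, 0 ≤ u ∧ u < x ∧ x < v ∧ v ≤ 1 ∧ Pull f u v w₁ w₂ ∧
      ∀ S : Set ℝ, IsPreconnected S → S ⊆ Ioo 0 1 → (∀ y ∈ S, f y ∈ Ioo w₁ w₂) → x ∈ S →
        S ⊆ Ioo u v := by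
  have hw : w₁ < w₂ := hfx.1.trans hfx.2
  set Ω : Set ℝ := Ioo 0 1 ∩ f ⁻¹' Ioo w₁ w₂ with hΩ
  have hΩo : IsOpen Ω := isOpen_Ioo.inter (isOpen_Ioo.preimage h.cont)
  obtain ⟨u, v, hu0, hux, hxv, hv1, hsub, hu, hv⟩ := comp_exists hΩo inter_subset_left
    (show x ∈ Ω from ⟨hx, hfx⟩)
  have key : ∀ e, e ∈ Icc u v → e ∉ Ω → f e = w₁ ∨ f e = w₂ := by
    intro e he heΩ
    apply h.endpt (hux.trans hxv) hw (fun y hy => (hsub hy).2) he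
    intro hfe
    by_cases he01 : e ∈ Ioo (0:ℝ) 1
    · exact heΩ ⟨he01, hfe⟩
    · have : e = 0 ∨ e = 1 := by
        by_contra hcon
        push Not at hcon
        exact he01 ⟨lt_of_le_of_ne (hu0.trans he.1) hcon.1.symm,
          lt_of_le_of_ne (he.2.trans hv1) hcon.2⟩
      rcases h.bdry this with e1 | e1 <;> rw [e1] at hfe
      · linarith [hfe.1]
      · linarith [hfe.2]
  have huv := hux.trans hxv
  refine ⟨u, v, hu0, hux, hxv, hv1, ⟨fun y hy => (hsub hy).2, key u ⟨le_rfl, huv.le⟩ hu,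
    key v ⟨huv.le, le_rfl⟩ hv⟩, ?_⟩
  intro S hS hS01 hSf hxS
  exact comp_max (Ω := Ω) hS (fun y hy => ⟨hS01 hy, hSf y hy⟩) hu hv ⟨x, hxS, hux, hxv⟩

/-- pulled back intervals stay away from the boundary. -/
theorem Sys.pull_in (h : Sys f Cr) {a b a' b' : ℝ} (h0 : 0 ≤ a) (h1 : b ≤ 1) (hab : a < b)
    (h0' : 0 < a') (h1' : b' < 1) (p : Pull f a b a' b') (hab' : a' < b') : 0 < a ∧ b < 1 := by
  constructor
  · refine lt_of_le_of_ne h0 ?_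
    intro e
    rcases h.bdry (Or.inl e.symm) with e1 | e1 <;> rcases p.lft with e2 | e2 <;> linarith
  · refine lt_of_le_of_ne h1 ?_
    intro e
    rcases h.bdry (Or.inr e) with e1 | e1 <;> rcases p.rgt with e2 | e2 <;> linarith

/-- outer pull-back around an inner pull-back. -/
theorem Sys.pull_outer (h : Sys f Cr) {a b u' a' b' v' : ℝ} (h0 : 0 ≤ a) (h1 : b ≤ 1)
    (hab : a < b) (p : Pull f a b a' b') (hn : Nest u' a' b' v') :
    ∃ u v, Nest u a b v ∧ Pull f u v u' v' := by
  obtain ⟨g0, g1, g2, g3, g4⟩ := hn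
  obtain ⟨ha0, hb1⟩ := h.pull_in h0 h1 hab (by linarith) (by linarith) p g2
  have hx : (a + b)/2 ∈ Ioo a b := ⟨by linarith, by linarith⟩
  have hfx := p.maps _ hx
  obtain ⟨u, v, hu0, hux, hxv, hv1, hp, hmax⟩ := h.pull_exists (w₁ := u') (w₂ := v')
    (x := (a + b)/2) g0 g4 ⟨by linarith, by linarith⟩ ⟨by linarith [hfx.1], by linarith [hfx.2]⟩
  have := hmax (Icc a b) isPreconnected_Icc (fun y hy => ⟨by linarith [hy.1], by linarith [hy.2]⟩)
    (fun y hy => by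
      have := p.cmaps h hab g2 y hy
      exact ⟨by linarith [this.1], by linarith [this.2]⟩) ⟨hx.1.le, hx.2.le⟩
  exact ⟨u, v, ⟨hu0, (this ⟨le_rfl, hab.le⟩).1, hab, (this ⟨hab.le, le_rfl⟩).2, hv1⟩, hp⟩

theorem Sys.pull_ds (h : Sys f Cr) {u a b v u' a' b' v' : ℝ} (hn : Nest u a b v)
    (hn' : Nest u' a' b' v') (p : Pull f u v u' v') (q : Pull f a b a' b')
    (hc : ∀ c ∈ Cr, c ∉ Ioo u v) : DS f Cr u a b v u' a' b' v' := by
  obtain ⟨h0, h1, h2, h3, h4⟩ := hn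
  obtain ⟨g0, g1, g2, g3, g4⟩ := hn'
  refine ⟨hc, ?_⟩
  have hu : u ∈ Icc u v := ⟨le_rfl, by linarith⟩
  have ha : a ∈ Icc u v := ⟨by linarith, by linarith⟩
  have hb : b ∈ Icc u v := ⟨by linarith, by linarith⟩
  have hv : v ∈ Icc u v := ⟨by linarith, by linarith⟩
  have huv : u < v := by linarith
  rcases h.mono h0 h4 hc with hm | hm
  · left
    have e1 := hm hu hv huv
    have e2 := hm ha hb h2
    refine ⟨?_, ?_, ?_, ?_⟩
    · rcases p.lft with e | e <;> rcases p.rgt with e' | e' <;> linarith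
    · rcases q.lft with e | e <;> rcases q.rgt with e' | e' <;> linarith
    · rcases q.lft with e | e <;> rcases q.rgt with e' | e' <;> linarith
    · rcases p.lft with e | e <;> rcases p.rgt with e' | e' <;> linarith
  · right
    have e1 := hm hu hv huv
    have e2 := hm ha hb h2
    refine ⟨?_, ?_, ?_, ?_⟩
    · rcases p.lft with e | e <;> rcases p.rgt with e' | e' <;> linarith
    · rcases q.lft with e | e <;> rcases q.rgt with e' | e' <;> linarith
    · rcases q.lft with e | e <;> rcases q.rgt with e' | e' <;> linarith
    · rcases p.lft with e | e <;> rcases p.rgt with e' | e' <;> linarith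

/-- Backward recursion. -/
theorem exists_back {α : Type*} {T : ℕ} (P : ℕ → α → Prop) (R : ℕ → α → α → Prop)
    (hstep : ∀ k < T, ∀ q', P (k+1) q' → ∃ q, P k q ∧ R k q q') (qT : α) (hT : P T qT) :
    ∃ Q : ℕ → α, Q T = qT ∧ (∀ k ≤ T, P k (Q k)) ∧ ∀ k < T, R k (Q k) (Q (k+1)) := by
  induction T generalizing qT with
  | zero =>
    refine ⟨fun _ => qT, rfl, ?_, ?_⟩
    · intro k hk
      obtain rfl : k = 0 := by omega
      exact hT
    · intro k hk; omega
  | succ T ih =>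
    obtain ⟨q, hq, hR⟩ := hstep T (by omega) qT hT
    obtain ⟨Q, h1, h2, h3⟩ := ih (fun k hk => hstep k (by omega)) q hq
    refine ⟨fun k => if k ≤ T then Q k else qT, by simp, ?_, ?_⟩
    · intro k hk
      by_cases hkT : k ≤ T
      · simp only [hkT, if_true]; exact h2 k hkT
      · obtain rfl : k = T + 1 := by omega
        simpa using hT
    · intro k hk
      by_cases hkT : k < T
      · have e1 : k ≤ T := by omega
        have e2 : k + 1 ≤ T := by omega
        simp only [e1, e2, if_true]; exact h3 k hkT
      · obtain rfl : k = T := by omega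
        simp only [le_refl, if_true, show ¬ (k + 1 ≤ k) by omega, if_false, h1]
        exact hR

/-- critical passages of a sequence of intervals. -/
def passes (Cr : Finset ℝ) (T : ℕ) (u v : ℕ → ℝ) : Finset ℕ := by
  classical
  exact (Finset.range T).filter fun k => ∃ c ∈ Cr, c ∈ Ioo (u k) (v k)

theorem mem_passes {T : ℕ} {u v : ℕ → ℝ} {k : ℕ} :
    k ∈ passes Cr T u v ↔ k < T ∧ ∃ c ∈ Cr, c ∈ Ioo (u k) (v k) := by
  classical
  unfold passes
  rw [Finset.mem_filter, Finset.mem_range]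

/-- Chain from two nested pull-back sequences. -/
theorem Sys.pull_chain (h : Sys f Cr) {T : ℕ} {u a b v : ℕ → ℝ} (r : ℝ)
    (hn : ∀ k ≤ T, Nest (u k) (a k) (b k) (v k))
    (hp : ∀ k < T, Pull f (u k) (v k) (u (k+1)) (v (k+1)))
    (hq : ∀ k < T, Pull f (a k) (b k) (a (k+1)) (b (k+1))) :
    Chain f Cr r T u a b v (passes Cr T u v) := by
  refine ⟨hn, fun k hk => (hq k hk).maps, ?_, ?_⟩
  · intro k hk hkS
    apply h.pull_ds (hn k hk.le) (hn (k+1) hk) (hp k hk) (hq k hk)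
    intro c hc hcI
    exact hkS (mem_passes.2 ⟨hk, c, hc, hcI⟩)
  · intro k hk _
    exact ⟨Or.inl (hp k hk).nl, Or.inl (hp k hk).nr⟩

/-- Existence of outer pull-back sequence. -/
theorem Sys.outer_seq (h : Sys f Cr) {T : ℕ} {a b : ℕ → ℝ} (h0 : ∀ k ≤ T, 0 ≤ a k)
    (h1 : ∀ k ≤ T, b k ≤ 1) (hab : ∀ k ≤ T, a k < b k)
    (hq : ∀ k < T, Pull f (a k) (b k) (a (k+1)) (b (k+1))) {u₀ v₀ : ℝ}
    (hT : Nest u₀ (a T) (b T) v₀) :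
    ∃ u v : ℕ → ℝ, u T = u₀ ∧ v T = v₀ ∧ (∀ k ≤ T, Nest (u k) (a k) (b k) (v k)) ∧
      ∀ k < T, Pull f (u k) (v k) (u (k+1)) (v (k+1)) := by
  obtain ⟨Q, hQ1, hQ2, hQ3⟩ := exists_back (T := T) (α := ℝ × ℝ)
    (fun k q => Nest q.1 (a k) (b k) q.2) (fun _ q q' => Pull f q.1 q.2 q'.1 q'.2)
    (fun k hk q' hq' => by
      obtain ⟨u, v, hn, hp⟩ := h.pull_outer (h0 k hk.le) (h1 k hk.le) (hab k hk.le) (hq k hk) hq'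
      exact ⟨(u, v), hn, hp⟩) (u₀, v₀) hT
  exact ⟨fun k => (Q k).1, fun k => (Q k).2, by simp [hQ1], by simp [hQ1], hQ2, hQ3⟩

variable {x a b : ℕ → ℝ} {η : ℝ}

theorem Orb.pull (o : Orb f Cr x a b η) (i : ℕ) : Pull f (a i) (b i) (a (i+1)) (b (i+1)) := by
  refine ⟨o.maps i, ?_, ?_⟩ <;> rcases o.ends i with ⟨e1, e2⟩ | ⟨e1, e2⟩
  · exact Or.inl e1
  · exact Or.inr e1
  · exact Or.inr e2
  · exact Or.inl e2

theorem Orb.surj (o : Orb f Cr x a b η) (h : Sys f Cr) (i k : ℕ) :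
    Ioo (a (i+k)) (b (i+k)) ⊆ f^[k] '' Ioo (a i) (b i) := by
  induction k with
  | zero => simp
  | succ k ih =>
    have h1 : Ioo (a (i+k+1)) (b (i+k+1)) ⊆ f '' Ioo (a (i+k)) (b (i+k)) := by
      rcases o.ends (i+k) with ⟨e1, e2⟩ | ⟨e1, e2⟩
      · rw [← e1, ← e2]; exact intermediate_value_Ioo (o.lt _).le h.cont.continuousOn
      · rw [← e1, ← e2]; exact intermediate_value_Ioo' (o.lt _).le h.cont.continuousOn
    rw [Function.iterate_succ', image_comp]
    exact h1.trans (image_mono ih)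

/-- Trimmed chains. -/
structure TC (f : ℝ → ℝ) (Cr : Finset ℝ) (a b : ℕ → ℝ) (η : ℝ) (T : ℕ) (u v : ℕ → ℝ) : Prop where
  nest : ∀ k ≤ T, Nest (u k) (a k) (b k) (v k)
  maps : ∀ k < T, ∀ y ∈ Ioo (u k) (v k), f y ∈ Ioo (u (k+1)) (v (k+1))
  step : ∀ k < T, DS f Cr (u k) (a k) (b k) (v k) (u (k+1)) (a (k+1)) (b (k+1)) (v (k+1)) ∨
    (PS f (η/4) (u k) (a k) (b k) (v k) (u (k+1)) (v (k+1)) ∧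
      ∃ d ∈ Cr, d ∈ Ioo (u k) (v k) ∧ ∀ c ∈ Cr, c ∈ Ioo (u k) (v k) → c = d)

theorem TC.chain {T : ℕ} {u v : ℕ → ℝ} (t : TC f Cr a b η T u v) (o : Orb f Cr x a b η) :
    Chain f Cr (η/4) T u a b v (passes Cr T u v) := by
  refine ⟨t.nest, fun k _ => o.maps k, ?_, ?_⟩
  · intro k hk hkS
    rcases t.step k hk with h1 | ⟨_, d, hd, hdI, _⟩
    · exact h1
    · exact absurd (mem_passes.2 ⟨hk, d, hd, hdI⟩) hkS
  · intro k hk hkS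
    obtain ⟨_, d, hd, hdI⟩ := mem_passes.1 hkS
    rcases t.step k hk with h1 | ⟨h1, _⟩
    · exact absurd hdI (h1.1 d hd)
    · exact h1

theorem TC.itmaps {T : ℕ} {u v : ℕ → ℝ} (t : TC f Cr a b η T u v) {k j : ℕ} (hkj : k + j ≤ T) :
    ∀ y ∈ Ioo (u k) (v k), f^[j] y ∈ Ioo (u (k+j)) (v (k+j)) := by
  intro y hy
  induction j with
  | zero => exact hy
  | succ j ih => rw [Function.iterate_succ_apply']; exact t.maps (k+j) (by omega) _ (ih (by omega))

theorem TC.only {T : ℕ} {u v : ℕ → ℝ} (t : TC f Cr a b η T u v) {k : ℕ} (hk : k < T) {c d : ℝ}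
    (hc : c ∈ Cr) (hd : d ∈ Cr) (hcI : c ∈ Ioo (u k) (v k)) (hdI : d ∈ Ioo (u k) (v k)) :
    c = d := by
  rcases t.step k hk with h1 | ⟨_, e, _, _, hu⟩
  · exact absurd hdI (h1.1 d hd)
  · rw [hu c hc hcI, hu d hd hdI]

theorem Sys.tc_step (h : Sys f Cr) (o : Orb f Cr x a b η) (k : ℕ) {u' v' : ℝ}
    (hn : Nest u' (a (k+1)) (b (k+1)) v') :
    ∃ u v, Nest u (a k) (b k) v ∧ (∀ y ∈ Ioo u v, f y ∈ Ioo u' v') ∧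
     (DS f Cr u (a k) (b k) v u' (a (k+1)) (b (k+1)) v' ∨
      (PS f (η/4) u (a k) (b k) v u' v' ∧
        ∃ d ∈ Cr, d ∈ Ioo u v ∧ ∀ c ∈ Cr, c ∈ Ioo u v → c = d)) := by
  obtain ⟨u, v, hN, hp⟩ := h.pull_outer (o.pos k).le (o.lt1 k).le (o.lt k) (o.pull k) hn
  by_cases hc : ∀ c ∈ Cr, c ∉ Ioo u v
  · exact ⟨u, v, hN, hp.maps, Or.inl (h.pull_ds hN hn hp (o.pull k) hc)⟩
  push Not at hc
  have hη := o.ηpos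
  have hη1 := o.η1
  have hlen := o.len k
  obtain ⟨c0, hc0, hc0I⟩ := hc
  -- nearest critical point
  set g : ℝ → ℝ := fun c => max (a k - c) (c - b k) with hg
  obtain ⟨d, hd, hdmin⟩ := Finset.exists_min_image (Cr.filter fun c => c ∈ Ioo u v) g
    ⟨c0, Finset.mem_filter.2 ⟨hc0, hc0I⟩⟩
  rw [Finset.mem_filter] at hd
  obtain ⟨hd, hdI⟩ := hd
  obtain ⟨n0, n1, n2, n3, n4⟩ := hN
  have hdn := o.nc k d hd
  have hdcase : d < a k ∨ b k < d := by
    by_contra hcon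
    push Not at hcon
    exact hdn ⟨hcon.1, hcon.2⟩
  have hr1 : η/4 * (b k - a k) ≤ η/4 := by nlinarith [o.pos k, o.lt1 k, o.lt k]
  have hother : ∀ c ∈ Cr, c ∈ Ioo u v → c ≠ d → η ≤ |c - d| ∧ (c < a k ∨ b k < c) ∧
      g d ≤ g c := by
    intro c hc hcI hcd
    refine ⟨o.sep c hc d hd hcd, ?_, hdmin c (Finset.mem_filter.2 ⟨hc, hcI⟩)⟩
    by_contra hcon
    push Not at hcon
    exact o.nc k c hc ⟨hcon.1, hcon.2⟩
  rcases hdcase with hda | hda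
  · refine ⟨max u (d - η), min v (b k + η/4), ⟨le_max_of_le_left n0, max_lt n1 (by linarith), n2,
      lt_min n3 (by linarith), min_le_of_left_le n4⟩, ?_, Or.inr ⟨⟨?_, ?_⟩, d, hd, ?_, ?_⟩⟩
    · intro y hy
      exact hp.maps y ⟨lt_of_le_of_lt (le_max_left _ _) hy.1, lt_of_lt_of_le hy.2 (min_le_left _ _)⟩
    · rcases max_choice u (d - η) with e | e <;> rw [e]
      · exact Or.inl hp.nl
      · right; linarith
    · rcases min_choice v (b k + η/4) with e | e <;> rw [e]
      · exact Or.inl hp.nr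
      · right; linarith
    · exact ⟨max_lt hdI.1 (by linarith), lt_min hdI.2 (by linarith)⟩
    · intro c hc hcI
      by_contra hcd
      have hcI1 := lt_of_le_of_lt (le_max_left _ _) hcI.1
      have hcI2 := lt_of_le_of_lt (le_max_right _ _) hcI.1
      have hcI3 := lt_of_lt_of_le hcI.2 (min_le_left _ _)
      have hcI4 := lt_of_lt_of_le hcI.2 (min_le_right _ _)
      obtain ⟨e1, e2, e3⟩ := hother c hc ⟨hcI1, hcI3⟩ hcd
      have hgd : a k - d ≤ g d := le_max_left _ _
      rcases e2 with e2 | e2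
      · have hgc : g c = a k - c := max_eq_left (by linarith)
        rcases abs_cases (c - d) with ⟨q, q'⟩ | ⟨q, q'⟩ <;> linarith
      · have hgc : g c = c - b k := max_eq_right (by linarith)
        rcases abs_cases (c - d) with ⟨q, q'⟩ | ⟨q, q'⟩ <;> linarith
  · refine ⟨max u (a k - η/4), min v (d + η), ⟨le_max_of_le_left n0, max_lt n1 (by linarith), n2,
      lt_min n3 (by linarith), min_le_of_left_le n4⟩, ?_, Or.inr ⟨⟨?_, ?_⟩, d, hd, ?_, ?_⟩⟩
    · intro y hy
      exact hp.maps y ⟨lt_of_le_of_lt (le_max_left _ _) hy.1, lt_of_lt_of_le hy.2 (min_le_left _ _)⟩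
    · rcases max_choice u (a k - η/4) with e | e <;> rw [e]
      · exact Or.inl hp.nl
      · right; linarith
    · rcases min_choice v (d + η) with e | e <;> rw [e]
      · exact Or.inl hp.nr
      · right; linarith
    · exact ⟨max_lt hdI.1 (by linarith), lt_min hdI.2 (by linarith)⟩
    · intro c hc hcI
      by_contra hcd
      have hcI1 := lt_of_le_of_lt (le_max_left _ _) hcI.1
      have hcI2 := lt_of_le_of_lt (le_max_right _ _) hcI.1
      have hcI3 := lt_of_lt_of_le hcI.2 (min_le_left _ _)
      have hcI4 := lt_of_lt_of_le hcI.2 (min_le_right _ _)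
      obtain ⟨e1, e2, e3⟩ := hother c hc ⟨hcI1, hcI3⟩ hcd
      have hgd : d - b k ≤ g d := le_max_right _ _
      rcases e2 with e2 | e2
      · have hgc : g c = a k - c := max_eq_left (by linarith)
        rcases abs_cases (c - d) with ⟨q, q'⟩ | ⟨q, q'⟩ <;> linarith
      · have hgc : g c = c - b k := max_eq_right (by linarith)
        rcases abs_cases (c - d) with ⟨q, q'⟩ | ⟨q, q'⟩ <;> linarith

theorem Sys.tc_exists (h : Sys f Cr) (o : Orb f Cr x a b η) (T : ℕ) {u₀ v₀ : ℝ}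
    (hT : Nest u₀ (a T) (b T) v₀) : ∃ u v, u T = u₀ ∧ v T = v₀ ∧ TC f Cr a b η T u v := by
  obtain ⟨Q, hQ1, hQ2, hQ3⟩ := exists_back (T := T) (α := ℝ × ℝ)
    (fun k q => Nest q.1 (a k) (b k) q.2) (fun k q q' => (∀ y ∈ Ioo q.1 q.2, f y ∈ Ioo q'.1 q'.2) ∧
     (DS f Cr q.1 (a k) (b k) q.2 q'.1 (a (k+1)) (b (k+1)) q'.2 ∨
      (PS f (η/4) q.1 (a k) (b k) q.2 q'.1 q'.2 ∧
        ∃ d ∈ Cr, d ∈ Ioo q.1 q.2 ∧ ∀ c ∈ Cr, c ∈ Ioo q.1 q.2 → c = d)))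
    (fun k hk q' hq' => by
      obtain ⟨u, v, hn, hp⟩ := h.tc_step o k hq'
      exact ⟨(u, v), hn, hp⟩) (u₀, v₀) hT
  exact ⟨fun k => (Q k).1, fun k => (Q k).2, by simp [hQ1], by simp [hQ1], hQ2,
    fun k hk => (hQ3 k hk).1, fun k hk => (hQ3 k hk).2⟩

/-- Long trimmed chains with bounded final cross ratio have many passes. -/
theorem Sys.star (h : Sys f Cr) (o : Orb f Cr x a b η) (s : ℕ) (K : ℝ) :
    ∃ T₀ : ℕ, ∀ T ≥ T₀, ∀ u v, TC f Cr a b η T u v → cr (u T) (a T) (b T) (v T) ≤ K →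
      s < (passes Cr T u v).card := by
  obtain ⟨K', _, hK'⟩ := h.chainK (r := η/4) (by linarith [o.ηpos]) s K
  have hab := o.lt 0
  set ε := (b 0 - a 0) / max K' 1 with hε
  have hm : (1:ℝ) ≤ max K' 1 := le_max_right _ _
  have hεpos : 0 < ε := div_pos (by linarith) (by linarith)
  have hε1 : ε ≤ b 0 - a 0 := div_le_self (by linarith) hm
  set A : Set ℕ := {k | ∃ y ∈ Ioo (a 0 - ε) (a 0 + ε), f^[k] y ∈ Cr} with hA
  have hAinf : A.Infinite := by
    rw [Set.infinite_iff_exists_gt]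
    intro n
    obtain ⟨y, hy, k, hk, hkC⟩ := o.j4 ε hεpos (n+1)
    exact ⟨k, ⟨y, hy, hkC⟩, by omega⟩
  obtain ⟨F, hF, hFc⟩ := hAinf.exists_subset_card_eq (s+1)
  refine ⟨F.sup id + 1, ?_⟩
  intro T hT u v t hcr
  by_contra hcon
  push Not at hcon
  have h0 := hK' T u a b v _ (t.chain o) hcon hcr 0 (by omega)
  have hN := t.nest 0 (by omega)
  have hleft := cr_left hN
  have hpos : 0 < a 0 - u 0 := by linarith [hN.2.1]
  have hub : ε ≤ a 0 - u 0 := by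
    rw [hε, div_le_iff₀ (by linarith)]
    have : cr (u 0) (a 0) (b 0) (v 0) * (a 0 - u 0) ≤ max K' 1 * (a 0 - u 0) :=
      mul_le_mul_of_nonneg_right (h0.trans (le_max_left _ _)) hpos.le
    linarith
  have hsub : F ⊆ passes Cr T u v := by
    intro k hk
    obtain ⟨y, hy, hyc⟩ := hF hk
    have hkT : k < T := by
      have : k ≤ F.sup id := Finset.le_sup (f := id) hk
      omega
    refine mem_passes.2 ⟨hkT, _, hyc, ?_⟩
    have := t.itmaps (k := 0) (j := k) (by omega) y
      ⟨by linarith [hy.1], by linarith [hy.2, hN.2.2.2.1]⟩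
    simpa using this
  have := Finset.card_le_card hsub
  omega

end NoHom


/-! ### Part 6: repeated passes -/

namespace NoHom

variable {f : ℝ → ℝ} {Cr : Finset ℝ} {x a b : ℕ → ℝ} {η : ℝ}

/-- images of intervals around the same turning point are nested. -/
theorem Sys.img_nested (h : Sys f Cr) {d u v u' v' : ℝ} (hd : d ∈ Cr) (h0 : 0 ≤ u) (h1 : v ≤ 1)
    (h0' : 0 ≤ u') (h1' : v' ≤ 1) (hdI : d ∈ Ioo u v) (hdI' : d ∈ Ioo u' v')
    (ho : ∀ c ∈ Cr, c ∈ Ioo u v → c = d) (ho' : ∀ c ∈ Cr, c ∈ Ioo u' v' → c = d) :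
    f '' Ioo u v ⊆ f '' Ioo u' v' ∨ f '' Ioo u' v' ⊆ f '' Ioo u v := by
  have hc1 : (f '' Ioo u v).OrdConnected :=
    (isPreconnected_Ioo.image f h.cont.continuousOn).ordConnected
  have hc2 : (f '' Ioo u' v').OrdConnected :=
    (isPreconnected_Ioo.image f h.cont.continuousOn).ordConnected
  have hm1 : f d ∈ f '' Ioo u v := ⟨d, hdI, rfl⟩
  have hm2 : f d ∈ f '' Ioo u' v' := ⟨d, hdI', rfl⟩
  by_contra hcon
  push Not at hcon
  obtain ⟨hcon1, hcon2⟩ := hcon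
  obtain ⟨y, hy, hy'⟩ := not_subset.1 hcon1
  obtain ⟨z, hz, hz'⟩ := not_subset.1 hcon2
  have hsub : ∀ p ∈ Ioo u v, ∀ c ∈ Cr, c ∈ uIcc p d → c = d := fun p hp c hc hcI =>
    ho c hc ((ordConnected_Ioo.uIcc_subset hp hdI) hcI)
  have hsub' : ∀ p ∈ Ioo u' v', ∀ c ∈ Cr, c ∈ uIcc p d → c = d := fun p hp c hc hcI =>
    ho' c hc ((ordConnected_Ioo.uIcc_subset hp hdI') hcI)
  obtain ⟨p, hp, rfl⟩ := hy
  obtain ⟨q, hq, rfl⟩ := hz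
  have hp01 : p ∈ Icc (0:ℝ) 1 := ⟨by linarith [hp.1], by linarith [hp.2]⟩
  have hq01 : q ∈ Icc (0:ℝ) 1 := ⟨by linarith [hq.1], by linarith [hq.2]⟩
  rcases h.turn d hd with ht | ht
  · have e1 := ht p hp01 (hsub p hp)
    have e2 := ht q hq01 (hsub' q hq)
    rcases le_total (f p) (f q) with hpq | hpq
    · exact hz' (hc1.out ⟨p, hp, rfl⟩ hm1 ⟨hpq, e2⟩)
    · exact hy' (hc2.out ⟨q, hq, rfl⟩ hm2 ⟨hpq, e1⟩)
  · have e1 := ht p hp01 (hsub p hp)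
    have e2 := ht q hq01 (hsub' q hq)
    rcases le_total (f p) (f q) with hpq | hpq
    · exact hy' (hc2.out hm2 ⟨q, hq, rfl⟩ ⟨e1, hpq⟩)
    · exact hz' (hc1.out hm1 ⟨p, hp, rfl⟩ ⟨e2, hpq⟩)

/-- Dichotomy for repeated passes. -/
theorem TC.repeat {T : ℕ} {u v : ℕ → ℝ} (t : TC f Cr a b η T u v) (h : Sys f Cr)
    (o : Orb f Cr x a b η) {k s : ℕ} (hs : 1 ≤ s) (hk : k + s < T) {d : ℝ} (hd : d ∈ Cr)
    (hdk : d ∈ Ioo (u k) (v k)) (hdk' : d ∈ Ioo (u (k+s)) (v (k+s))) :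
    (∀ n, k + 1 ≤ n → n + s ≤ T → Ioo (a n) (b n) ⊆ Ioo (u (n+s)) (v (n+s))) ∨
    ∃ Q : Set ℝ, IsOpen Q ∧ Q.OrdConnected ∧ Q ⊆ Ioo 0 1 ∧ Icc (a k) (b k) ⊆ Q ∧ x (k+s) ∈ Q ∧
      (∀ y ∈ Q, f^[s] y ∈ Q) ∧ ∀ y ∈ Q, f^[T-k] y ∈ Ioo (u T) (v T) := by
  have n1 := t.nest k (by omega)
  have n2 := t.nest (k+s) (by omega)
  rcases h.img_nested hd n1.1 n1.2.2.2.2 n2.1 n2.2.2.2.2 hdk hdk'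
    (fun c hc hcI => t.only (by omega) hc hd hcI hdk)
    (fun c hc hcI => t.only (by omega) hc hd hcI hdk') with hsub | hsub
  · left
    intro n hn hnT y hy
    obtain ⟨j, rfl⟩ : ∃ j, n = k + 1 + j := ⟨n - (k+1), by omega⟩
    have h1 := o.surj h k (1 + j)
    rw [show k + (1 + j) = k + 1 + j by ring] at h1
    obtain ⟨z, hz, rfl⟩ := h1 hy
    have hzV : z ∈ Ioo (u k) (v k) := ⟨by linarith [n1.2.1, hz.1], by linarith [n1.2.2.2.1, hz.2]⟩
    obtain ⟨w, hw, hwz⟩ := hsub ⟨z, hzV, rfl⟩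
    have := t.itmaps (k := k+s) (j := 1 + j) (by omega) w hw
    rw [show k + s + (1 + j) = k + 1 + j + s by ring] at this
    rw [Nat.add_comm 1 j, Function.iterate_succ_apply, ← hwz, ← Function.iterate_succ_apply,
      Nat.succ_eq_add_one, Nat.add_comm j 1]
    exact this
  · right
    have key : ∀ y ∈ Ioo (u k) (v k) ∪ Ioo (u (k+s)) (v (k+s)), ∀ j, 1 ≤ j → k + j ≤ T →
        f^[j] y ∈ Ioo (u (k+j)) (v (k+j)) := by
      rintro y (hy | hy) j hj hjT
      · exact t.itmaps hjT y hy
      · obtain ⟨w, hw, hwy⟩ := hsub ⟨y, hy, rfl⟩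
        have := t.itmaps hjT w hw
        obtain ⟨i, rfl⟩ : ∃ i, j = i + 1 := ⟨j - 1, by omega⟩
        rw [Function.iterate_succ_apply, ← hwy, ← Function.iterate_succ_apply]
        exact this
    refine ⟨Ioo (u k) (v k) ∪ Ioo (u (k+s)) (v (k+s)), isOpen_Ioo.union isOpen_Ioo,
      (IsPreconnected.union d hdk hdk' isPreconnected_Ioo isPreconnected_Ioo).ordConnected,
      ?_, ?_, ?_, ?_, ?_⟩
    · apply union_subset <;> apply Ioo_subset_Ioo
      exacts [n1.1, n1.2.2.2.2, n2.1, n2.2.2.2.2]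
    · intro y hy
      exact Or.inl ⟨by linarith [n1.2.1, hy.1], by linarith [n1.2.2.2.1, hy.2]⟩
    · right
      have := o.mem (k+s)
      exact ⟨by linarith [n2.2.1, this.1], by linarith [n2.2.2.2.1, this.2]⟩
    · intro y hy
      exact Or.inr (key y hy s hs (by omega))
    · intro y hy
      have := key y hy (T-k) (by omega) (by omega)
      rwa [show k + (T - k) = T by omega] at this

/-- Invariant open sets. -/
structure Inv (f : ℝ → ℝ) (Ω : Set ℝ) : Prop where
  op : IsOpen Ω
  sub : Ω ⊆ Ioo 0 1
  inv : ∀ y ∈ Ioo (0:ℝ) 1, y ∈ Ω ↔ f y ∈ Ω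

theorem Inv.inv' {Ω : Set ℝ} (i : Inv f Ω) (h : Sys f Cr) {y : ℝ} (hy : y ∈ Icc (0:ℝ) 1) :
    y ∈ Ω ↔ f y ∈ Ω := by
  by_cases hy' : y ∈ Ioo (0:ℝ) 1
  · exact i.inv y hy'
  · have : y = 0 ∨ y = 1 := by
      by_contra hcon
      push Not at hcon
      exact hy' ⟨lt_of_le_of_ne hy.1 hcon.1.symm, lt_of_le_of_ne hy.2 hcon.2⟩
    constructor
    · intro h1; exact absurd (i.sub h1) hy'
    · intro h1
      have := i.sub h1
      rcases h.bdry ‹y = 0 ∨ y = 1› with e | e <;> rw [e] at this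
      · exact absurd this.1 (lt_irrefl _)
      · exact absurd this.2 (lt_irrefl _)

theorem Inv.it {Ω : Set ℝ} (i : Inv f Ω) (h : Sys f Cr) {y : ℝ} (hy : y ∈ Icc (0:ℝ) 1) (n : ℕ) :
    y ∈ Ω ↔ f^[n] y ∈ Ω := by
  induction n with
  | zero => rfl
  | succ n ih => rw [Function.iterate_succ_apply', ← i.inv' h (h.itmaps n y hy), ih]

/-- The saturation of an open set. -/
def Sat (f : ℝ → ℝ) (Q : Set ℝ) : Set ℝ := {y | y ∈ Ioo (0:ℝ) 1 ∧ ∃ i, f^[i] y ∈ Q}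

theorem Sys.sat_inv (h : Sys f Cr) {Q : Set ℝ} (hQ : IsOpen Q) (hQ01 : Q ⊆ Ioo 0 1) {s : ℕ}
    (hs : 1 ≤ s) (hQs : ∀ y ∈ Q, f^[s] y ∈ Q) : Inv f (Sat f Q) := by
  refine ⟨?_, fun y hy => hy.1, ?_⟩
  · have : Sat f Q = Ioo 0 1 ∩ ⋃ i, f^[i] ⁻¹' Q := by
      ext y; simp [Sat]
    rw [this]
    exact isOpen_Ioo.inter (isOpen_iUnion fun i => hQ.preimage (h.itcont i))
  · intro y hy
    constructor
    · rintro ⟨_, i, hi⟩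
      have key : ∃ j, f^[j] (f y) ∈ Q := by
        rcases Nat.eq_zero_or_pos i with rfl | hi0
        · refine ⟨s - 1, ?_⟩
          rw [← Function.iterate_succ_apply, Nat.succ_eq_add_one, Nat.sub_add_cancel hs]
          exact hQs y hi
        · refine ⟨i - 1, ?_⟩
          rw [← Function.iterate_succ_apply, Nat.succ_eq_add_one, Nat.sub_add_cancel hi0]
          exact hi
      refine ⟨?_, key⟩
      by_contra hcon
      have hfy := h.maps y ⟨hy.1.le, hy.2.le⟩
      have he : f y = 0 ∨ f y = 1 := by
        by_contra hcon'
        push Not at hcon'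
        exact hcon ⟨lt_of_le_of_ne hfy.1 hcon'.1.symm, lt_of_le_of_ne hfy.2 hcon'.2⟩
      have hb : ∀ j, f^[j] (f y) = 0 ∨ f^[j] (f y) = 1 := by
        intro j
        induction j with
        | zero => exact he
        | succ j ih => rw [Function.iterate_succ_apply']; exact h.bdry ih
      obtain ⟨j, hj⟩ := key
      have := hQ01 hj
      rcases hb j with e | e <;> rw [e] at this
      · exact absurd this.1 (lt_irrefl _)
      · exact absurd this.2 (lt_irrefl _)
    · rintro ⟨_, i, hi⟩
      exact ⟨hy, i + 1, by rwa [Function.iterate_succ_apply]⟩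

/-- `x i` and `x j` lie in the same component of `Ω`. -/
def Same (Ω : Set ℝ) (x : ℕ → ℝ) (i j : ℕ) : Prop := uIcc (x i) (x j) ⊆ Ω

theorem Same.symm {Ω : Set ℝ} {i j : ℕ} (s : Same Ω x i j) : Same Ω x j i := by
  unfold Same at *; rwa [uIcc_comm]

theorem Same.trans {Ω : Set ℝ} {i j k : ℕ} (s : Same Ω x i j) (s' : Same Ω x j k) :
    Same Ω x i k :=
  (uIcc_subset_uIcc_union_uIcc (a := x i) (b := x j) (c := x k)).trans (union_subset s s')

theorem Same.push {Ω : Set ℝ} {i j : ℕ} (s : Same Ω x i j) (I : Inv f Ω) (h : Sys f Cr)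
    (o : Orb f Cr x a b η) (n : ℕ) : Same Ω x (i+n) (j+n) := by
  have h1 : uIcc (f^[n] (x i)) (f^[n] (x j)) ⊆ f^[n] '' uIcc (x i) (x j) :=
    intermediate_value_uIcc (h.itcont n).continuousOn
  unfold Same
  rw [← o.it i n, ← o.it j n]
  intro y hy
  obtain ⟨z, hz, rfl⟩ := h1 hy
  exact (I.it h (Ioo_subset_Icc_self (I.sub (s hz))) n).1 (s hz)

/-- the sets `E_M`. -/
def EM (f : ℝ → ℝ) (x a b : ℕ → ℝ) (M : ℕ) (Ω : Set ℝ) (n : ℕ) : Prop :=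
  Inv f Ω ∧ Icc (a 0) (b 0) ⊆ Ω ∧ (∃ p, 1 ≤ p ∧ Same Ω x n (n+p)) ∧
    ∀ q, 1 ≤ q → q < M → ¬ Same Ω x n (n+q)

theorem Orb.citmaps (o : Orb f Cr x a b η) (h : Sys f Cr) (i k : ℕ) :
    ∀ y ∈ Icc (a i) (b i), f^[k] y ∈ Icc (a (i+k)) (b (i+k)) := by
  intro y hy
  induction k with
  | zero => exact hy
  | succ k ih => rw [Function.iterate_succ_apply']; exact o.cmaps h _ _ ih

theorem Sys.sat_J0 (h : Sys f Cr) (o : Orb f Cr x a b η) {Q : Set ℝ} {k : ℕ}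
    (hQ : Icc (a k) (b k) ⊆ Q) : Icc (a 0) (b 0) ⊆ Sat f Q := by
  intro y hy
  refine ⟨o.sub01 0 hy, k, hQ ?_⟩
  have := o.citmaps h 0 k y hy
  simpa using this

theorem sub_sat {Q : Set ℝ} (hQ01 : Q ⊆ Ioo 0 1) : Q ⊆ Sat f Q :=
  fun y hy => ⟨hQ01 hy, 0, hy⟩

end NoHom


/-! ### Part 7: step one -/

namespace NoHom

variable {f : ℝ → ℝ} {Cr : Finset ℝ} {x a b : ℕ → ℝ} {η : ℝ}

theorem record {L d : ℕ → ℝ} (hL : ∀ i, 0 < L i) (hd : ∀ i, 0 ≤ d i)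
    (hsm : ∀ ε > 0, ∃ i, 0 < d i ∧ L i < ε * d i) (N : ℕ) {ε : ℝ} (hε : 0 < ε) :
    ∃ m ≥ N, 0 < d m ∧ L m ≤ ε * d m ∧ ∀ j < m, L m * d j ≤ L j * d m := by
  classical
  obtain ⟨δ, hδ, _, hδ'⟩ := pos_lb (Finset.range N) (fun j => L j / (d j + 1))
    (fun j _ => div_pos (hL j) (by linarith [hd j]))
  have hex := hsm (min ε δ) (lt_min hε hδ)
  set ε' := min ε δ with hε'
  have hε'0 : 0 < ε' := lt_min hε hδ
  set m := Nat.find hex with hm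
  obtain ⟨h1, h2⟩ := Nat.find_spec hex
  refine ⟨m, ?_, h1, ?_, ?_⟩
  · by_contra hlt
    push Not at hlt
    have h3 := hδ' m (Finset.mem_range.2 hlt)
    rw [le_div_iff₀ (by linarith [hd m])] at h3
    have h4 : ε' ≤ δ := min_le_right _ _
    have h5 : ε' * d m ≤ δ * (d m + 1) := by
      have := mul_le_mul_of_nonneg_right h4 (hd m)
      linarith
    exact absurd h2 (not_lt.2 (h5.trans h3))
  · have : ε' * d m ≤ ε * d m := mul_le_mul_of_nonneg_right (min_le_left _ _) (hd m)
    exact h2.le.trans this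
  · intro j hj
    have h3 := Nat.find_min hex hj
    rcases (hd j).eq_or_lt with e | e
    · rw [← e]; simp only [mul_zero]; exact mul_nonneg (hL j).le (hd m)
    · have h4 : ε' * d j ≤ L j := by
        by_contra hcon
        exact h3 ⟨e, not_le.1 hcon⟩
      have h5 : L m * d j ≤ ε' * d m * d j := mul_le_mul_of_nonneg_right h2.le (hd j)
      have h6 : ε' * d j * d m ≤ L j * d m := mul_le_mul_of_nonneg_right h4 (hd m)
      linarith

theorem disj_cases {a b c d : ℝ} (hab : a < b) (hcd : c < d) (h : Disjoint (Ioo a b) (Ioo c d)) :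
    b ≤ c ∨ d ≤ a := by
  rw [Ioo_disjoint_Ioo] at h
  by_contra hcon
  push Not at hcon
  have : max a c < min b d := max_lt (lt_min hab hcon.2) (lt_min hcon.1 hcd)
  linarith

/-- components are mapped into themselves -/
theorem Inv.comp_self {Ω : Set ℝ} (I : Inv f Ω) (h : Sys f Cr) (o : Orb f Cr x a b η) {α β : ℝ}
    {k q : ℕ} (hsub : Ioo α β ⊆ Ω) (hα : α ∉ Ω) (hβ : β ∉ Ω) (hx : x k ∈ Ioo α β)
    (hs : Same Ω x k (k+q)) : ∀ y ∈ Ioo α β, f^[q] y ∈ Ioo α β := by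
  have h1 : uIcc (x k) (x (k+q)) ⊆ Ioo α β :=
    comp_max isPreconnected_uIcc hs hα hβ ⟨x k, left_mem_uIcc, hx⟩
  have h2 : f^[q] '' Ioo α β ⊆ Ioo α β := by
    apply comp_max (Ω := Ω) (isPreconnected_Ioo.image _ (h.itcont q).continuousOn) _ hα hβ
    · exact ⟨x (k+q), ⟨x k, hx, o.it k q⟩, h1 right_mem_uIcc⟩
    · rintro _ ⟨y, hy, rfl⟩
      exact (I.it h (Ioo_subset_Icc_self (I.sub (hsub hy))) q).1 (hsub hy)
  intro y hy
  exact h2 ⟨y, hy, rfl⟩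

/-- two distinct passes with a common critical point. -/
theorem TC.two_passes {T : ℕ} {u v : ℕ → ℝ} {S : Finset ℕ} (hS : S ⊆ passes Cr T u v)
    (hc : Cr.card < S.card) :
    ∃ k s : ℕ, 1 ≤ s ∧ k + s < T ∧ k ∈ S ∧ k + s ∈ S ∧
      ∃ d ∈ Cr, d ∈ Ioo (u k) (v k) ∧ d ∈ Ioo (u (k+s)) (v (k+s)) := by
  classical
  have hex : ∀ k : ℕ, ∃ c : ℝ, k ∈ S → c ∈ Cr ∧ c ∈ Ioo (u k) (v k) := by
    intro k
    by_cases hk : k ∈ S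
    · obtain ⟨_, c, hc, hcI⟩ := mem_passes.1 (hS hk)
      exact ⟨c, fun _ => ⟨hc, hcI⟩⟩
    · exact ⟨0, fun h => absurd h hk⟩
  choose g hg using hex
  obtain ⟨k, hk, k', hk', hne, he⟩ := Finset.exists_ne_map_eq_of_card_lt_of_maps_to hc
    (f := g) (fun k hk => (hg k hk).1)
  wlog hlt : k < k' generalizing k k'
  · exact this k' hk' k hk hne.symm he.symm (by omega)
  refine ⟨k, k' - k, by omega, ?_, hk, ?_, g k, (hg k hk).1, (hg k hk).2, ?_⟩
  · have := (mem_passes.1 (hS hk')).1; omega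
  · rwa [show k + (k' - k) = k' by omega]
  · rw [show k + (k' - k) = k' by omega, he]; exact (hg k' hk').2

theorem Sys.step1 (h : Sys f Cr) (o : Orb f Cr x a b η) (M : ℕ) : ∃ n Ω, EM f x a b M Ω n := by
  classical
  by_contra hcon
  push Not at hcon
  -- the finite set of periodic points
  set Z : Finset ℝ := {0, 1} ∪ (Finset.range M).biUnion fun q =>
    if hq : 1 ≤ q then (h.fix_finite hq).toFinset else ∅ with hZ
  have hmem : ∀ z, z ∈ Z ↔ (z = 0 ∨ z = 1) ∨ ∃ q, q < M ∧ 1 ≤ q ∧ z ∈ Icc (0:ℝ) 1 ∧ f^[q] z = z := by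
    intro z
    rw [hZ, Finset.mem_union, Finset.mem_insert, Finset.mem_singleton, Finset.mem_biUnion]
    refine or_congr Iff.rfl (exists_congr fun q => ?_)
    rw [Finset.mem_range]
    refine and_congr Iff.rfl ?_
    by_cases hq : 1 ≤ q
    · simp [hq]
    · simp [hq]
  have hZ01 : ∀ z ∈ Z, z ∈ Icc (0:ℝ) 1 := by
    intro z hz
    rcases (hmem z).1 hz with (rfl | rfl) | ⟨q, _, _, hz', _⟩
    · simp
    · simp
    · exact hz'
  have hZf : ∀ z ∈ Z, f z ∈ Z := by
    intro z hz
    rw [hmem]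
    rcases (hmem z).1 hz with hz' | ⟨q, h1, h2, h3, h4⟩
    · exact Or.inl (h.bdry hz')
    · refine Or.inr ⟨q, h1, h2, h.maps z h3, ?_⟩
      rw [← Function.iterate_succ_apply, Function.iterate_succ_apply', h4]
  have hZit : ∀ n, ∀ z ∈ Z, f^[n] z ∈ Z := by
    intro n z hz
    induction n with
    | zero => exact hz
    | succ n ih => rw [Function.iterate_succ_apply']; exact hZf _ ih
  have h0Z : (0:ℝ) ∈ Z := (hmem 0).2 (Or.inl (Or.inl rfl))
  have h1Z : (1:ℝ) ∈ Z := (hmem 1).2 (Or.inl (Or.inr rfl))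
  obtain ⟨ρ, hρ, haway⟩ := o.away h Z ⟨0, h0Z⟩ hZ01 hZf
  set dd : ℕ → ℝ := fun i => infDist (x i) (Z : Set ℝ) with hdd
  have hsm : ∀ ε > 0, ∃ i, 0 < dd i ∧ b i - a i < ε * dd i := by
    intro ε hε
    have hev : ∀ᶠ i in atTop, b i - a i < ε * ρ :=
      o.lim.eventually_lt_const (by positivity)
    obtain ⟨N, hN⟩ := eventually_atTop.1 hev
    obtain ⟨i, hi, hi'⟩ := haway N
    refine ⟨i, lt_of_lt_of_le hρ hi', (hN i hi).trans_le ?_⟩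
    exact mul_le_mul_of_nonneg_left hi' hε.le
  obtain ⟨T₀, hT₀⟩ := h.star o Cr.card 80
  obtain ⟨m, hmN, hdm, hLm, hrec⟩ := record (L := fun i => b i - a i) (d := dd)
    (fun i => by linarith [o.lt i]) (fun i => infDist_nonneg) hsm T₀ (ε := 1/8) (by norm_num)
  set L := b m - a m with hL
  have hLpos : 0 < L := by linarith [o.lt m]
  have hxm := o.mem m
  -- points of the neighbourhood are away from Z
  have hfar : ∀ y, a m - L/8 ≤ y → y ≤ b m + L/8 → 3/4 * dd m ≤ infDist y (Z : Set ℝ) := by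
    intro y h1 h2
    have h3 : dd m ≤ infDist y (Z : Set ℝ) + dist (x m) y := infDist_le_infDist_add_dist
    have h4 : dist (x m) y ≤ 9/8 * L := by
      rw [Real.dist_eq, abs_le]
      constructor <;> linarith [hxm.1, hxm.2]
    linarith
  have hnotZ : ∀ y, a m - L/8 ≤ y → y ≤ b m + L/8 → y ∉ Z := by
    intro y h1 h2 hy
    have := hfar y h1 h2
    rw [infDist_zero_of_mem (Finset.mem_coe.2 hy)] at this
    linarith
  have hd0 : dd m ≤ x m := by
    have : infDist (x m) (Z : Set ℝ) ≤ dist (x m) 0 := infDist_le_dist_of_mem (Finset.mem_coe.2 h0Z)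
    rwa [Real.dist_eq, sub_zero, abs_of_pos (o.x01 m).1] at this
  have hd1 : dd m ≤ 1 - x m := by
    have : infDist (x m) (Z : Set ℝ) ≤ dist (x m) 1 := infDist_le_dist_of_mem (Finset.mem_coe.2 h1Z)
    rwa [dist_comm, Real.dist_eq, abs_of_pos (by linarith [(o.x01 m).2])] at this
  have hN : Nest (a m - L/8) (a m) (b m) (b m + L/8) :=
    ⟨by linarith [hxm.2], by linarith, o.lt m, by linarith, by linarith [hxm.1]⟩
  obtain ⟨u, v, hu, hv, t⟩ := h.tc_exists o m hN
  have hcr : cr (u m) (a m) (b m) (v m) ≤ 80 := by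
    rw [hu, hv]
    have := cr_le hN (t := 1/8) (by norm_num) (by linarith) (by linarith)
    norm_num at this
    exact this
  have hcard := hT₀ m hmN u v t hcr
  obtain ⟨k, s, hs, hks, _, _, d, hd, hdk, hdk'⟩ := TC.two_passes (Finset.Subset.refl _) hcard
  rcases t.repeat h o hs hks hd hdk hdk' with hA | ⟨Q, hQo, hQc, hQ01, hQJ, hQx, hQs, hQT⟩
  · have h1 := hA (m - s) (by omega) (by omega)
    rw [show m - s + s = m by omega, hu, hv] at h1
    set j := m - s with hj
    have hjm : j < m := by omega
    have h2 := (Ioo_subset_Ioo_iff (o.lt j)).1 h1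
    have h3 : b j - a j ≤ L / 8 := by
      rcases disj_cases (o.lt j) (o.lt m) (o.disj j m (by omega)) with e | e <;> linarith [h2.1, h2.2]
    have h4 := hrec j hjm
    have h5 := hfar (x j) (by linarith [(o.mem j).1, h2.1]) (by linarith [(o.mem j).2, h2.2])
    have h6 : 3/4 * dd m ≤ dd j := h5
    have h7 : L * (3/4 * dd m) ≤ L * dd j := mul_le_mul_of_nonneg_left h6 hLpos.le
    have h8 : (b j - a j) * dd m ≤ L/8 * dd m := mul_le_mul_of_nonneg_right h3 hdm.le
    nlinarith
  · have I := h.sat_inv hQo hQ01 hs hQs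
    have hne := hcon k (Sat f Q)
    have hex : ∃ q, 1 ≤ q ∧ q < M ∧ Same (Sat f Q) x k (k+q) := by
      by_contra hc
      push Not at hc
      apply hne
      refine ⟨I, h.sat_J0 o hQJ, ⟨s, hs, ?_⟩, fun q h1 h2 => hc q h1 h2⟩
      exact (hQc.uIcc_subset (hQJ (Ioo_subset_Icc_self (o.mem k))) hQx).trans (sub_sat hQ01)
    obtain ⟨q, hq1, hqM, hsame⟩ := hex
    obtain ⟨α, β, hα0, hαx, hxβ, hβ1, hsub, hα, hβ⟩ := comp_exists I.op I.sub
      (hsame left_mem_uIcc)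
    refine h.A3 hα0 hβ1 (hαx.trans hxβ) hq1 (I.comp_self h o hsub hα hβ ⟨hαx, hxβ⟩ hsame) ?_
    intro y hy hfix
    have hyΩ := hsub hy
    obtain ⟨hy01, i, hi⟩ := hyΩ
    have hyZ : y ∈ Z := (hmem y).2 (Or.inr ⟨q, hqM, hq1, Ioo_subset_Icc_self hy01, hfix⟩)
    have h1 := hQT _ hi
    rw [hu, hv] at h1
    exact hnotZ _ h1.1.le h1.2.le (hZit _ _ (hZit _ _ hyZ))

end NoHom


/-! ### Part 8: the cycle of components -/

namespace NoHom

variable {f : ℝ → ℝ} {Cr : Finset ℝ} {x a b : ℕ → ℝ} {η : ℝ}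

structure Cyc (f : ℝ → ℝ) (x a b : ℕ → ℝ) (M : ℕ) (Ω : Set ℝ) (n p : ℕ) (α β : ℕ → ℝ) : Prop where
  inv : Inv f Ω
  J0 : Icc (a 0) (b 0) ⊆ Ω
  p1 : 1 ≤ p
  Mp : M ≤ p
  same : ∀ i j, n ≤ i → n ≤ j → (Same Ω x i j ↔ i ≡ j [MOD p])
  min : ∀ k < n, ∀ Ω', ¬ EM f x a b M Ω' k
  a0 : ∀ j, 0 ≤ α j
  b1 : ∀ j, β j ≤ 1
  mem : ∀ j, x j ∈ Ioo (α j) (β j)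
  sub : ∀ j, Ioo (α j) (β j) ⊆ Ω
  an : ∀ j, α j ∉ Ω
  bn : ∀ j, β j ∉ Ω

theorem Sys.cyc (h : Sys f Cr) (o : Orb f Cr x a b η) (M : ℕ) :
    ∃ Ω n p α β, Cyc f x a b M Ω n p α β := by
  classical
  have hex := h.step1 o M
  set n := Nat.find hex with hn
  obtain ⟨Ω, I, hJ, hp, hM⟩ := Nat.find_spec hex
  have hmin : ∀ k < n, ∀ Ω', ¬ EM f x a b M Ω' k := fun k hk Ω' hE => Nat.find_min hex hk ⟨Ω', hE⟩
  rw [← hn] at hp hM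
  set p := Nat.find hp with hpd
  obtain ⟨hp1, hps⟩ := Nat.find_spec hp
  rw [← hpd] at hp1 hps
  have hpmin : ∀ q, 1 ≤ q → q < p → ¬ Same Ω x n (n+q) := fun q h1 h2 hS =>
    Nat.find_min hp h2 ⟨h1, hS⟩
  have hMp : M ≤ p := by
    by_contra hlt
    exact hM p hp1 (by omega) hps
  have hx0 : ∀ j, x j ∈ Ω := by
    intro j
    have h1 := (I.it h (Ioo_subset_Icc_self (o.x01 0)) j).1 (hJ (Ioo_subset_Icc_self (o.mem 0)))
    rw [o.it 0 j] at h1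
    simpa using h1
  have hrefl : ∀ i, Same Ω x i i := by
    intro i
    unfold Same
    rw [uIcc_self]
    exact singleton_subset_iff.2 (hx0 i)
  have hper : ∀ i, n ≤ i → ∀ k, Same Ω x i (i + p * k) := by
    intro i hi k
    induction k with
    | zero => exact hrefl i
    | succ k ih =>
      have h1 := hps.push I h o (i - n + p * k)
      rw [show n + (i - n + p * k) = i + p * k by omega,
        show n + p + (i - n + p * k) = i + p * (k+1) by rw [mul_add]; omega] at h1
      exact ih.trans h1
  have hmod : ∀ i q, n ≤ i → (Same Ω x i (i+q) ↔ p ∣ q) := by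
    intro i q hi
    constructor
    · intro hS
      have h1 : Same Ω x n (n+q) := by
        -- push up to a multiple of the period
        have h2 := hS.push I h o ((p-1) * (i - n))
        have e1 : i + (p-1) * (i-n) = n + p * (i - n) := by
          obtain ⟨w, hw⟩ : ∃ w, i = n + w := ⟨i - n, by omega⟩
          obtain ⟨p', hp'⟩ : ∃ p', p = p' + 1 := ⟨p - 1, by omega⟩
          rw [hw, hp', Nat.add_sub_cancel, Nat.add_sub_cancel_left]; ring
        have e2 : i + q + (p-1) * (i-n) = (n + q) + p * (i - n) := by omega
        rw [e1, e2] at h2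
        exact ((hper n le_rfl _).trans h2).trans (hper (n+q) (by omega) _).symm
      have h3 : Same Ω x n (n + q % p) := by
        have h4 := hper (n + q % p) (by omega) (q / p)
        rw [show n + q % p + p * (q / p) = n + q by rw [add_assoc, Nat.mod_add_div]] at h4
        exact h1.trans h4.symm
      rcases Nat.eq_zero_or_pos (q % p) with e | e
      · exact Nat.dvd_of_mod_eq_zero e
      · exact absurd h3 (hpmin _ e (Nat.mod_lt _ (by omega)))
    · rintro ⟨k, rfl⟩
      exact hper i hi k
  have hsame : ∀ i j, n ≤ i → n ≤ j → (Same Ω x i j ↔ i ≡ j [MOD p]) := by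
    have key : ∀ i j, n ≤ i → i ≤ j → (Same Ω x i j ↔ i ≡ j [MOD p]) := by
      intro i j hi hij
      rw [Nat.modEq_iff_dvd' hij, ← hmod i (j-i) hi, show i + (j - i) = j by omega]
    intro i j hi hj
    rcases le_total i j with hij | hij
    · exact key i j hi hij
    · exact ⟨fun hS => ((key j i hj hij).1 hS.symm).symm,
        fun hS => ((key j i hj hij).2 hS.symm).symm⟩
  have hc : ∀ j, ∃ α β : ℝ, 0 ≤ α ∧ α < x j ∧ x j < β ∧ β ≤ 1 ∧ Ioo α β ⊆ Ω ∧ α ∉ Ω ∧ β ∉ Ω :=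
    fun j => comp_exists I.op I.sub (hx0 j)
  choose α β h1 h2 h3 h4 h5 h6 h7 using hc
  exact ⟨Ω, n, p, α, β, I, hJ, hp1, hMp, hsame, hmin, h1, h4, fun j => ⟨h2 j, h3 j⟩, h5, h6, h7⟩

variable {M n p : ℕ} {Ω : Set ℝ} {α β : ℕ → ℝ}

theorem Cyc.lt (c : Cyc f x a b M Ω n p α β) (j : ℕ) : α j < β j := (c.mem j).1.trans (c.mem j).2

theorem Cyc.max (c : Cyc f x a b M Ω n p α β) {S : Set ℝ} (hS : IsPreconnected S) (hSΩ : S ⊆ Ω)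
    {j : ℕ} (hne : (S ∩ Ioo (α j) (β j)).Nonempty) : S ⊆ Ioo (α j) (β j) :=
  comp_max hS hSΩ (c.an j) (c.bn j) hne

theorem Cyc.eq (c : Cyc f x a b M Ω n p α β) {i j : ℕ}
    (hne : (Ioo (α i) (β i) ∩ Ioo (α j) (β j)).Nonempty) : α i = α j ∧ β i = β j := by
  have h1 := c.max isPreconnected_Ioo (c.sub i) hne
  have h2 := c.max isPreconnected_Ioo (c.sub j) (by rwa [inter_comm] at hne)
  have h3 := (Ioo_subset_Ioo_iff (c.lt i)).1 h1
  have h4 := (Ioo_subset_Ioo_iff (c.lt j)).1 h2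
  exact ⟨le_antisymm h4.1 h3.1, le_antisymm h3.2 h4.2⟩

theorem Cyc.same_of (c : Cyc f x a b M Ω n p α β) {i j : ℕ}
    (hne : (Ioo (α i) (β i) ∩ Ioo (α j) (β j)).Nonempty) : Same Ω x i j := by
  obtain ⟨e1, e2⟩ := c.eq hne
  have h1 := c.mem i
  rw [e1, e2] at h1
  exact (ordConnected_Ioo.uIcc_subset h1 (c.mem j)).trans (c.sub j)

theorem Cyc.mod_of (c : Cyc f x a b M Ω n p α β) {i j : ℕ} (hi : n ≤ i) (hj : n ≤ j)
    {y : ℝ} (hyi : y ∈ Ioo (α i) (β i)) (hyj : y ∈ Ioo (α j) (β j)) : i ≡ j [MOD p] :=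
  (c.same i j hi hj).1 (c.same_of ⟨y, hyi, hyj⟩)

theorem Cyc.eq_of_mod (c : Cyc f x a b M Ω n p α β) {i j : ℕ} (hi : n ≤ i) (hj : n ≤ j)
    (hm : i ≡ j [MOD p]) : α i = α j ∧ β i = β j := by
  have h1 := (c.same i j hi hj).2 hm
  have h2 := c.max isPreconnected_uIcc h1 (j := j) ⟨x j, right_mem_uIcc, c.mem j⟩
  exact c.eq ⟨x i, c.mem i, h2 left_mem_uIcc⟩

theorem Cyc.maps (c : Cyc f x a b M Ω n p α β) (h : Sys f Cr) (o : Orb f Cr x a b η) (j k : ℕ) :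
    ∀ y ∈ Ioo (α j) (β j), f^[k] y ∈ Ioo (α (j+k)) (β (j+k)) := by
  intro y hy
  refine c.max (isPreconnected_Ioo.image _ (h.itcont k).continuousOn) ?_ (j := j+k)
    ⟨x (j+k), ⟨x j, c.mem j, o.it j k⟩, c.mem (j+k)⟩ ⟨y, hy, rfl⟩
  rintro _ ⟨z, hz, rfl⟩
  exact (c.inv.it h (Ioo_subset_Icc_self (c.inv.sub (c.sub j hz))) k).1 (c.sub j hz)

theorem Cyc.pull (c : Cyc f x a b M Ω n p α β) (h : Sys f Cr) (o : Orb f Cr x a b η) (j : ℕ) :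
    Pull f (α j) (β j) (α (j+1)) (β (j+1)) := by
  have hm : ∀ y ∈ Ioo (α j) (β j), f y ∈ Ioo (α (j+1)) (β (j+1)) := c.maps h o j 1
  have hlt := c.lt j
  have key : ∀ e ∈ Icc (α j) (β j), e ∉ Ω → f e = α (j+1) ∨ f e = β (j+1) := by
    intro e he heΩ
    apply h.endpt hlt (c.lt _) hm he
    intro hfe
    have he01 : e ∈ Icc (0:ℝ) 1 := ⟨(c.a0 j).trans he.1, he.2.trans (c.b1 j)⟩
    exact heΩ ((c.inv.inv' h he01).2 (c.sub _ hfe))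
  exact ⟨hm, key _ ⟨le_rfl, hlt.le⟩ (c.an j), key _ ⟨hlt.le, le_rfl⟩ (c.bn j)⟩

theorem Cyc.cJ (c : Cyc f x a b M Ω n p α β) (h : Sys f Cr) (o : Orb f Cr x a b η) (j : ℕ) :
    α j < a j ∧ b j < β j := by
  have h1 : Icc (a 0) (b 0) ⊆ Ioo (α 0) (β 0) := c.max isPreconnected_Icc c.J0
    ⟨x 0, Ioo_subset_Icc_self (o.mem 0), c.mem 0⟩
  have hΩ : Icc (a j) (b j) ⊆ Ω := by
    -- closed image
    have h2 : Icc (a j) (b j) ⊆ f^[j] '' Icc (a 0) (b 0) := by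
      have h3 := o.surj h 0 j
      rw [Nat.zero_add] at h3
      rw [← closure_Ioo (o.lt j).ne]
      refine closure_minimal (h3.trans (image_mono Ioo_subset_Icc_self)) ?_
      exact (isCompact_Icc.image (h.itcont j)).isClosed
    intro y hy
    obtain ⟨z, hz, rfl⟩ := h2 hy
    exact (c.inv.it h (Ioo_subset_Icc_self (o.sub01 0 hz)) j).1 (c.J0 hz)
  have h3 := c.max isPreconnected_Icc hΩ (j := j) ⟨x j, Ioo_subset_Icc_self (o.mem j), c.mem j⟩
  exact ⟨(h3 ⟨le_rfl, (o.lt j).le⟩).1, (h3 ⟨(o.lt j).le, le_rfl⟩).2⟩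

/-! #### distance to the boundary -/

theorem Sys.nonconst (h : Sys f Cr) (k : ℕ) : ∀ {u v : ℝ} (w : ℝ), 0 ≤ u → u < v → v ≤ 1 →
    ∃ y ∈ Icc u v, f^[k] y ≠ w := by
  induction k with
  | zero =>
    intro u v w _ huv _
    by_cases hu : u = w
    · exact ⟨v, ⟨huv.le, le_rfl⟩, by simp only [Function.iterate_zero, id]; rw [← hu]; exact huv.ne'⟩
    · exact ⟨u, ⟨le_rfl, huv.le⟩, hu⟩
  | succ k ih =>
    intro u v w hu huv hv
    have h1 : ∃ y ∈ Icc u v, f y ≠ f u := by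
      by_contra hcon
      push Not at hcon
      obtain ⟨z, hz, hzc⟩ := (Ioo_infinite huv).exists_notMem_finset Cr
      have hev : f =ᶠ[nhds z] fun _ => f u := by
        filter_upwards [Ioo_mem_nhds hz.1 hz.2] with y hy
        exact hcon y (Ioo_subset_Icc_self hy)
      have := hev.deriv_eq
      rw [deriv_const] at this
      exact h.reg z ⟨by linarith [hz.1], by linarith [hz.2]⟩ hzc this
    obtain ⟨y, hy, hne⟩ := h1
    have himg : uIcc (f u) (f y) ⊆ f '' uIcc u y := intermediate_value_uIcc h.cont.continuousOn
    have hu01 := h.maps u ⟨hu, by linarith⟩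
    have hy01 := h.maps y ⟨by linarith [hy.1], by linarith [hy.2]⟩
    have hlt : min (f u) (f y) < max (f u) (f y) := by
      rw [min_lt_max]; exact hne.symm
    obtain ⟨z, hz, hzw⟩ := ih w (le_min hu01.1 hy01.1) hlt (max_le hu01.2 hy01.2)
    obtain ⟨t, ht, rfl⟩ := himg hz
    refine ⟨t, ?_, hzw⟩
    rw [uIcc_of_le hy.1] at ht
    exact ⟨ht.1, ht.2.trans hy.2⟩

theorem Sys.fold (h : Sys f Cr) {e y₀ : ℝ} (he : e = 0 ∨ e = 1) (hy₀ : y₀ ∈ Ioo (0:ℝ) 1) :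
    ∃ i j : ℕ, i < j ∧ j ≤ 2 ∧ ∃ s ∈ uIcc e y₀, ∃ t ∈ uIcc e y₀, s ≠ e ∧ t ≠ e ∧
      f^[i] s = f^[j] t := by
  have hb : ∀ k, f^[k] e = 0 ∨ f^[k] e = 1 := by
    intro k
    induction k with
    | zero => exact he
    | succ k ih => rw [Function.iterate_succ_apply']; exact h.bdry ih
  obtain ⟨i, j, hij, hj, heq⟩ : ∃ i j : ℕ, i < j ∧ j ≤ 2 ∧ f^[i] e = f^[j] e := by
    rcases hb 0 with e0 | e0 <;> rcases hb 1 with e1 | e1 <;> rcases hb 2 with e2 | e2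
    · exact ⟨0, 1, by norm_num, by norm_num, by rw [e0, e1]⟩
    · exact ⟨0, 1, by norm_num, by norm_num, by rw [e0, e1]⟩
    · exact ⟨0, 2, by norm_num, by norm_num, by rw [e0, e2]⟩
    · exact ⟨1, 2, by norm_num, by norm_num, by rw [e1, e2]⟩
    · exact ⟨1, 2, by norm_num, by norm_num, by rw [e1, e2]⟩
    · exact ⟨0, 2, by norm_num, by norm_num, by rw [e0, e2]⟩
    · exact ⟨0, 1, by norm_num, by norm_num, by rw [e0, e1]⟩
    · exact ⟨0, 1, by norm_num, by norm_num, by rw [e0, e1]⟩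
  have hsub : uIcc e y₀ ⊆ Icc 0 1 := by
    apply uIcc_subset_Icc
    · rcases he with rfl | rfl <;> simp
    · exact ⟨hy₀.1.le, hy₀.2.le⟩
  have hnc : ∀ k, ∃ y ∈ uIcc e y₀, f^[k] y ≠ f^[k] e := by
    intro k
    have hlt : min e y₀ < max e y₀ := by
      rw [min_lt_max]
      rcases he with rfl | rfl
      · exact hy₀.1.ne
      · exact hy₀.2.ne'
    exact h.nonconst k (u := min e y₀) (v := max e y₀) (f^[k] e)
      (le_min (by rcases he with rfl | rfl <;> norm_num) hy₀.1.le) hlt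
      (max_le (by rcases he with rfl | rfl <;> norm_num) hy₀.2.le)
  obtain ⟨y, hy, hyne⟩ := hnc i
  obtain ⟨z, hz, hzne⟩ := hnc j
  have hc : ∀ k, (f^[k] '' uIcc e y₀).OrdConnected := fun k =>
    (isPreconnected_uIcc.image _ (h.itcont k).continuousOn).ordConnected
  have hy01 := h.itmaps i y (hsub hy)
  have hz01 := h.itmaps j z (hsub hz)
  have hfin : ∃ w, w ≠ f^[i] e ∧ w ∈ f^[i] '' uIcc e y₀ ∧ w ∈ f^[j] '' uIcc e y₀ := by
    rcases hb i with e0 | e0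
    · have e0' := heq ▸ e0
      refine ⟨min (f^[i] y) (f^[j] z), ?_, ?_, ?_⟩
      · rw [e0] at hyne ⊢
        rw [e0'] at hzne
        exact (lt_min (lt_of_le_of_ne hy01.1 hyne.symm) (lt_of_le_of_ne hz01.1 hzne.symm)).ne'
      · exact (hc i).out ⟨e, left_mem_uIcc, rfl⟩ ⟨y, hy, rfl⟩
          ⟨by rw [e0]; exact le_min hy01.1 hz01.1, min_le_left _ _⟩
      · exact (hc j).out ⟨e, left_mem_uIcc, rfl⟩ ⟨z, hz, rfl⟩
          ⟨by rw [e0']; exact le_min hy01.1 hz01.1, min_le_right _ _⟩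
    · have e0' := heq ▸ e0
      refine ⟨max (f^[i] y) (f^[j] z), ?_, ?_, ?_⟩
      · rw [e0] at hyne ⊢
        rw [e0'] at hzne
        exact (max_lt (lt_of_le_of_ne hy01.2 hyne) (lt_of_le_of_ne hz01.2 hzne)).ne
      · exact (hc i).out ⟨y, hy, rfl⟩ ⟨e, left_mem_uIcc, rfl⟩
          ⟨le_max_left _ _, by rw [e0]; exact max_le hy01.2 hz01.2⟩
      · exact (hc j).out ⟨z, hz, rfl⟩ ⟨e, left_mem_uIcc, rfl⟩
          ⟨le_max_right _ _, by rw [e0']; exact max_le hy01.2 hz01.2⟩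
  obtain ⟨w, hw, ⟨s, hs, hsw⟩, ⟨t, ht, htw⟩⟩ := hfin
  refine ⟨i, j, hij, hj, s, hs, t, ht, ?_, ?_, by rw [hsw, htw]⟩
  · rintro rfl; exact hw hsw.symm
  · rintro rfl; exact hw (by rw [heq, htw])

theorem Cyc.not_fold (c : Cyc f x a b M Ω n p α β) (h : Sys f Cr) (o : Orb f Cr x a b η)
    (hp : 3 ≤ p) {k i j : ℕ} (hk : n ≤ k) (hij : i < j) (hj : j ≤ 2) {s t : ℝ}
    (hs : s ∈ Ioo (α k) (β k)) (ht : t ∈ Ioo (α k) (β k)) (he : f^[i] s = f^[j] t) : False := by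
  have h1 := c.maps h o k i s hs
  have h2 := c.maps h o k j t ht
  rw [he] at h1
  have h3 := c.mod_of (by omega) (by omega) h1 h2
  rw [Nat.modEq_iff_dvd' (by omega)] at h3
  have := Nat.le_of_dvd (by omega) h3
  omega

theorem Sys.kappa (h : Sys f Cr) (o : Orb f Cr x a b η) : ∃ κ : ℝ, 0 < κ ∧ κ ≤ 1 ∧
    ∀ M Ω n p α β, Cyc f x a b M Ω n p α β → 3 ≤ p → ∃ j ≥ n, κ ≤ α j ∧ β j ≤ 1 - κ := by
  obtain ⟨ρ, hρ, haway⟩ := o.away h ({0, 1} : Finset ℝ) ⟨0, by simp⟩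
    (fun z hz => by
      rcases Finset.mem_insert.1 hz with rfl | hz
      · simp
      · rw [Finset.mem_singleton] at hz; rw [hz]; simp)
    (fun z hz => by
      rw [Finset.mem_insert, Finset.mem_singleton] at hz ⊢
      exact h.bdry hz)
  have hin : ∀ i, ρ ≤ infDist (x i) (({0, 1} : Finset ℝ) : Set ℝ) → ρ ≤ x i ∧ x i ≤ 1 - ρ := by
    intro i hi
    have h0 := hi.trans (infDist_le_dist_of_mem (y := (0:ℝ)) (by simp))
    have h1 := hi.trans (infDist_le_dist_of_mem (y := (1:ℝ)) (by simp))
    rw [Real.dist_eq, sub_zero, abs_of_pos (o.x01 i).1] at h0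
    rw [dist_comm, Real.dist_eq, abs_of_pos (by linarith [(o.x01 i).2])] at h1
    exact ⟨h0, by linarith⟩
  obtain ⟨i0, _, hi0⟩ := haway 0
  have hρ1 : ρ < 1 := by linarith [(hin i0 hi0).1, (o.x01 i0).2]
  obtain ⟨i, j, hij, hj, s, hs, t, ht, hs0, ht0, hst⟩ :=
    h.fold (e := 0) (y₀ := ρ) (Or.inl rfl) ⟨hρ, hρ1⟩
  obtain ⟨i', j', hij', hj', s', hs', t', ht', hs0', ht0', hst'⟩ :=
    h.fold (e := 1) (y₀ := 1 - ρ) (Or.inr rfl) ⟨by linarith, by linarith⟩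
  rw [uIcc_of_le hρ.le] at hs ht
  rw [uIcc_of_ge (by linarith)] at hs' ht'
  have p1 := lt_of_le_of_ne hs.1 hs0.symm
  have p2 := lt_of_le_of_ne ht.1 ht0.symm
  have p3 := lt_of_le_of_ne hs'.2 hs0'
  have p4 := lt_of_le_of_ne ht'.2 ht0'
  refine ⟨min (min s t) (min (1-s') (1-t')), ?_, ?_, ?_⟩
  · exact lt_min (lt_min p1 p2) (lt_min (by linarith) (by linarith))
  · exact (min_le_left _ _).trans ((min_le_left _ _).trans (by linarith [hs.2]))
  intro M Ω n p α β c hp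
  obtain ⟨k, hk, hkρ⟩ := haway n
  obtain ⟨q1, q2⟩ := hin k hkρ
  refine ⟨k, hk, ?_, ?_⟩
  · refine (min_le_left _ _).trans ?_
    by_contra hlt
    push Not at hlt
    have r1 := lt_of_lt_of_le hlt (min_le_left _ _)
    have r2 := lt_of_lt_of_le hlt (min_le_right _ _)
    have := (c.mem k).2
    exact c.not_fold h o hp hk hij hj (s := s) (t := t) ⟨r1, by linarith [hs.2]⟩
      ⟨r2, by linarith [ht.2]⟩ hst
  · by_contra hlt
    push Not at hlt
    have r0 : 1 - min (1-s') (1-t') < β k := by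
      have := min_le_right (min s t) (min (1-s') (1-t'))
      linarith
    have r1 := min_le_left (1-s') (1-t')
    have r2 := min_le_right (1-s') (1-t')
    rcases min_choice (1-s') (1-t') with e | e
    all_goals
      have := (c.mem k).1
      refine c.not_fold h o hp hk hij' hj' (s := s') (t := t') ⟨by linarith [hs'.1], ?_⟩
        ⟨by linarith [ht'.1], ?_⟩ hst' <;> linarith

/-- counting lemma -/
theorem count_le {ι : Type*} [DecidableEq ι] {S : Finset ℕ} {A q : ℕ} (hp : 1 ≤ p)
    (hS : ∀ k ∈ S, A ≤ k ∧ k < A + q * p) (col : ℕ → ι) (F : Finset ι) (hF : ∀ k ∈ S, col k ∈ F)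
    (hcol : ∀ k ∈ S, ∀ k' ∈ S, col k = col k' → k ≡ k' [MOD p]) : S.card ≤ F.card * q := by
  rw [← Finset.card_range q, ← Finset.card_product]
  refine Finset.card_le_card_of_injOn (fun k => (col k, (k - A)/p)) ?_ ?_
  · intro k hk
    rw [Finset.mem_coe, Finset.mem_product, Finset.mem_range]
    refine ⟨hF k hk, ?_⟩
    rw [Nat.div_lt_iff_lt_mul (by omega)]
    have := hS k hk
    omega
  · intro k hk k' hk' he
    simp only [Prod.mk.injEq] at he
    have h1 := hcol k hk k' hk' he.1
    obtain ⟨w, rfl⟩ : ∃ w, k = A + w := ⟨k - A, by have := hS k hk; omega⟩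
    obtain ⟨w', rfl⟩ : ∃ w', k' = A + w' := ⟨k' - A, by have := hS k' hk'; omega⟩
    have h2 : w ≡ w' [MOD p] := Nat.ModEq.add_left_cancel' A h1
    have h3 := he.2
    rw [Nat.add_sub_cancel_left, Nat.add_sub_cancel_left] at h3
    have : w = w' := by
      rw [← Nat.div_add_mod w p, ← Nat.div_add_mod w' p, h3, h2]
    rw [this]

end NoHom


/-! ### Part 9: counting passes in the cycle -/

namespace NoHom

variable {f : ℝ → ℝ} {Cr : Finset ℝ} {x a b : ℕ → ℝ} {η : ℝ}
variable {M n p : ℕ} {Ω : Set ℝ} {α β : ℕ → ℝ}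

theorem Cyc.count_TC (c : Cyc f x a b M Ω n p α β) (h : Sys f Cr) (o : Orb f Cr x a b η)
    {m T : ℕ} {u v : ℕ → ℝ} (hm : n ≤ m) (hmT : m ≡ T [MOD p]) (hnT : n ≤ T) (hT : T ≤ n + 4 * p)
    (t : TC f Cr a b η T u v) (hu : u T = α m) (hv : v T = β m) :
    (passes Cr T u v).card ≤ 5 * Cr.card := by
  classical
  have hpull : ∀ y ∈ Icc (0:ℝ) 1, ∀ j, f^[j] y ∈ Ioo (u T) (v T) → y ∈ Ω := by
    intro y hy j hj
    rw [hu, hv] at hj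
    exact (c.inv.it h hy j).2 (c.sub m hj)
  have hVΩ : ∀ j ≤ T, Ioo (u j) (v j) ⊆ Ω := by
    intro j hj y hy
    have hn := t.nest j hj
    refine hpull y ⟨by linarith [hn.1, hy.1], by linarith [hn.2.2.2.2, hy.2]⟩ (T - j) ?_
    have := t.itmaps (k := j) (j := T - j) (by omega) y hy
    rwa [show j + (T - j) = T by omega] at this
  have hVC : ∀ j ≤ T, Ioo (u j) (v j) ⊆ Ioo (α j) (β j) := by
    intro j hj
    have hn := t.nest j hj
    have hx := o.mem j
    refine c.max isPreconnected_Ioo (hVΩ j hj) ⟨x j, ?_, c.mem j⟩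
    exact ⟨by linarith [hn.2.1, hx.1], by linarith [hn.2.2.2.1, hx.2]⟩
  have hnosame : ∀ q, 1 ≤ q → q < M → ¬ Same Ω x n (n+q) := by
    intro q h1 h2 hS
    have := (c.same n (n+q) le_rfl (by omega)).1 hS
    rw [Nat.modEq_iff_dvd' (by omega), Nat.add_sub_cancel_left] at this
    have := Nat.le_of_dvd (by omega) this
    have := c.Mp
    omega
  set S := passes Cr T u v with hS
  have h1 : (S.filter (fun k => k < n)).card ≤ Cr.card := by
    by_contra hcon
    push Not at hcon
    obtain ⟨k, s, hs, hks, hkS, hkS', d, hd, hdk, hdk'⟩ :=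
      TC.two_passes (T := T) (u := u) (v := v) (Finset.filter_subset _ _) hcon
    rw [Finset.mem_filter] at hkS hkS'
    have hkn := hkS'.2
    rcases t.repeat h o hs hks hd hdk hdk' with hA | ⟨Q, hQo, hQc, hQ01, hQJ, hQx, hQs, hQT⟩
    · have h2 := hA (n - s) (by omega) (by omega)
      rw [show n - s + s = n by omega] at h2
      have h3 := hVC n hnT (h2 (o.mem (n-s)))
      apply c.min (n-s) (by omega) Ω
      refine ⟨c.inv, c.J0, ⟨s, hs, ?_⟩, ?_⟩
      · rw [show n - s + s = n by omega]
        exact (ordConnected_Ioo.uIcc_subset h3 (c.mem n)).trans (c.sub n)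
      · intro q hq1 hq2 hS
        apply hnosame q hq1 hq2
        have := hS.push c.inv h o s
        rwa [show n - s + s = n by omega, show n - s + q + s = n + q by omega] at this
    · have I := h.sat_inv hQo hQ01 hs hQs
      have hQΩ : Q ⊆ Ω := fun y hy => hpull y (Ioo_subset_Icc_self (hQ01 hy)) _ (hQT y hy)
      have hSatΩ : Sat f Q ⊆ Ω := by
        rintro y ⟨hy, i, hi⟩
        exact (c.inv.it h (Ioo_subset_Icc_self hy) i).2 (hQΩ hi)
      apply c.min k (by omega) (Sat f Q)
      refine ⟨I, h.sat_J0 o hQJ, ⟨s, hs, ?_⟩, ?_⟩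
      · exact (hQc.uIcc_subset (hQJ (Ioo_subset_Icc_self (o.mem k))) hQx).trans (sub_sat hQ01)
      · intro q hq1 hq2 hS
        apply hnosame q hq1 hq2
        have hS' : Same Ω x k (k+q) := fun y hy => hSatΩ (hS hy)
        have := hS'.push c.inv h o (n - k)
        rwa [show k + (n - k) = n by omega, show k + q + (n - k) = n + q by omega] at this
  have h2 : (S.filter (fun k => ¬ k < n)).card ≤ Cr.card * 4 := by
    have hex : ∀ k : ℕ, ∃ d : ℝ, k ∈ S → d ∈ Cr ∧ d ∈ Ioo (u k) (v k) := by
      intro k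
      by_cases hk : k ∈ S
      · obtain ⟨_, d, hc, hcI⟩ := mem_passes.1 hk
        exact ⟨d, fun _ => ⟨hc, hcI⟩⟩
      · exact ⟨0, fun h => absurd h hk⟩
    choose g hg using hex
    refine count_le (p := p) (A := n) c.p1 ?_ g Cr ?_ ?_
    · intro k hk
      rw [Finset.mem_filter] at hk
      have := (mem_passes.1 hk.1).1
      omega
    · intro k hk
      rw [Finset.mem_filter] at hk
      exact (hg k hk.1).1
    · intro k hk k' hk' he
      rw [Finset.mem_filter] at hk hk'
      have e1 := hVC k (mem_passes.1 hk.1).1.le (hg k hk.1).2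
      have e2 := hVC k' (mem_passes.1 hk'.1).1.le (hg k' hk'.1).2
      rw [he] at e1
      exact c.mod_of (by omega) (by omega) e1 e2
  have h3 := Finset.card_filter_add_card_filter_not (s := S) (fun k => k < n)
  omega

theorem Sys.close (h : Sys f Cr) (o : Orb f Cr x a b η) {ε : ℝ} (hε : 0 < ε) :
    ∃ M₀ : ℕ, ∀ M ≥ M₀, ∀ Ω n p α β, Cyc f x a b M Ω n p α β → ∀ m i, n ≤ m → m < n + p →
      1 ≤ i → i ≤ 3 → a (m + i * p) - α m < ε * (b (m+i*p) - a (m+i*p)) ∨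
        β m - b (m + i * p) < ε * (b (m+i*p) - a (m+i*p)) := by
  obtain ⟨T₀, hT₀⟩ := h.star o (5 * Cr.card) (1/ε^2 + 2/ε)
  refine ⟨T₀, ?_⟩
  intro M hM Ω n p α β c m i hnm hmp hi1 hi3
  by_contra hcon
  push Not at hcon
  have hmod : m ≡ m + i * p [MOD p] := by
    rw [Nat.modEq_iff_dvd' (by omega), Nat.add_sub_cancel_left]
    exact Dvd.intro_left i rfl
  have hip : i * p ≤ 3 * p := Nat.mul_le_mul_right p hi3
  have hip1 : 1 * p ≤ i * p := Nat.mul_le_mul_right p hi1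
  have hMp := c.Mp
  set T := m + i * p with hT
  obtain ⟨e1, e2⟩ := c.eq_of_mod (i := m) (j := T) hnm (by omega) hmod
  obtain ⟨e3, e4⟩ := c.cJ h o T
  rw [← e1] at e3
  rw [← e2] at e4
  have hN : Nest (α m) (a T) (b T) (β m) := ⟨c.a0 m, e3, o.lt T, e4, c.b1 m⟩
  obtain ⟨u, v, hu, hv, t⟩ := h.tc_exists o T hN
  have h1 := c.count_TC h o hnm hmod (by omega) (by omega) t hu hv
  have h2 := hT₀ T (by omega) u v t (by rw [hu, hv]; exact cr_le hN hε hcon.1 hcon.2)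
  omega

/-- counting passes in a window. -/
theorem Cyc.count_window (c : Cyc f x a b M Ω n p α β) (h : Sys f Cr) (o : Orb f Cr x a b η)
    {V : Set ℝ} (ty : ℕ → Fin 3)
    (hty : ∀ i j, n ≤ i → n ≤ j → x i ∈ V → x j ∈ V → ty i = ty j → i ≡ j [MOD p])
    {t₀ N : ℕ} (ht₀ : n ≤ t₀) (hN : N ≤ 2 * p) {u v : ℕ → ℝ}
    (hx : ∀ k ≤ N, x (t₀ + k) ∈ Ioo (u k) (v k))
    (hm : ∀ k < N, ∀ y ∈ Ioo (u k) (v k), f y ∈ Ioo (u (k+1)) (v (k+1)))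
    (hV : Ioo (u N) (v N) ⊆ V) : (passes Cr N u v).card ≤ 14 * Cr.card := by
  classical
  set S := passes Cr N u v with hS
  have hit : ∀ k j, k + j ≤ N → ∀ y ∈ Ioo (u k) (v k), f^[j] y ∈ Ioo (u (k+j)) (v (k+j)) := by
    intro k j hj y hy
    induction j with
    | zero => exact hy
    | succ j ih =>
      rw [Function.iterate_succ_apply']
      exact hm (k+j) (by omega) _ (ih (by omega))
  have hex : ∀ k : ℕ, ∃ d : ℝ, k ∈ S → d ∈ Cr ∧ d ∈ Ioo (u k) (v k) ∧
      ∀ c ∈ Cr, c ∈ uIcc (x (t₀ + k)) d → c = d := by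
    intro k
    by_cases hk : k ∈ S
    swap
    · exact ⟨0, fun h => absurd h hk⟩
    obtain ⟨hkN, c0, hc0, hc0I⟩ := mem_passes.1 hk
    obtain ⟨d, hd, hdmin⟩ := Finset.exists_min_image (Cr.filter fun c => c ∈ Ioo (u k) (v k))
      (fun c => |c - x (t₀ + k)|) ⟨c0, Finset.mem_filter.2 ⟨hc0, hc0I⟩⟩
    rw [Finset.mem_filter] at hd
    refine ⟨d, fun _ => ⟨hd.1, hd.2, ?_⟩⟩
    intro c hc hcI
    have h2 := hdmin c (Finset.mem_filter.2 ⟨hc, (ordConnected_Ioo.uIcc_subset (hx k hkN.le) hd.2) hcI⟩)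
    rw [mem_uIcc] at hcI
    rcases hcI with ⟨q1, q2⟩ | ⟨q1, q2⟩
    · rw [abs_of_nonneg (by linarith), abs_of_nonneg (by linarith)] at h2
      linarith
    · rw [abs_of_nonpos (by linarith), abs_of_nonpos (by linarith)] at h2
      linarith
  choose g hg using hex
  have key : ∀ k ∈ S, ∀ k' ∈ S, g k = g k' → k ≤ k' →
      x (t₀ + N + (k' - k)) ∈ V ∨ x (t₀ + N - (k' - k)) ∈ V := by
    intro k hk k' hk' he hkk
    obtain ⟨d1, d2, d3⟩ := hg k hk
    obtain ⟨_, d2', d3'⟩ := hg k' hk'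
    rw [← he] at d2' d3'
    set d := g k
    have hkN := (mem_passes.1 hk).1
    have hkN' := (mem_passes.1 hk').1
    have i1 : uIcc (x (t₀+k+1)) (f d) ⊆ Ioo (u (k+1)) (v (k+1)) := by
      rw [← o.step (t₀+k)]
      refine (intermediate_value_uIcc h.cont.continuousOn).trans ?_
      rintro _ ⟨y, hy, rfl⟩
      exact hm k hkN y ((ordConnected_Ioo.uIcc_subset (hx k hkN.le) d2) hy)
    have i2 : uIcc (x (t₀+k'+1)) (f d) ⊆ Ioo (u (k'+1)) (v (k'+1)) := by
      rw [← o.step (t₀+k')]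
      refine (intermediate_value_uIcc h.cont.continuousOn).trans ?_
      rintro _ ⟨y, hy, rfl⟩
      exact hm k' hkN' y ((ordConnected_Ioo.uIcc_subset (hx k' hkN'.le) d2') hy)
    have j1 : x (t₀+k'+1) ∈ uIcc (x (t₀+k+1)) (f d) ∨ x (t₀+k+1) ∈ uIcc (x (t₀+k'+1)) (f d) := by
      rw [mem_uIcc, mem_uIcc, ← o.step (t₀+k), ← o.step (t₀+k')]
      rcases h.turn d d1 with ht | ht
      · have w1 := ht _ (Ioo_subset_Icc_self (o.x01 (t₀+k))) d3
        have w2 := ht _ (Ioo_subset_Icc_self (o.x01 (t₀+k'))) d3'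
        rcases le_total (f (x (t₀+k))) (f (x (t₀+k'))) with w | w
        · exact Or.inl (Or.inl ⟨w, w2⟩)
        · exact Or.inr (Or.inl ⟨w, w1⟩)
      · have w1 := ht _ (Ioo_subset_Icc_self (o.x01 (t₀+k))) d3
        have w2 := ht _ (Ioo_subset_Icc_self (o.x01 (t₀+k'))) d3'
        rcases le_total (f (x (t₀+k))) (f (x (t₀+k'))) with w | w
        · exact Or.inr (Or.inr ⟨w1, w⟩)
        · exact Or.inl (Or.inr ⟨w2, w⟩)
    rcases j1 with j1 | j1
    · left
      have := hit (k+1) (N - (k+1)) (by omega) _ (i1 j1)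
      rw [o.it, show k + 1 + (N - (k+1)) = N by omega,
        show t₀ + k' + 1 + (N - (k+1)) = t₀ + N + (k' - k) by omega] at this
      exact hV this
    · right
      have := hit (k'+1) (N - (k'+1)) (by omega) _ (i2 j1)
      rw [o.it, show k' + 1 + (N - (k'+1)) = N by omega,
        show t₀ + k + 1 + (N - (k'+1)) = t₀ + N - (k' - k) by omega] at this
      exact hV this
  -- base points
  set kz : ℝ → ℕ := fun e => sInf {k | k ∈ S ∧ g k = e} with hkz
  have hkz1 : ∀ k ∈ S, kz (g k) ∈ S ∧ g (kz (g k)) = g k ∧ kz (g k) ≤ k := by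
    intro k hk
    have hne : {j | j ∈ S ∧ g j = g k}.Nonempty := ⟨k, hk, rfl⟩
    have h2 := Nat.sInf_mem hne
    exact ⟨h2.1, h2.2, Nat.sInf_le ⟨hk, rfl⟩⟩
  set T := t₀ + N with hT
  set ok : ℕ → Option (Bool × Fin 3) := fun k =>
    if k = kz (g k) then none
    else if x (T + (k - kz (g k))) ∈ V then some (true, ty (T + (k - kz (g k))))
    else some (false, ty (T - (k - kz (g k)))) with hok
  have hcount := count_le (p := p) (A := 0) (q := 2) (S := S) c.p1 (by
      intro k hk
      have := (mem_passes.1 hk).1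
      omega) (fun k => (g k, ok k)) (Cr ×ˢ (Finset.univ : Finset (Option (Bool × Fin 3)))) (by
      intro k hk
      rw [Finset.mem_product]
      exact ⟨(hg k hk).1, Finset.mem_univ _⟩) (by
      intro k hk k' hk' he
      simp only [Prod.mk.injEq] at he
      obtain ⟨he1, he2⟩ := he
      obtain ⟨z1, z2, z3⟩ := hkz1 k hk
      obtain ⟨_, _, z3'⟩ := hkz1 k' hk'
      have y1 := key _ z1 k hk z2 z3
      have y2 := key _ z1 k' hk' (z2.trans he1) (by rw [he1]; exact z3')
      rw [← he1] at z3'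
      simp only [hok, ← he1] at he2
      set k0 := kz (g k) with hk0
      have hkN := (mem_passes.1 hk).1
      have hkN' := (mem_passes.1 hk').1
      obtain ⟨w, hw⟩ : ∃ w, k = k0 + w := ⟨k - k0, by omega⟩
      obtain ⟨w', hw'⟩ : ∃ w', k' = k0 + w' := ⟨k' - k0, by omega⟩
      rw [show k - k0 = w by omega] at y1 he2
      rw [show k' - k0 = w' by omega] at y2 he2
      have hgoal : w ≡ w' [MOD p] → k ≡ k' [MOD p] := by
        intro hw1
        rw [hw, hw']
        exact Nat.ModEq.add_left k0 hw1
      by_cases b1 : k = k0 <;> by_cases b2 : k' = k0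
      · rw [b1, b2]
      · simp only [b1, b2, if_true, if_false] at he2
        split_ifs at he2
      · simp only [b1, b2, if_true, if_false] at he2
        split_ifs at he2
      · simp only [b1, b2, if_false] at he2
        by_cases b3 : x (T + w) ∈ V <;> by_cases b4 : x (T + w') ∈ V
        · simp only [b3, b4, if_true, Option.some.injEq, Prod.mk.injEq, true_and] at he2
          have := hty _ _ (by omega) (by omega) b3 b4 he2
          exact hgoal (Nat.ModEq.add_left_cancel' T this)
        · simp [b3, b4] at he2
        · simp [b3, b4] at he2
        · simp only [b3, b4, if_false, Option.some.injEq, Prod.mk.injEq, true_and] at he2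
          have y1' := y1.resolve_left b3
          have y2' := y2.resolve_left b4
          have h5 := hty _ _ (by omega) (by omega) y1' y2' he2
          have h6 := Nat.ModEq.add_right (w + w') h5
          rw [show T - w + (w + w') = T + w' by omega, show T - w' + (w + w') = T + w by omega] at h6
          exact hgoal (Nat.ModEq.add_left_cancel' T h6).symm)
  rw [Finset.card_product] at hcount
  have hcard : (Finset.univ : Finset (Option (Bool × Fin 3))).card = 7 := by decide
  rw [hcard] at hcount
  omega

/-- choice of the best component -/
theorem Cyc.best (c : Cyc f x a b M Ω n p α β) {κ : ℝ} (hκ : 0 < κ) (hκ1 : κ ≤ 1)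
    (hj : ∃ j ≥ n, κ ≤ α j ∧ β j ≤ 1 - κ) :
    ∃ m, n ≤ m ∧ m < n + p ∧ 0 < α m - κ/8 * (β m - α m) ∧ β m + κ/8 * (β m - α m) < 1 ∧
      ∃ ty : ℕ → Fin 3, ∀ i j, n ≤ i → n ≤ j →
        x i ∈ Ioo (α m - κ/8 * (β m - α m)) (β m + κ/8 * (β m - α m)) →
        x j ∈ Ioo (α m - κ/8 * (β m - α m)) (β m + κ/8 * (β m - α m)) →
        ty i = ty j → i ≡ j [MOD p] := by
  classical
  have hp := c.p1
  set D : ℕ → ℝ := fun j => Min.min (α j) (1 - β j) with hD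
  obtain ⟨m, hm, hmax⟩ := Finset.exists_max_image (Finset.Ico n (n+p))
    (fun j => D j / (β j - α j)) ⟨n, by rw [Finset.mem_Ico]; omega⟩
  rw [Finset.mem_Ico] at hm
  have hl : ∀ j, 0 < β j - α j := fun j => by linarith [c.lt j]
  have hmax' : ∀ j ≥ n, D j * (β m - α m) ≤ D m * (β j - α j) := by
    intro j hj
    have hmod : n + (j - n) % p ≡ j [MOD p] := by
      have h1 : n + (j - n) % p ≡ n + (j - n) [MOD p] := Nat.ModEq.add_left n (Nat.mod_modEq _ _)
      rwa [show n + (j - n) = j by omega] at h1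
    have hlt := Nat.mod_lt (j - n) (show 0 < p by omega)
    obtain ⟨e1, e2⟩ := c.eq_of_mod (by omega) hj hmod
    have h1 := hmax (n + (j - n) % p) (by rw [Finset.mem_Ico]; omega)
    simp only [hD, e1, e2] at h1
    rwa [div_le_div_iff₀ (hl j) (hl m)] at h1
  obtain ⟨j, hjn, hj1, hj2⟩ := hj
  set l := β m - α m with hldef
  have hlm : 0 < l := hl m
  have hDm : κ * l ≤ D m := by
    have h1 := hmax' j hjn
    have h2 : κ ≤ D j := le_min hj1 (by linarith)
    have h3 : κ * l ≤ D j * l := mul_le_mul_of_nonneg_right h2 hlm.le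
    have h4 : 0 < D m := by
      by_contra hneg
      push Not at hneg
      have : D m * (β j - α j) ≤ 0 := mul_nonpos_of_nonpos_of_nonneg hneg (hl j).le
      have : 0 < κ * l := by positivity
      linarith
    have h5 : D m * (β j - α j) ≤ D m * 1 :=
      mul_le_mul_of_nonneg_left (by linarith [c.a0 j, c.b1 j]) h4.le
    linarith
  have hκl : 0 < κ * l := by positivity
  have hD1 : D m ≤ α m := min_le_left _ _
  have hD2 : D m ≤ 1 - β m := min_le_right _ _
  refine ⟨m, hm.1, hm.2, by linarith, by linarith, ?_⟩
  set lam := κ/8 * l with hlam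
  have hlam' : lam ≤ D m / 8 := by rw [hlam]; linarith
  have hcase : ∀ i ≥ n, x i ∈ Ioo (α m - lam) (β m + lam) →
      (Ioo (α i) (β i) ∩ Ioo (α m) (β m)).Nonempty ∨ α m - lam ∈ Ioo (α i) (β i) ∨
        β m + lam ∈ Ioo (α i) (β i) := by
    intro i hi hxi
    by_contra hcon
    push Not at hcon
    obtain ⟨q1, q2, q3⟩ := hcon
    have hxC := c.mem i
    have h1 := hmax' i hi
    have hDmpos : 0 < D m := by linarith
    have hfin : D m - lam ≤ D i → β i - α i ≤ lam → False := by
      intro r1 r2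
      have r3 : D m * (β i - α i) ≤ D m * lam := mul_le_mul_of_nonneg_left r2 hDmpos.le
      have r4 : (7/8 * D m) * l ≤ D i * l := mul_le_mul_of_nonneg_right (by linarith) hlm.le
      have r5 : D m * lam ≤ D m * (1/8 * l) := by
        apply mul_le_mul_of_nonneg_left _ hDmpos.le
        rw [hlam]; nlinarith
      have : 0 < D m * l := by positivity
      nlinarith
    rcases disj_cases (c.lt i) (c.lt m) (disjoint_iff_inter_eq_empty.2 q1)
      with e | e
    · have r1 : α m - lam ≤ α i := by
        by_contra hlt
        push Not at hlt
        exact q2 ⟨hlt, by linarith [hxi.1, hxC.2]⟩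
      apply hfin
      · exact le_min (by linarith) (by linarith [c.lt m, mul_pos (by linarith : 0 < κ/8) hlm])
      · linarith
    · have r1 : β i ≤ β m + lam := by
        by_contra hlt
        push Not at hlt
        exact q3 ⟨by linarith [hxi.2, hxC.1], hlt⟩
      apply hfin
      · exact le_min (by linarith [c.lt m, mul_pos (by linarith : 0 < κ/8) hlm]) (by linarith)
      · linarith
  refine ⟨fun i => if (Ioo (α i) (β i) ∩ Ioo (α m) (β m)).Nonempty then 0 else
    if α m - lam ∈ Ioo (α i) (β i) then 1 else 2, ?_⟩
  intro i j hi hj hxi hxj he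
  have h1 := hcase i hi hxi
  have h2 := hcase j hj hxj
  by_cases a1 : (Ioo (α i) (β i) ∩ Ioo (α m) (β m)).Nonempty <;>
    by_cases a2 : (Ioo (α j) (β j) ∩ Ioo (α m) (β m)).Nonempty
  · exact ((c.same i m hi hm.1).1 (c.same_of a1)).trans ((c.same j m hj hm.1).1 (c.same_of a2)).symm
  · simp only [a1, a2, if_true, if_false] at he
    split_ifs at he
    all_goals exact absurd he (by decide)
  · simp only [a1, a2, if_true, if_false] at he
    split_ifs at he
    all_goals exact absurd he (by decide)
  · have h1' := h1.resolve_left a1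
    have h2' := h2.resolve_left a2
    simp only [a1, a2, if_false] at he
    by_cases a3 : α m - lam ∈ Ioo (α i) (β i) <;> by_cases a4 : α m - lam ∈ Ioo (α j) (β j)
    · exact c.mod_of hi hj a3 a4
    · rw [if_pos a3, if_neg a4] at he; exact absurd he (by decide)
    · rw [if_neg a3, if_pos a4] at he; exact absurd he (by decide)
    · exact c.mod_of hi hj (h1'.resolve_left a3) (h2'.resolve_left a4)

end NoHom


/-! ### Part 10: the final contradiction -/

namespace NoHom

variable {f : ℝ → ℝ} {Cr : Finset ℝ} {x a b : ℕ → ℝ} {η : ℝ} {M n p : ℕ} {Ω : Set ℝ} {α β : ℕ → ℝ}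

theorem pull_it {N : ℕ} {u v : ℕ → ℝ} (hp : ∀ k < N, Pull f (u k) (v k) (u (k+1)) (v (k+1))) :
    ∀ y ∈ Ioo (u 0) (v 0), f^[N] y ∈ Ioo (u N) (v N) := by
  intro y hy
  have : ∀ k ≤ N, f^[k] y ∈ Ioo (u k) (v k) := by
    intro k hk
    induction k with
    | zero => exact hy
    | succ k ih =>
      rw [Function.iterate_succ_apply']
      exact (hp k hk).maps _ (ih (by omega))
  exact this N le_rfl

theorem Cyc.local_contr (c : Cyc f x a b M Ω n p α β) (h : Sys f Cr) (o : Orb f Cr x a b η)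
    {V : Set ℝ} (ty : ℕ → Fin 3)
    (hty : ∀ i j, n ≤ i → n ≤ j → x i ∈ V → x j ∈ V → ty i = ty j → i ≡ j [MOD p])
    {t₀ N : ℕ} (ht₀ : n ≤ t₀) (hN1 : 1 ≤ N) (hN : N ≤ 2 * p) {D δ r ε : ℝ} (hD0 : 0 < D)
    (hE : ∀ T u a b v S, Chain f Cr r T u a b v S → S.card ≤ 14 * Cr.card →
      cr (u T) (a T) (b T) (v T) ≤ δ → ∀ k ≤ T, cr (u k) (a k) (b k) (v k) ≤ ε)
    (hD : ∀ T u a b v S, Chain f Cr 1 T u a b v S → S.card ≤ 14 * Cr.card →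
      cr (u T) (a T) (b T) (v T) ≤ 8 → ∀ z ∈ Ioo (a 0) (b 0),
        |deriv f^[T] z| * (b 0 - a 0) ≤ D * (b T - a T))
    (hε : 0 < ε) (hΛ : (2 + D) * ε ≤ 1) {e r₀ : ℝ} (hr₀ : 0 < r₀)
    (hV : Ioo (e - 2*r₀) (e + 2*r₀) ⊆ V) (h0 : 0 ≤ e - 2*r₀) (h1 : e + 2*r₀ ≤ 1)
    (hJ : Nest (e - r₀) (a (t₀+N)) (b (t₀+N)) (e + r₀))
    (hcr : cr (e - r₀) (a (t₀+N)) (b (t₀+N)) (e + r₀) ≤ δ)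
    (hL : a t₀ - (b t₀ - a t₀) ≤ e - r₀) (hR : e + r₀ ≤ b t₀ + (b t₀ - a t₀))
    (hr : 2 * r₀ ≤ b t₀ - a t₀) : False := by
  have hsub : Ioo (e - r₀) (e + r₀) ⊆ Ioo (e - 2*r₀) (e + 2*r₀) :=
    Ioo_subset_Ioo (by linarith) (by linarith)
  obtain ⟨u, v, hu, hv, hn, hp⟩ := h.outer_seq (T := N) (a := fun k => a (t₀+k))
    (b := fun k => b (t₀+k)) (fun k _ => (o.pos _).le) (fun k _ => (o.lt1 _).le)
    (fun k _ => o.lt _) (fun k _ => o.pull (t₀+k)) hJ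
  have hxm : ∀ k ≤ N, x (t₀+k) ∈ Ioo (u k) (v k) := fun k hk =>
    ⟨(hn k hk).2.1.trans (o.mem _).1, (o.mem _).2.trans (hn k hk).2.2.2.1⟩
  have hc1 := c.count_window h o ty hty ht₀ hN hxm (fun k hk => (hp k hk).maps)
    (by rw [hu, hv]; exact hsub.trans hV)
  have hch1 := h.pull_chain r hn hp (fun k _ => o.pull (t₀+k))
  have hcr0 := hE N u _ _ v _ hch1 hc1 (by rw [hu, hv]; exact hcr) 0 (Nat.zero_le _)
  have hn0 := hn 0 (Nat.zero_le _)
  simp only [Nat.add_zero] at hcr0 hn0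
  set J := b t₀ - a t₀ with hJdef
  have hJpos : 0 < J := by have := o.lt t₀; linarith
  have e1 : (2 + D) * J ≤ a t₀ - u 0 := by
    have w := cr_left hn0
    have q : 0 < a t₀ - u 0 := by linarith [hn0.2.1]
    have w2 : J ≤ ε * (a t₀ - u 0) := w.trans (mul_le_mul_of_nonneg_right hcr0 q.le)
    have w3 : (2 + D) * J ≤ (2 + D) * (ε * (a t₀ - u 0)) :=
      mul_le_mul_of_nonneg_left w2 (by linarith)
    nlinarith
  have e2 : (2 + D) * J ≤ v 0 - b t₀ := by
    have w := cr_right hn0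
    have q : 0 < v 0 - b t₀ := by linarith [hn0.2.2.2.1]
    have w2 : J ≤ ε * (v 0 - b t₀) := w.trans (mul_le_mul_of_nonneg_right hcr0 q.le)
    have w3 : (2 + D) * J ≤ (2 + D) * (ε * (v 0 - b t₀)) :=
      mul_le_mul_of_nonneg_left w2 (by linarith)
    nlinarith
  have hDJ : 0 < D * J := by positivity
  -- second layer
  have huv : ∀ k ≤ N, u k < v k := fun k hk => by
    linarith [(hn k hk).2.1, (hn k hk).2.2.1, (hn k hk).2.2.2.1]
  obtain ⟨u', v', hu', hv', hn', hp'⟩ := h.outer_seq (T := N) (a := u)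
    (b := v) (fun k hk => (hn k hk).1) (fun k hk => (hn k hk).2.2.2.2)
    huv hp (u₀ := e - 2*r₀) (v₀ := e + 2*r₀) (by
      rw [hu, hv]; exact ⟨h0, by linarith, by linarith, by linarith, h1⟩)
  have hc2 := c.count_window h o ty hty ht₀ hN (u := u') (v := v')
    (fun k hk => ⟨(hn' k hk).2.1.trans (hxm k hk).1, (hxm k hk).2.trans (hn' k hk).2.2.2.1⟩)
    (fun k hk => (hp' k hk).maps) (by rw [hu', hv']; exact hV)
  have hch2 := h.pull_chain 1 hn' hp' hp
  have hder := hD N u' u v v' _ hch2 hc2 (by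
    rw [hu, hv, hu', hv']
    unfold cr
    rw [div_le_iff₀ (by ring_nf; positivity)]
    ring_nf
    exact le_rfl)
  have hB : Ioo (e - r₀) (e + r₀) ⊆ Ioo (u 0) (v 0) :=
    Ioo_subset_Ioo (by linarith) (by linarith)
  apply h.A4 (α := e - r₀) (β := e + r₀) (by linarith) (by linarith) (by linarith) hN1
  · intro y hy
    have := pull_it hp y (hB hy)
    rwa [hu, hv] at this
  · intro y hy
    have w := hder y (hB hy)
    rw [hu, hv] at w
    have w1 : 2 * D * J ≤ v 0 - u 0 := by nlinarith
    have w2 : |deriv f^[N] y| * (2 * D * J) ≤ D * J := by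
      have q1 := mul_le_mul_of_nonneg_left w1 (abs_nonneg (deriv f^[N] y))
      have q2 : D * (e + r₀ - (e - r₀)) ≤ D * J := mul_le_mul_of_nonneg_left (by linarith) hD0.le
      linarith
    by_contra hcon
    push Not at hcon
    nlinarith

end NoHom


/-! ### Part 11: precritical points are dense -/

namespace NoHom

variable {f : ℝ → ℝ} {Cr : Finset ℝ} {x a b : ℕ → ℝ} {η : ℝ} {M n p : ℕ} {Ω : Set ℝ} {α β : ℕ → ℝ}

theorem Cyc.size (c : Cyc f x a b M Ω n p α β) (h : Sys f Cr) (o : Orb f Cr x a b η)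
    {m t₀ N : ℕ} {lam K D : ℝ} (hm : n ≤ m) (ty : ℕ → Fin 3)
    (hty : ∀ i j, n ≤ i → n ≤ j → x i ∈ Ioo (α m - lam) (β m + lam) →
      x j ∈ Ioo (α m - lam) (β m + lam) → ty i = ty j → i ≡ j [MOD p])
    (hlam : 0 < lam) (h0 : 0 ≤ α m - lam) (h1 : β m + lam ≤ 1)
    (ht₀ : n ≤ t₀) (htm : t₀ ≡ m [MOD p]) (hN : N ≤ 2 * p) (hNm : t₀ + N ≡ m [MOD p])
    (hK : cr (α m - lam) (α m) (β m) (β m + lam) ≤ K)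
    (hD : ∀ T u a b v S, Chain f Cr 1 T u a b v S → S.card ≤ 14 * Cr.card →
      cr (u T) (a T) (b T) (v T) ≤ K → ∀ z ∈ Ioo (a 0) (b 0),
        |deriv f^[T] z| * (b 0 - a 0) ≤ D * (b T - a T)) :
    b (t₀ + N) - a (t₀ + N) ≤ D * (b t₀ - a t₀) := by
  obtain ⟨q1, q2⟩ := c.eq_of_mod ht₀ hm htm
  obtain ⟨q3, q4⟩ := c.eq_of_mod (by omega) hm hNm
  have hlt := c.lt m
  obtain ⟨u, v, hu, hv, hn, hp⟩ := h.outer_seq (T := N) (a := fun k => α (t₀+k))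
    (b := fun k => β (t₀+k)) (fun k _ => c.a0 _) (fun k _ => c.b1 _)
    (fun k _ => c.lt _) (fun k _ => c.pull h o (t₀+k)) (u₀ := α m - lam) (v₀ := β m + lam) (by
      simp only [q3, q4]
      exact ⟨h0, by linarith, hlt, by linarith, h1⟩)
  have hc := c.count_window h o ty hty ht₀ hN
    (fun k hk => ⟨(hn k hk).2.1.trans (c.mem _).1, (c.mem _).2.trans (hn k hk).2.2.2.1⟩)
    (fun k hk => (hp k hk).maps) (by rw [hu, hv])
  have hch := h.pull_chain 1 hn hp (fun k _ => c.pull h o (t₀+k))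
  have hder := hD N u _ _ v _ hch hc (by
    simp only [q3, q4]
    rw [hu, hv]; exact hK)
  simp only [Nat.add_zero, q1, q2, q3, q4] at hder
  have hder' : ∀ z ∈ Ioo (a t₀) (b t₀), ‖deriv f^[N] z‖ ≤ D := by
    intro z hz
    obtain ⟨j1, j2⟩ := c.cJ h o t₀
    rw [q1] at j1
    rw [q2] at j2
    have := hder z ⟨j1.trans hz.1, hz.2.trans j2⟩
    rw [Real.norm_eq_abs]
    exact le_of_mul_le_mul_right this (by linarith)
  set T := t₀ + N with hT
  have hltT := o.lt T
  have hlt0 := o.lt t₀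
  have hD0 : 0 ≤ D := (norm_nonneg _).trans (hder' _ (o.mem t₀))
  by_contra hcon
  push Not at hcon
  have hDJ : 0 ≤ D * (b t₀ - a t₀) := mul_nonneg hD0 (by linarith)
  set s := (b T - a T - D * (b t₀ - a t₀)) / 4 with hs
  obtain ⟨y1, hy1, e1⟩ := o.surj h t₀ N (show a T + s ∈ Ioo (a T) (b T) from
    ⟨by linarith, by linarith⟩)
  obtain ⟨y2, hy2, e2⟩ := o.surj h t₀ N (show b T - s ∈ Ioo (a T) (b T) from
    ⟨by linarith, by linarith⟩)
  have hmv := (convex_Ioo (a t₀) (b t₀)).norm_image_sub_le_of_norm_deriv_le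
    (f := f^[N]) (fun z _ => (h.itcd N).differentiable (by norm_num) z) hder' hy1 hy2
  rw [e1, e2, Real.norm_eq_abs, Real.norm_eq_abs] at hmv
  have hy : |y2 - y1| ≤ b t₀ - a t₀ := by
    rw [abs_le]; constructor <;> linarith [hy1.1, hy1.2, hy2.1, hy2.2]
  have := mul_le_mul_of_nonneg_left hy hD0
  have := le_abs_self (b T - s - (a T + s))
  linarith

set_option maxHeartbeats 1600000 in
theorem Sys.no_orb (h : Sys f Cr) (o : Orb f Cr x a b η) : False := by
  obtain ⟨κ, hκ, hκ1, hkap⟩ := h.kappa o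
  set d := κ / 8 with hd
  have hd0 : 0 < d := by positivity
  obtain ⟨D1, hD1, hcD1⟩ := h.chainD one_pos (14 * Cr.card) (1 / d^2 + 2 / d)
  obtain ⟨D2, hD2, hcD2⟩ := h.chainD one_pos (14 * Cr.card) 8
  obtain ⟨δ, hδ, r, hr, hE⟩ := h.chainE (14 * Cr.card) (ε := 1 / (2 + D2)) (by positivity)
  set t := 1 + 3 / δ with ht
  have hδ3 : 0 < 3 / δ := by positivity
  have ht0 : 0 < t := by positivity
  have htδ : 1 / t ^ 2 + 2 / t ≤ δ := by
    have h1 : 1 / t ^ 2 ≤ 1 / t := by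
      apply one_div_le_one_div_of_le ht0
      nlinarith
    have h2 : 3 / t ≤ δ := by
      rw [div_le_iff₀ ht0, ht]
      have : δ * (3 / δ) = 3 := by field_simp
      nlinarith
    have h3 : 3 / t = 1 / t + 2 / t := by ring
    linarith
  -- choice of ε
  set ε := d / (4 * t * (1 + D1)) with hε
  have hε0 : 0 < ε := by positivity
  have ht1 : 1 ≤ t := by linarith
  have hεeq : ε * (4 * t * (1 + D1)) = d := by rw [hε]; field_simp
  have hεt : ε * t ≤ d / 4 := by
    have : 0 < ε * t := by positivity
    have : 0 < ε * t * D1 := by positivity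
    nlinarith
  have hεd : ε ≤ d / 4 := by nlinarith
  have hd1 : d ≤ 1 / 8 := by rw [hd]; linarith
  have hεD : ε * D1 < 1 := by
    have q1 : 0 < ε * D1 := by positivity
    have q2 : ε * D1 ≤ ε * D1 * t := le_mul_of_one_le_right q1.le ht1
    have : 0 < ε * t := by positivity
    nlinarith
  obtain ⟨M₀, hclose⟩ := h.close o hε0
  obtain ⟨Ω, n, p, α, β, c⟩ := h.cyc o (M₀ + 3)
  have hp3 : 3 ≤ p := by have := c.Mp; omega
  obtain ⟨m, hnm, hmp, hb0, hb1, ty, hty⟩ := c.best hκ hκ1 (hkap _ _ _ _ _ _ c hp3)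
  rw [← hd] at hb0 hb1 hty
  have hltm := c.lt m
  set L := β m - α m with hL
  have hL0 : 0 < L := by linarith
  have hcl := hclose (M₀ + 3) (by omega) Ω n p α β c m
  have hdL : 0 < d * L := by positivity
  -- main claim
  have hmodi : ∀ i, m + i * p ≡ m [MOD p] := by
    intro i
    simp [Nat.ModEq]
  have main : ∀ i j, 1 ≤ i → i < j → j ≤ 3 →
      ((a (m + i * p) - α m < ε * (b (m+i*p) - a (m+i*p)) ∧
        a (m + j * p) - α m < ε * (b (m+j*p) - a (m+j*p))) ∨
       (β m - b (m + i * p) < ε * (b (m+i*p) - a (m+i*p)) ∧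
        β m - b (m + j * p) < ε * (b (m+j*p) - a (m+j*p)))) → False := by
    intro i j hi hij hj3 hends
    obtain ⟨w, rfl⟩ : ∃ w, j = i + w := ⟨j - i, by omega⟩
    have hw : 1 ≤ w := by omega
    have hw2 : w ≤ 2 := by omega
    set t₀ := m + i * p with ht₀
    have hTe : m + (i + w) * p = t₀ + w * p := by rw [ht₀]; ring
    rw [hTe] at hends
    have hNp : w * p ≤ 2 * p := Nat.mul_le_mul_right _ hw2
    have hN1 : 1 ≤ w * p := Nat.mul_pos hw (by omega)
    have hmodT : t₀ + w * p ≡ m [MOD p] := by rw [← hTe]; exact hmodi _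
    have hsz := c.size h o hnm ty hty hdL hb0.le hb1.le (by omega) (hmodi i) hNp hmodT
      (cr_le ⟨hb0.le, by linarith, hltm, by linarith, hb1.le⟩ hd0 (by linarith) (by linarith)) hcD1
    obtain ⟨i1, i2⟩ := c.cJ h o t₀
    obtain ⟨j1, j2⟩ := c.cJ h o (t₀ + w * p)
    obtain ⟨q1, q2⟩ := c.eq_of_mod (i := t₀) (by omega) hnm (hmodi i)
    obtain ⟨q3, q4⟩ := c.eq_of_mod (i := t₀ + w * p) (by omega) hnm hmodT
    rw [q1] at i1
    rw [q2] at i2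
    rw [q3] at j1
    rw [q4] at j2
    have hlt0 := o.lt t₀
    have hltT := o.lt (t₀ + w * p)
    have hdis := disj_cases hlt0 hltT (o.disj t₀ (t₀ + w * p) (by omega))
    set T := t₀ + w * p with hT
    set J := b t₀ - a t₀ with hJ
    set J' := b T - a T with hJ'
    have hJ0 : 0 < J := by linarith
    have hJ0' : 0 < J' := by linarith
    have hJL : J ≤ L := by linarith
    have hεJ : ε * J' ≤ ε * D1 * J := by
      have := mul_le_mul_of_nonneg_left hsz hε0.le
      linarith
    have hεJ2 : ε * D1 * J < J := by
      have := mul_lt_mul_of_pos_right hεD hJ0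
      linarith
    have hεJ3 : ε * J ≤ d / 4 * J := mul_le_mul_of_nonneg_right hεd hJ0.le
    have hdJ : 0 < d * J := by positivity
    have hdJ1 : d * J ≤ 1/8 * J := mul_le_mul_of_nonneg_right hd1 hJ0.le
    have hdJL : d * J ≤ d * L := mul_le_mul_of_nonneg_left hJL hd0.le
    have htJ : J' ≤ ε * J → t * J' ≤ d / 4 * J := by
      intro hle
      have w1 := mul_le_mul_of_nonneg_left hle ht0.le
      have w2 := mul_le_mul_of_nonneg_right hεt hJ0.le
      have w3 : t * (ε * J) = ε * t * J := by ring
      linarith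
    have hεJ0 : 0 < ε * J := by positivity
    have fin : ∀ e : ℝ, J' ≤ ε * J → α m ≤ e → e ≤ β m → e - ε * J ≤ a T → b T ≤ e + ε * J →
        a t₀ - ε * J ≤ e → e ≤ b t₀ + ε * J → False := by
      intro e z1 z2 z3 z4 z5 z6 z7
      have z8 := htJ z1
      have hN : Nest (e - d/2 * J) (a T) (b T) (e + d/2 * J) :=
        ⟨by linarith, by linarith, hltT, by linarith, by linarith⟩
      refine c.local_contr h o ty hty (t₀ := t₀) (N := w * p) (by omega) hN1 hNp hD2 hE hcD2
        (by positivity) (by rw [mul_one_div, div_self (by positivity)]) (e := e) (r₀ := d/2 * J)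
        (by positivity) ?_ (by linarith) (by linarith) hN ?_ (by linarith) (by linarith)
        (by linarith)
      · exact Ioo_subset_Ioo (by linarith) (by linarith)
      · exact (cr_le hN ht0 (by linarith) (by linarith)).trans htδ
    rcases hends with ⟨r1, r2⟩ | ⟨r1, r2⟩
    · rcases hdis with hh | hh
      · linarith
      · exact fin (α m) (by linarith) le_rfl hltm.le (by linarith) (by linarith) (by linarith)
          (by linarith)
    · rcases hdis with hh | hh
      · exact fin (β m) (by linarith) hltm.le le_rfl (by linarith) (by linarith) (by linarith)
          (by linarith)
      · linarith
  have c1 := hcl 1 hnm hmp le_rfl (by norm_num)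
  have c2 := hcl 2 hnm hmp (by norm_num) (by norm_num)
  have c3 := hcl 3 hnm hmp (by norm_num) le_rfl
  have m12 := main 1 2 le_rfl (by norm_num) (by norm_num)
  have m13 := main 1 3 le_rfl (by norm_num) (by norm_num)
  have m23 := main 2 3 (by norm_num) (by norm_num) le_rfl
  clear main hcl hclose
  tauto

/-- Main result of the core: precritical points are dense. -/
theorem Sys.core (h : Sys f Cr) {s t : ℝ} (hs : 0 ≤ s) (hst : s < t) (ht : t ≤ 1) :
    ∃ y ∈ Ioo s t, ∃ n : ℕ, f^[n] y ∈ Cr := by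
  by_contra hcon
  push Not at hcon
  obtain ⟨x, a, b, η, o⟩ := h.orb hs hst ht hcon
  exact h.no_orb o

end NoHom


/-! ### Part 12: consequences of non-flatness -/

namespace NoHom

variable {f : ℝ → ℝ} {Cr : Finset ℝ}

/-- local form of non-flatness -/
theorem nonflat_local (hcd : ContDiff ℝ 3 f) {c : ℝ} (hnf : NonFlatAt f c)
    (hreg : ∀ᶠ x in nhdsWithin c {c}ᶜ, deriv f x ≠ 0) :
    ∃ n : ℕ, ∃ A : ℝ, 0 < A ∧ ∀ᶠ x in nhdsWithin c {c}ᶜ,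
      A / 2 * |x - c| ^ n ≤ |deriv f x| ∧ |deriv f x| ≤ 2 * A * |x - c| ^ n := by
  obtain ⟨φ, P, U, hU, hφ, hφ0, hφd, hfP⟩ := hnf
  have hφdiff : Differentiable ℝ φ := hφ.differentiable (by norm_num)
  have hfdiff : Differentiable ℝ f := hcd.differentiable (by norm_num)
  have hstrict : HasStrictDerivAt φ (deriv φ 0) 0 :=
    (hφ.contDiffAt).hasStrictDerivAt (by norm_num)
  have hmap : map φ (nhds 0) = nhds c := by
    rw [← hφ0]; exact hstrict.map_nhds_eq (hφd 0)
  have hne : ∀ᶠ t in nhdsWithin (0:ℝ) {0}ᶜ, φ t ≠ c := by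
    have := (hφdiff 0).hasDerivAt.eventually_ne (c := c) (hφd 0)
    exact this
  have hder : ∀ᶠ t in nhds (0:ℝ), deriv f (φ t) * deriv φ t = P.derivative.eval t := by
    have hU' : ∀ᶠ t in nhds (0:ℝ), U ∈ nhds t := eventually_mem_nhds_iff.2 hU
    filter_upwards [hU'] with t ht
    have h1 : HasDerivAt (fun s => f (φ s)) (deriv f (φ t) * deriv φ t) t :=
      (hfdiff (φ t)).hasDerivAt.comp t (hφdiff t).hasDerivAt
    have h2 : HasDerivAt (fun s => P.eval s) (P.derivative.eval t) t := P.hasDerivAt t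
    have h3 : HasDerivAt (fun s => f (φ s)) (P.derivative.eval t) t :=
      h2.congr_of_eventuallyEq (by filter_upwards [ht] with s hs using hfP s hs)
    exact h1.unique h3
  have htend : Tendsto φ (nhdsWithin (0:ℝ) {0}ᶜ) (nhdsWithin c {c}ᶜ) := by
    rw [tendsto_nhdsWithin_iff]
    refine ⟨?_, hne⟩
    have : Tendsto φ (nhds 0) (nhds c) := hmap.le
    exact this.mono_left nhdsWithin_le_nhds
  have hP0 : P.derivative ≠ 0 := by
    intro h0
    have h1 : ∀ᶠ t in nhdsWithin (0:ℝ) {0}ᶜ, False := by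
      filter_upwards [htend.eventually hreg, hder.filter_mono nhdsWithin_le_nhds] with t h1 h2
      rw [h0, Polynomial.eval_zero] at h2
      exact (mul_ne_zero h1 (hφd t)) h2
    rw [eventually_false_iff_eq_bot] at h1
    exact (inferInstance : (nhdsWithin (0:ℝ) {0}ᶜ).NeBot).ne h1
  obtain ⟨R, hR, hRd⟩ := Polynomial.exists_eq_pow_rootMultiplicity_mul_and_not_dvd P.derivative hP0 0
  set n := Polynomial.rootMultiplicity 0 P.derivative with hn
  have hR0 : R.eval 0 ≠ 0 := fun h0 => hRd (Polynomial.dvd_iff_isRoot.2 h0)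
  set B := deriv φ 0 with hB
  have hB0 : B ≠ 0 := hφd 0
  have hslope : Tendsto (fun t => (φ t - c) / t) (nhdsWithin (0:ℝ) {0}ᶜ) (nhds B) := by
    have := hasDerivAt_iff_tendsto_slope.1 (hφdiff 0).hasDerivAt
    refine this.congr' ?_
    filter_upwards with t
    rw [slope_def_field, hφ0, sub_zero]
  have hRt : Tendsto (fun t => R.eval t) (nhdsWithin (0:ℝ) {0}ᶜ) (nhds (R.eval 0)) :=
    (R.continuous.tendsto 0).mono_left nhdsWithin_le_nhds
  have hφ't : Tendsto (fun t => deriv φ t) (nhdsWithin (0:ℝ) {0}ᶜ) (nhds B) :=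
    ((hφ.continuous_deriv (by norm_num)).tendsto 0).mono_left nhdsWithin_le_nhds
  set A := |R.eval 0| / (|B| * |B| ^ n) with hA
  have hA0 : 0 < A := by positivity
  have hlim : Tendsto (fun t => |R.eval t| / (|deriv φ t| * |(φ t - c) / t| ^ n))
      (nhdsWithin (0:ℝ) {0}ᶜ) (nhds A) := by
    apply Tendsto.div hRt.abs (hφ't.abs.mul (hslope.abs.pow n))
    positivity
  have hb1 := hlim.eventually (lt_mem_nhds (show A / 2 < A by linarith))
  have hb2 := hlim.eventually (gt_mem_nhds (show A < 2 * A by linarith))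
  have hfin : ∀ᶠ t in nhdsWithin (0:ℝ) {0}ᶜ,
      A / 2 * |φ t - c| ^ n ≤ |deriv f (φ t)| ∧ |deriv f (φ t)| ≤ 2 * A * |φ t - c| ^ n := by
    filter_upwards [hb1, hb2, hne, hder.filter_mono nhdsWithin_le_nhds, self_mem_nhdsWithin]
      with t h1 h2 h3 h4 h5
    have h5' : t ≠ 0 := h5
    have hpos : 0 < |φ t - c| := abs_pos.2 (sub_ne_zero.2 h3)
    have hval : |R.eval t| / (|deriv φ t| * |(φ t - c) / t| ^ n) =
        |deriv f (φ t)| / |φ t - c| ^ n := by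
      have h6 : |deriv f (φ t)| * |deriv φ t| = |t| ^ n * |R.eval t| := by
        rw [← abs_mul, h4, hR]
        simp [abs_mul]
      have hd : 0 < |deriv φ t| := abs_pos.2 (hφd t)
      have ht : 0 < |t| := abs_pos.2 h5'
      rw [abs_div, div_pow, div_eq_div_iff (by positivity) (by positivity)]
      field_simp
      linarith
    rw [hval] at h1 h2
    rw [lt_div_iff₀ (by positivity)] at h1
    rw [div_lt_iff₀ (by positivity)] at h2
    exact ⟨h1.le, h2.le⟩
  refine ⟨n, A, hA0, ?_⟩
  rw [eventually_nhdsWithin_iff] at hfin ⊢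
  rw [← hmap, eventually_map]
  filter_upwards [hfin] with t ht hx
  apply ht
  rintro rfl
  exact hx hφ0

/-- global two-sided bound -/
theorem nonflat_global (hcd : ContDiff ℝ 3 f)
    (hreg : ∀ x ∈ Icc (0:ℝ) 1, x ∉ Cr → deriv f x ≠ 0) (hI : ∀ c ∈ Cr, c ∈ Ioo (0:ℝ) 1)
    (hnf : ∀ c ∈ Cr, NonFlatAt f c) :
    ∃ e : ℝ → ℕ, ∃ c0 C0 : ℝ, 0 < c0 ∧ 0 < C0 ∧ ∀ y ∈ Icc (0:ℝ) 1, y ∉ Cr →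
      c0 * ∏ c ∈ Cr, |y - c| ^ e c ≤ |deriv f y| ∧
      |deriv f y| ≤ C0 * ∏ c ∈ Cr, |y - c| ^ e c := by
  classical
  have hloc : ∀ c : ℝ, ∃ n : ℕ, ∃ A : ℝ, c ∈ Cr → 0 < A ∧ ∀ᶠ x in nhdsWithin c {c}ᶜ,
      A / 2 * |x - c| ^ n ≤ |deriv f x| ∧ |deriv f x| ≤ 2 * A * |x - c| ^ n := by
    intro c
    by_cases hc : c ∈ Cr
    · obtain ⟨n, A, h1, h2⟩ := nonflat_local hcd (hnf c hc) (by
        have h1 : ∀ᶠ x in nhdsWithin c {c}ᶜ, x ∈ Ioo (0:ℝ) 1 :=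
          (isOpen_Ioo.mem_nhds (hI c hc) : _ ∈ nhds c) |> fun h => nhdsWithin_le_nhds h
        have h2 : ∀ᶠ x in nhdsWithin c {c}ᶜ, x ∉ Cr.erase c := by
          have : IsOpen ((Cr.erase c : Finset ℝ) : Set ℝ)ᶜ := (Finset.finite_toSet _).isClosed.isOpen_compl
          exact nhdsWithin_le_nhds (this.mem_nhds (by simp))
        filter_upwards [h1, h2, self_mem_nhdsWithin] with x h1 h2 h3
        exact hreg x (Ioo_subset_Icc_self h1) (fun hx => h2 (Finset.mem_erase.2 ⟨h3, hx⟩)))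
      exact ⟨n, A, fun _ => ⟨h1, h2⟩⟩
    · exact ⟨0, 0, fun h => absurd h hc⟩
  choose e A hA using hloc
  refine ⟨e, ?_⟩
  set w : ℝ → ℝ := fun y => ∏ c ∈ Cr, |y - c| ^ e c with hw
  have hw0 : ∀ y, 0 ≤ w y := fun y => Finset.prod_nonneg fun c _ => by positivity
  have key := isCompact_Icc (a := (0:ℝ)) (b := 1) |>.induction_on
    (p := fun s => ∃ c0 C0 : ℝ, 0 < c0 ∧ 0 < C0 ∧ ∀ y ∈ s, y ∉ Cr →
      c0 * w y ≤ |deriv f y| ∧ |deriv f y| ≤ C0 * w y)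
    ⟨1, 1, one_pos, one_pos, fun y hy => absurd hy (notMem_empty y)⟩
    (fun s t hst ⟨c0, C0, h1, h2, h3⟩ => ⟨c0, C0, h1, h2, fun y hy => h3 y (hst hy)⟩)
    (fun s t ⟨c0, C0, h1, h2, h3⟩ ⟨c1, C1, k1, k2, k3⟩ =>
      ⟨min c0 c1, max C0 C1, lt_min h1 k1, lt_max_of_lt_left h2, fun y hy hyC => by
        rcases hy with hy | hy
        · obtain ⟨q1, q2⟩ := h3 y hy hyC
          exact ⟨(mul_le_mul_of_nonneg_right (min_le_left _ _) (hw0 y)).trans q1,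
            q2.trans (mul_le_mul_of_nonneg_right (le_max_left _ _) (hw0 y))⟩
        · obtain ⟨q1, q2⟩ := k3 y hy hyC
          exact ⟨(mul_le_mul_of_nonneg_right (min_le_right _ _) (hw0 y)).trans q1,
            q2.trans (mul_le_mul_of_nonneg_right (le_max_right _ _) (hw0 y))⟩⟩)
    (fun x hx => by
      by_cases hxC : x ∈ Cr
      · obtain ⟨hA0, hev⟩ := hA x hxC
        set v : ℝ → ℝ := fun y => ∏ c ∈ Cr.erase x, |y - c| ^ e c with hv
        have hvc : Continuous v := by
          apply continuous_finsetProd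
          intro c _
          fun_prop
        have hv0 : 0 < v x := Finset.prod_pos fun c hc => by
          have : x - c ≠ 0 := sub_ne_zero.2 (Finset.ne_of_mem_erase hc).symm
          positivity
        have hwv : ∀ y, w y = |y - x| ^ e x * v y := fun y => (Finset.mul_prod_erase _ _ hxC).symm
        have b1 : ∀ᶠ y in nhds x, v x / 2 < v y :=
          (hvc.tendsto x).eventually (lt_mem_nhds (by linarith))
        have b2 : ∀ᶠ y in nhds x, v y < 2 * v x :=
          (hvc.tendsto x).eventually (gt_mem_nhds (by linarith))
        rw [eventually_nhdsWithin_iff] at hev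
        refine ⟨_, mem_nhdsWithin_of_mem_nhds (b1.and (b2.and hev)),
          A x / (4 * v x), 4 * A x / v x, by positivity, by positivity, ?_⟩
        rintro y ⟨y1, y2, y3⟩ hyC
        obtain ⟨y4, y5⟩ := y3 (fun hyx => hyC (by rw [mem_singleton_iff.1 hyx]; exact hxC))
        rw [hwv]
        set z := |y - x| ^ e x with hz
        have hz0 : 0 ≤ z := by positivity
        constructor
        · refine le_trans ?_ y4
          rw [div_mul_eq_mul_div, div_le_iff₀ (by positivity)]
          have : A x * z * v y ≤ A x * z * (2 * v x) :=
            mul_le_mul_of_nonneg_left y2.le (by positivity)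
          linarith
        · refine y5.trans ?_
          rw [div_mul_eq_mul_div, le_div_iff₀ (by positivity)]
          have : A x * z * (v x / 2) ≤ A x * z * v y :=
            mul_le_mul_of_nonneg_left y1.le (by positivity)
          linarith
      · have hwc : Continuous w := by
          apply continuous_finsetProd
          intro c _
          fun_prop
        have hw0x : 0 < w x := Finset.prod_pos fun c hc => by
          have : x - c ≠ 0 := sub_ne_zero.2 (fun h => hxC (h ▸ hc))
          positivity
        have hg : Continuous fun y => |deriv f y| := (hcd.continuous_deriv (by norm_num)).abs
        have hg0 : 0 < |deriv f x| := abs_pos.2 (hreg x hx hxC)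
        have b1 : ∀ᶠ y in nhds x, w x / 2 < w y :=
          (hwc.tendsto x).eventually (lt_mem_nhds (by linarith))
        have b2 : ∀ᶠ y in nhds x, w y < 2 * w x :=
          (hwc.tendsto x).eventually (gt_mem_nhds (by linarith))
        have b3 : ∀ᶠ y in nhds x, |deriv f x| / 2 < |deriv f y| :=
          (hg.tendsto x).eventually (lt_mem_nhds (by linarith))
        have b4 : ∀ᶠ y in nhds x, |deriv f y| < 2 * |deriv f x| :=
          (hg.tendsto x).eventually (gt_mem_nhds (by linarith))
        refine ⟨_, mem_nhdsWithin_of_mem_nhds (b1.and (b2.and (b3.and b4))),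
          |deriv f x| / (4 * w x), 4 * |deriv f x| / w x, by positivity, by positivity, ?_⟩
        rintro y ⟨y1, y2, y3, y4⟩ hyC
        constructor
        · refine le_trans ?_ y3.le
          rw [div_mul_eq_mul_div, div_le_iff₀ (by positivity)]
          nlinarith
        · refine y4.le.trans ?_
          rw [div_mul_eq_mul_div, le_div_iff₀ (by positivity)]
          nlinarith)
  exact key

/-- a subinterval far from a finite set -/
theorem gap (Cr : Finset ℝ) {a b : ℝ} (hab : a < b) : ∃ y1 y2 : ℝ,
    a ≤ y1 ∧ y2 ≤ b ∧ y2 - y1 = (b - a) / (3 * (Cr.card + 1)) ∧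
    ∀ c ∈ Cr, ∀ y ∈ Icc y1 y2, (b - a) / (3 * (Cr.card + 1)) ≤ |y - c| := by
  classical
  set k := Cr.card with hk
  set τ := (b - a) / (3 * ((k:ℝ) + 1)) with hτ
  have hτ0 : 0 < τ := div_pos (by linarith) (by positivity)
  have hτe : 3 * ((k:ℝ) + 1) * τ = b - a := by rw [hτ]; field_simp
  have hex : ∃ j ∈ Finset.range (k+1), ∀ c ∈ Cr, c ∉ Ioo (a + 3 * j * τ) (a + 3 * (j + 1) * τ) := by
    by_contra hcon
    push Not at hcon
    have : ∀ j : ℕ, ∃ c : ℝ, j ∈ Finset.range (k+1) →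
        c ∈ Cr ∧ c ∈ Ioo (a + 3 * j * τ) (a + 3 * (j + 1) * τ) := by
      intro j
      by_cases hj : j ∈ Finset.range (k+1)
      · obtain ⟨c, h1, h2⟩ := hcon j hj
        exact ⟨c, fun _ => ⟨h1, h2⟩⟩
      · exact ⟨0, fun h => absurd h hj⟩
    choose g hg using this
    obtain ⟨i, hi, j, hj, hij, he⟩ := Finset.exists_ne_map_eq_of_card_lt_of_maps_to
      (s := Finset.range (k+1)) (t := Cr) (by rw [Finset.card_range]; omega)
      (f := g) (fun j hj => (hg j hj).1)
    have main : ∀ i j : ℕ, i < j → g i ∈ Ioo (a + 3 * i * τ) (a + 3 * (i + 1) * τ) →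
        g i ∈ Ioo (a + 3 * j * τ) (a + 3 * (j + 1) * τ) → False := by
      intro i j hij h1 h2
      have : (i:ℝ) + 1 ≤ j := by exact_mod_cast hij
      have := mul_le_mul_of_nonneg_right this hτ0.le
      linarith [h1.2, h2.1]
    rcases lt_or_gt_of_ne hij with hlt | hlt
    · exact main i j hlt (hg i hi).2 (he ▸ (hg j hj).2)
    · exact main j i hlt (hg j hj).2 (he ▸ (hg i hi).2)
  obtain ⟨j, hj, hjc⟩ := hex
  have hjk : (j:ℝ) ≤ k := by
    have := Finset.mem_range.1 hj
    exact_mod_cast (by omega : j ≤ k)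
  have hjτ := mul_le_mul_of_nonneg_right hjk hτ0.le
  have hjτ0 : 0 ≤ (j:ℝ) * τ := by positivity
  refine ⟨a + 3 * j * τ + τ, a + 3 * j * τ + 2 * τ, by linarith, by linarith, by ring, ?_⟩
  intro c hc y hy
  have h1 := hjc c hc
  rw [mem_Ioo, not_and_or, not_lt, not_lt] at h1
  rcases h1 with h1 | h1
  · exact le_trans (by linarith [hy.1]) (le_abs_self _)
  · exact le_trans (by linarith [hy.2]) (neg_le_abs _)

theorem n3_of (hcd : ContDiff ℝ 3 f)
    (hreg : ∀ x ∈ Icc (0:ℝ) 1, x ∉ Cr → deriv f x ≠ 0) (hI : ∀ c ∈ Cr, c ∈ Ioo (0:ℝ) 1)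
    (hz : ∀ c ∈ Cr, deriv f c = 0) (hnf : ∀ c ∈ Cr, NonFlatAt f c) :
    ∃ C : ℝ, 0 < C ∧ ∃ n : ℕ, ∀ u a b v D : ℝ, 0 ≤ u → u ≤ a → a < b → b ≤ v → v ≤ 1 →
    (∀ x ∈ Icc a b, ∀ y ∈ Icc a b, |f x - f y| ≤ D) →
    ∀ x ∈ Icc u v, |deriv f x| * (b - a) ≤ C * ((v - u) / (b - a)) ^ n * D := by
  obtain ⟨e, c0, C0, hc0, hC0, hb⟩ := nonflat_global hcd hreg hI hnf
  set q : ℝ := 3 * ((Cr.card : ℝ) + 1) with hq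
  have hq1 : 1 ≤ q := by
    have : (0:ℝ) ≤ Cr.card := by positivity
    linarith
  have hq0 : 0 < q := by linarith
  set n := ∑ c ∈ Cr, e c with hn
  refine ⟨C0 * q / c0 * (2 * q) ^ n, by positivity, n, ?_⟩
  intro u a b v D hu hua hab hbv hv1 hD x hx
  have hD0 : 0 ≤ D := (abs_nonneg _).trans (hD a ⟨le_rfl, hab.le⟩ a ⟨le_rfl, hab.le⟩)
  have hba : 0 < b - a := by linarith
  set ρ := (v - u) / (b - a) with hρ
  have hρ1 : 1 ≤ ρ := by rw [hρ, le_div_iff₀ hba]; linarith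
  have hρe : ρ * (b - a) = v - u := by rw [hρ]; field_simp
  by_cases hxC : x ∈ Cr
  · rw [hz x hxC, abs_zero, zero_mul]
    positivity
  obtain ⟨y1, y2, g1, g2, g3, g4⟩ := gap Cr hab
  rw [← hq] at g3 g4
  set τ := (b - a) / q with hτ
  have hτ0 : 0 < τ := by positivity
  have hτe : q * τ = b - a := by rw [hτ]; field_simp
  have hy12 : y1 < y2 := by linarith
  obtain ⟨ξ, hξ, hξd⟩ := exists_deriv_eq_slope f hy12 hcd.continuous.continuousOn
    (hcd.differentiable (by norm_num)).differentiableOn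
  have hξD : |deriv f ξ| * τ ≤ D := by
    rw [hξd, g3, abs_div, abs_of_pos hτ0, div_mul_cancel₀ _ hτ0.ne']
    exact hD y2 ⟨by linarith, g2⟩ y1 ⟨g1, by linarith⟩
  have hξfar : ∀ c ∈ Cr, τ ≤ |ξ - c| := fun c hc => g4 c hc ξ (Ioo_subset_Icc_self hξ)
  have hξC : ξ ∉ Cr := by
    intro hc
    have := hξfar ξ hc
    rw [sub_self, abs_zero] at this
    linarith
  have hξ1 := (hb ξ ⟨by linarith [hξ.1], by linarith [hξ.2]⟩ hξC).1
  have hx2 := (hb x ⟨by linarith [hx.1], by linarith [hx.2]⟩ hxC).2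
  have hprod : ∏ c ∈ Cr, |x - c| ^ e c ≤ (2 * q * ρ) ^ n * ∏ c ∈ Cr, |ξ - c| ^ e c := by
    rw [hn, ← Finset.prod_pow_eq_pow_sum, ← Finset.prod_mul_distrib]
    apply Finset.prod_le_prod
    · intro c _; positivity
    · intro c hc
      rw [← mul_pow]
      apply pow_le_pow_left₀ (abs_nonneg _)
      have h1 : |x - c| ≤ |x - ξ| + |ξ - c| := abs_sub_le x ξ c
      have h2 : |x - ξ| ≤ v - u := by
        rw [abs_le]; constructor <;> linarith [hx.1, hx.2, hξ.1, hξ.2]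
      have h3 := hξfar c hc
      have h4 : v - u ≤ ρ * q * |ξ - c| := by
        rw [← hρe, ← hτe, ← mul_assoc]
        exact mul_le_mul_of_nonneg_left h3 (by positivity)
      have h5 : 1 ≤ ρ * q := by nlinarith
      have h6 := mul_le_mul_of_nonneg_right h5 (abs_nonneg (ξ - c))
      linarith
  set W := ∏ c ∈ Cr, |ξ - c| ^ e c with hW
  have e1 : |deriv f x| ≤ C0 * ((2 * q * ρ) ^ n * W) :=
    hx2.trans (mul_le_mul_of_nonneg_left hprod hC0.le)
  have e2 : c0 * W * τ ≤ D := (mul_le_mul_of_nonneg_right hξ1 hτ0.le).trans hξD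
  calc |deriv f x| * (b - a) ≤ C0 * ((2 * q * ρ) ^ n * W) * (b - a) :=
        mul_le_mul_of_nonneg_right e1 hba.le
    _ = C0 * q / c0 * (2 * q) ^ n * ρ ^ n * (c0 * W * τ) := by
        rw [← hτe, mul_pow (2 * q) ρ]; field_simp
    _ ≤ C0 * q / c0 * (2 * q) ^ n * ρ ^ n * D :=
        mul_le_mul_of_nonneg_left e2 (by positivity)

end NoHom


/-! ### Part 13: from modal maps to the standing assumptions -/

namespace NoHom

variable {f : ℝ → ℝ} {Cr : Finset ℝ}

/-- the turning condition holds for modal maps. -/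
theorem turn_of {l : ℕ} {c : Fin l → ℝ} (hm : IsLModal l f c) (i : Fin l) :
    (∀ p ∈ Icc (0:ℝ) 1, (∀ k, c k ∈ uIcc p (c i) → c k = c i) → f p ≤ f (c i)) ∨
    (∀ p ∈ Icc (0:ℝ) 1, (∀ k, c k ∈ uIcc p (c i) → c k = c i) → f (c i) ≤ f p) := by
  obtain ⟨hmono, hI, -, -, -, s, hs1, hs2⟩ := hm
  have hi := i.isLt
  have eR : lapPts l c i.castSucc.succ = c i := by
    unfold lapPts
    rw [dif_neg (by simp), dif_neg (by simp; omega)]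
    congr 1
  have eL : lapPts l c i.succ.castSucc = c i := by
    unfold lapPts
    rw [dif_neg (by simp), dif_neg (by simp; omega)]
    congr 1
  have hlR : ∀ p ∈ Icc (0:ℝ) 1, (∀ k, c k ∈ uIcc p (c i) → c k = c i) → p ≤ c i →
      p ∈ lap l c i.castSucc := by
    intro p hp hk hpi
    refine ⟨?_, by rw [eR]; exact hpi⟩
    unfold lapPts
    split_ifs with h0 h1
    · exact hp.1
    · simp at h1; omega
    · by_contra hlt
      push Not at hlt
      simp only [Fin.val_castSucc] at h0
      have hlt2 : c ⟨i.castSucc.castSucc - 1, by simp; omega⟩ < c i := by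
        apply hmono
        rw [Fin.lt_def]
        simp
        omega
      have := hk _ (by rw [uIcc_of_le hpi]; exact ⟨hlt.le, hlt2.le⟩)
      exact hlt2.ne this
  have hlL : ∀ p ∈ Icc (0:ℝ) 1, (∀ k, c k ∈ uIcc p (c i) → c k = c i) → c i ≤ p →
      p ∈ lap l c i.succ := by
    intro p hp hk hpi
    refine ⟨by rw [eL]; exact hpi, ?_⟩
    unfold lapPts
    split_ifs with h0 h1
    · simp at h0
    · exact hp.2
    · by_contra hlt
      push Not at hlt
      simp only [Fin.val_succ] at h1
      have hlt2 : c i < c ⟨i.succ.succ - 1, by simp; omega⟩ := by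
        apply hmono
        rw [Fin.lt_def]
        simp
      have := hk _ (by rw [uIcc_of_ge hpi]; exact ⟨hlt2.le, hlt.le⟩)
      exact hlt2.ne this.symm
  have hdR : c i ∈ lap l c i.castSucc :=
    hlR _ (Ioo_subset_Icc_self (hI i)) (fun k hk => by simpa using hk) le_rfl
  have hdL : c i ∈ lap l c i.succ :=
    hlL _ (Ioo_subset_Icc_self (hI i)) (fun k hk => by simpa using hk) le_rfl
  have k1 := hs2 i.castSucc
  have k2 := hs2 i.succ
  have k3 := hs1 i
  cases hsc : s i.castSucc
  · have hsn : s i.succ = true := by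
      rw [hsc] at k3
      cases h : s i.succ
      · exact absurd h.symm k3
      · rfl
    rw [hsc] at k1
    rw [hsn] at k2
    simp only [if_true, Bool.false_eq_true, if_false] at k1 k2
    right
    intro p hp hk
    rcases le_total p (c i) with hpi | hpi
    · exact k1.antitoneOn (hlR p hp hk hpi) hdR hpi
    · exact k2.monotoneOn hdL (hlL p hp hk hpi) hpi
  · have hsn : s i.succ = false := by
      rw [hsc] at k3
      cases h : s i.succ
      · rfl
      · exact absurd h.symm k3
    rw [hsc] at k1
    rw [hsn] at k2
    simp only [if_true, Bool.false_eq_true, if_false] at k1 k2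
    left
    intro p hp hk
    rcases le_total p (c i) with hpi | hpi
    · exact k1.monotoneOn (hlR p hp hk hpi) hdR hpi
    · exact k2.antitoneOn hdL (hlL p hp hk hpi) hpi

/-- near a point of `Cr` the turning condition applies -/
theorem near_turn (hI : ∀ c ∈ Cr, c ∈ Ioo (0:ℝ) 1) {d : ℝ} (hd : d ∈ Cr) :
    ∀ᶠ p in nhds d, p ∈ Icc (0:ℝ) 1 ∧ ∀ c ∈ Cr, c ∈ uIcc p d → c = d := by
  classical
  have h1 : ∀ᶠ p in nhds d, p ∈ Ioo (0:ℝ) 1 := isOpen_Ioo.mem_nhds (hI d hd)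
  have hop : IsOpen ((Cr.erase d : Finset ℝ) : Set ℝ)ᶜ :=
    (Finset.finite_toSet _).isClosed.isOpen_compl
  obtain ⟨ε, hε, hb⟩ := Metric.isOpen_iff.1 hop d (by simp)
  filter_upwards [h1, Metric.ball_mem_nhds d hε] with p hp1 hp2
  refine ⟨Ioo_subset_Icc_self hp1, fun c hc hcu => ?_⟩
  by_contra hne
  have h2 : c ∈ ball d ε := by
    rw [Metric.mem_ball, Real.dist_eq] at hp2 ⊢
    rw [abs_lt] at hp2 ⊢
    rw [mem_uIcc] at hcu
    rcases hcu with ⟨q1, q2⟩ | ⟨q1, q2⟩ <;> constructor <;> linarith [hp2.1, hp2.2]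
  exact hb h2 (by simp [hne, hc])

theorem sys_of (l : ℕ) (f : ℝ → ℝ) (c : Fin l → ℝ)
    (hmodal : IsLModal l f c)
    (hsmooth : ContDiff ℝ 3 f)
    (hreg : ∀ x ∈ Icc (0:ℝ) 1, (∀ i, x ≠ c i) → deriv f x ≠ 0)
    (hS : ∀ x ∈ Icc (0:ℝ) 1, (∀ i, x ≠ c i) → schwarzian f x < 0)
    (hnf : ∀ i, NonFlatAt f (c i))
    (hna : ¬ HasAttractingPeriodicOrbit f) :
    ∃ Cr : Finset ℝ, Sys f Cr ∧ ∀ x ∈ Cr, ∃ i, x = c i := by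
  classical
  set Cr : Finset ℝ := Finset.univ.image c with hCr
  have hmem : ∀ x, x ∈ Cr ↔ ∃ i, c i = x := by intro x; simp [hCr]
  have hI : ∀ x ∈ Cr, x ∈ Ioo (0:ℝ) 1 := by
    intro x hx
    obtain ⟨i, rfl⟩ := (hmem x).1 hx
    exact hmodal.2.1 i
  have hnot : ∀ x, x ∉ Cr → ∀ i, x ≠ c i := fun x hx i hxi => hx ((hmem x).2 ⟨i, hxi.symm⟩)
  have hturn : ∀ d ∈ Cr,
    (∀ p ∈ Icc (0:ℝ) 1, (∀ c ∈ Cr, c ∈ uIcc p d → c = d) → f p ≤ f d) ∨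
    (∀ p ∈ Icc (0:ℝ) 1, (∀ c ∈ Cr, c ∈ uIcc p d → c = d) → f d ≤ f p) := by
    intro d hd
    obtain ⟨i, rfl⟩ := (hmem d).1 hd
    rcases turn_of hmodal i with ht | ht
    · exact Or.inl fun p hp hk => ht p hp fun k => hk (c k) ((hmem _).2 ⟨k, rfl⟩)
    · exact Or.inr fun p hp hk => ht p hp fun k => hk (c k) ((hmem _).2 ⟨k, rfl⟩)
  have hcrz : ∀ d ∈ Cr, deriv f d = 0 := by
    intro d hd
    rcases hturn d hd with ht | ht
    · have : IsLocalMax f d := by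
        filter_upwards [near_turn hI hd] with p hp using ht p hp.1 hp.2
      exact this.deriv_eq_zero
    · have : IsLocalMin f d := by
        filter_upwards [near_turn hI hd] with p hp using ht p hp.1 hp.2
      exact this.deriv_eq_zero
  have hreg' : ∀ x ∈ Icc (0:ℝ) 1, x ∉ Cr → deriv f x ≠ 0 := fun x hx hxC =>
    hreg x hx (hnot x hxC)
  refine ⟨Cr, ⟨hsmooth, hmodal.2.2.1, hmodal.2.2.2.1, hmodal.2.2.2.2.1, hI, hcrz, hreg',
    fun x hx hxC => hS x hx (hnot x hxC), hturn, ?_, hna⟩, ?_⟩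
  · apply n3_of hsmooth hreg' hI hcrz
    intro d hd
    obtain ⟨i, rfl⟩ := (hmem d).1 hd
    exact hnf i
  · intro x hx
    obtain ⟨i, hi⟩ := (hmem x).1 hx
    exact ⟨i, hi.symm⟩

end NoHom

/-- A `C³` `l`-modal map with negative Schwarzian derivative, non-flat at each critical
point and with no attracting periodic orbits, has no homterval; consequently the backward
orbit of the critical set is dense in `[0,1]`. -/
theorem no_homterval_and_dense_preimages
    (l : ℕ) (f : ℝ → ℝ) (c : Fin l → ℝ)
    (hmodal : IsLModal l f c)
    (hsmooth : ContDiff ℝ 3 f)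
    (hreg : ∀ x ∈ Icc (0:ℝ) 1, (∀ i, x ≠ c i) → deriv f x ≠ 0)
    (hS : ∀ x ∈ Icc (0:ℝ) 1, (∀ i, x ≠ c i) → schwarzian f x < 0)
    (hnf : ∀ i, NonFlatAt f (c i))
    (hna : ¬ HasAttractingPeriodicOrbit f) :
    ¬ HasHomterval f ∧
      Icc (0:ℝ) 1 ⊆ closure {x | x ∈ Icc (0:ℝ) 1 ∧ ∃ n : ℕ, ∃ i : Fin l, f^[n] x = c i} := by
  obtain ⟨Cr, h, hC⟩ := NoHom.sys_of l f c hmodal hsmooth hreg hS hnf hna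
  constructor
  · rintro ⟨a, b, hab, hsub, hmono⟩
    have ha0 : 0 ≤ a := (hsub ⟨le_rfl, hab.le⟩).1
    have hb1 : b ≤ 1 := (hsub ⟨hab.le, le_rfl⟩).2
    obtain ⟨y, hy, n, hd⟩ := h.core ha0 hab hb1
    have hev : ∀ᶠ z in nhds y, z ∈ Ioo a b ∧ (f^[n] z ∈ Icc (0:ℝ) 1 ∧
        ∀ c ∈ Cr, c ∈ uIcc (f^[n] z) (f^[n] y) → c = f^[n] y) :=
      (isOpen_Ioo.eventually_mem hy).and
        (((h.itcont n).tendsto y).eventually (NoHom.near_turn h.crI hd))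
    obtain ⟨ε, hε, hball⟩ := Metric.eventually_nhds_iff.1 hev
    have hz : ∀ z ∈ Icc (y - ε/2) (y + ε/2), z ∈ Ioo a b ∧ (f^[n] z ∈ Icc (0:ℝ) 1 ∧
        ∀ c ∈ Cr, c ∈ uIcc (f^[n] z) (f^[n] y) → c = f^[n] y) := by
      intro z hz
      apply hball
      rw [Real.dist_eq, abs_lt]
      constructor <;> linarith [hz.1, hz.2]
    have hyI := Ioo_subset_Icc_self hy
    have hu := (hz (y - ε/2) ⟨le_rfl, by linarith⟩).1
    have hv := (hz (y + ε/2) ⟨by linarith, le_rfl⟩).1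
    obtain ⟨z1, hz1, hz1n⟩ := h.nonconst (n+1) (u := y - ε/2) (v := y) (f^[n+1] y)
      (by linarith [hu.1]) (by linarith) (by linarith [hy.2])
    obtain ⟨z2, hz2, hz2n⟩ := h.nonconst (n+1) (u := y) (v := y + ε/2) (f^[n+1] y)
      (by linarith [hy.1]) (by linarith) (by linarith [hv.2])
    have w1 := hz z1 ⟨hz1.1, by linarith [hz1.2]⟩
    have w2 := hz z2 ⟨by linarith [hz2.1], hz2.2⟩
    have hs : ∀ z, f^[n+1] z = f (f^[n] z) := fun z => Function.iterate_succ_apply' f n z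
    rcases h.turn _ hd with ht | ht
    · have t1 := ht _ w1.2.1 w1.2.2
      have t2 := ht _ w2.2.1 w2.2.2
      rw [← hs, ← hs] at t1 t2
      rcases hmono (n+1) with hm | hm
      · exact hz2n (le_antisymm t2 (hm hyI (Ioo_subset_Icc_self w2.1) hz2.1))
      · exact hz1n (le_antisymm t1 (hm (Ioo_subset_Icc_self w1.1) hyI hz1.2))
    · have t1 := ht _ w1.2.1 w1.2.2
      have t2 := ht _ w2.2.1 w2.2.2
      rw [← hs, ← hs] at t1 t2
      rcases hmono (n+1) with hm | hm
      · exact hz1n (le_antisymm (hm (Ioo_subset_Icc_self w1.1) hyI hz1.2) t1)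
      · exact hz2n (le_antisymm (hm hyI (Ioo_subset_Icc_self w2.1) hz2.1) t2)
  · intro x hx
    rw [Metric.mem_closure_iff]
    intro ε hε
    obtain ⟨y, hy, n, hyC⟩ := h.core (s := max 0 (x - ε)) (t := min 1 (x + ε)) (le_max_left _ _)
      (by rw [max_lt_iff, lt_min_iff, lt_min_iff]
          exact ⟨⟨one_pos, by linarith [hx.1]⟩, by linarith [hx.2], by linarith⟩)
      (min_le_left _ _)
    rw [mem_Ioo, max_lt_iff, lt_min_iff] at hy
    obtain ⟨i, hi⟩ := hC _ hyC
    refine ⟨y, ⟨⟨hy.1.1.le, hy.2.1.le⟩, n, i, hi⟩, ?_⟩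
    rw [Real.dist_eq, abs_lt]
    constructor <;> linarith [hy.1.2, hy.2.2]
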